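/- Soundness of the generic linear-use CPS self-translation of EEC: (1) if Γ ⊢ t = u : A in the equational theory of EEC, then Γᶜ ⊢ tᶜ = uᶜ : Aᶜ; (2) if Γ | z:A̲ ⊢ t = u : B̲ in the equational theory of EEC, then Γᶜ | k_z:B̲ᶜ ⊢ tᶜ = uᶜ : A̲ᶜ. -/

import Mathlib

set_option autoImplicit false

namespace EEC

/-! # The enriched effect calculus (EEC)

A deep embedding of the enriched effect calculus of Egger, Møgelberg and
Simpson: value types and computation types, raw terms (de Bruijn indices for
value variables, together with a designated stoup variable `svar`), typing
derivations with an (at most singleton) stoup, the βη-equational theory, the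
simply-typed λ-calculus together with βη-equality and Moggi's computational
λ-calculus equality, the standard cbv/cbn translations of typed λ-calculus
into EEC, Hasegawa's linear-use CPS translations, and the generic linear-use
CPS self-translation of EEC. -/

mutual
  /-- Value types of EEC. -/
  inductive VType : Type
    | base : ℕ → VType                 -- value type constants α
    | unit : VType                     -- 1
    | prod : VType → VType → VType     -- A × B
    | arr : VType → VType → VType      -- A → B
    | comp : CType → VType             -- every computation type is a value type
    | lin : CType → CType → VType      -- A̲ ⊸ B̲
  /-- Computation types of EEC. -/
  inductive CType : Type
    | base : ℕ → CType                 -- computation type constants α̲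
    | cunit : CType                    -- 1̲
    | cand : CType → CType → CType     -- A̲ & B̲
    | carr : VType → CType → CType     -- A ⇒ B̲
    | iunit : CType                    -- I̲
    | bang : VType → CType             -- !A
    | copow : VType → CType → CType    -- !A ⊗ B̲
    | czero : CType                    -- 0̲
    | csum : CType → CType → CType     -- A̲ ⊕ B̲
end

/-- Raw terms of EEC.  Value variables are de Bruijn indices (`var n`, with
`var 0` the innermost bound variable); the unique stoup variable is `svar`
(the constructs `llam`, `copowlet` (in its body) and `ccase` (in its
branches) bind the stoup variable). -/
inductive Tm : Type
  | var : ℕ → Tm                -- value variable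
  | svar : Tm                   -- the stoup variable
  | unit : Tm                   -- * : 1
  | vpair : Tm → Tm → Tm        -- ⟨t,u⟩
  | vfst : Tm → Tm
  | vsnd : Tm → Tm
  | vlam : VType → Tm → Tm      -- λx:A. t
  | vapp : Tm → Tm → Tm
  | cunit : Tm                  -- ⋆ : 1̲
  | cpair : Tm → Tm → Tm        -- ⟨t,u⟩ : A̲ & B̲
  | cfst : Tm → Tm
  | csnd : Tm → Tm
  | clam : VType → Tm → Tm      -- λx:A ⇒ t
  | capp : Tm → Tm → Tm         -- s ⋅ t
  | top : Tm                    -- ⊤ : I̲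
  | ilet : Tm → Tm → Tm         -- t to ⊤. u
  | bang : Tm → Tm              -- !t
  | banglet : Tm → Tm → Tm      -- let !x = t in u   (binds a value variable in u)
  | copow : Tm → Tm → Tm        -- !t ⊗ u
  | copowlet : Tm → Tm → Tm     -- let !x⊗y = s in t (binds a value variable and the stoup variable in t)
  | cimage : CType → Tm → Tm    -- image_{A̲}(t)
  | cinl : Tm → Tm
  | cinr : Tm → Tm
  | ccase : Tm → Tm → Tm → Tm   -- case s of (x. t | y. u)  (branches bind the stoup variable)
  | llam : CType → Tm → Tm      -- λ°z:A̲. t (binds the stoup variable)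
  | lapp : Tm → Tm → Tm         -- s[t]

namespace Tm

/-- Lift a renaming of value variables under a binder. -/
def liftN (f : ℕ → ℕ) : ℕ → ℕ
  | 0 => 0
  | n + 1 => f n + 1

/-- Renaming of value variables. -/
def rename (f : ℕ → ℕ) : Tm → Tm
  | .var n => .var (f n)
  | .svar => .svar
  | .unit => .unit
  | .vpair t u => .vpair (rename f t) (rename f u)
  | .vfst t => .vfst (rename f t)
  | .vsnd t => .vsnd (rename f t)
  | .vlam A t => .vlam A (rename (liftN f) t)
  | .vapp s t => .vapp (rename f s) (rename f t)
  | .cunit => .cunit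
  | .cpair t u => .cpair (rename f t) (rename f u)
  | .cfst t => .cfst (rename f t)
  | .csnd t => .csnd (rename f t)
  | .clam A t => .clam A (rename (liftN f) t)
  | .capp s t => .capp (rename f s) (rename f t)
  | .top => .top
  | .ilet t u => .ilet (rename f t) (rename f u)
  | .bang t => .bang (rename f t)
  | .banglet t u => .banglet (rename f t) (rename (liftN f) u)
  | .copow t u => .copow (rename f t) (rename f u)
  | .copowlet s t => .copowlet (rename f s) (rename (liftN f) t)
  | .cimage A t => .cimage A (rename f t)
  | .cinl t => .cinl (rename f t)
  | .cinr t => .cinr (rename f t)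
  | .ccase s t u => .ccase (rename f s) (rename f t) (rename f u)
  | .llam A t => .llam A (rename f t)
  | .lapp s t => .lapp (rename f s) (rename f t)

/-- Weakening of value variables. -/
def shift (t : Tm) : Tm := rename Nat.succ t

/-- Lift a parallel substitution of value variables under a binder. -/
def liftS (σ : ℕ → Tm) : ℕ → Tm
  | 0 => .var 0
  | n + 1 => shift (σ n)

/-- Parallel (capture-avoiding) substitution for value variables. -/
def psubst (σ : ℕ → Tm) : Tm → Tm
  | .var n => σ n
  | .svar => .svar
  | .unit => .unit
  | .vpair t u => .vpair (psubst σ t) (psubst σ u)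
  | .vfst t => .vfst (psubst σ t)
  | .vsnd t => .vsnd (psubst σ t)
  | .vlam A t => .vlam A (psubst (liftS σ) t)
  | .vapp s t => .vapp (psubst σ s) (psubst σ t)
  | .cunit => .cunit
  | .cpair t u => .cpair (psubst σ t) (psubst σ u)
  | .cfst t => .cfst (psubst σ t)
  | .csnd t => .csnd (psubst σ t)
  | .clam A t => .clam A (psubst (liftS σ) t)
  | .capp s t => .capp (psubst σ s) (psubst σ t)
  | .top => .top
  | .ilet t u => .ilet (psubst σ t) (psubst σ u)
  | .bang t => .bang (psubst σ t)
  | .banglet t u => .banglet (psubst σ t) (psubst (liftS σ) u)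
  | .copow t u => .copow (psubst σ t) (psubst σ u)
  | .copowlet s t => .copowlet (psubst σ s) (psubst (liftS σ) t)
  | .cimage A t => .cimage A (psubst σ t)
  | .cinl t => .cinl (psubst σ t)
  | .cinr t => .cinr (psubst σ t)
  | .ccase s t u => .ccase (psubst σ s) (psubst σ t) (psubst σ u)
  | .llam A t => .llam A (psubst σ t)
  | .lapp s t => .lapp (psubst σ s) (psubst σ t)

/-- Capture-avoiding substitution `t[u/x]` of a term `u` for the innermost
value variable of `t`. -/
def subst0 (u : Tm) (t : Tm) : Tm :=
  psubst (fun n => match n with | 0 => u | m + 1 => .var m) t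

/-- Capture-avoiding substitution `t[u/z]` of a term `u` for the stoup
variable of `t`.  The substitution stops at the stoup-variable binders
(`llam`-bodies, `copowlet`-bodies and `ccase`-branches). -/
def ssubst (u : Tm) : Tm → Tm
  | .var n => .var n
  | .svar => u
  | .unit => .unit
  | .vpair t t' => .vpair (ssubst u t) (ssubst u t')
  | .vfst t => .vfst (ssubst u t)
  | .vsnd t => .vsnd (ssubst u t)
  | .vlam A t => .vlam A (ssubst (shift u) t)
  | .vapp s t => .vapp (ssubst u s) (ssubst u t)
  | .cunit => .cunit
  | .cpair t t' => .cpair (ssubst u t) (ssubst u t')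
  | .cfst t => .cfst (ssubst u t)
  | .csnd t => .csnd (ssubst u t)
  | .clam A t => .clam A (ssubst (shift u) t)
  | .capp s t => .capp (ssubst u s) (ssubst u t)
  | .top => .top
  | .ilet t t' => .ilet (ssubst u t) (ssubst u t')
  | .bang t => .bang (ssubst u t)
  | .banglet t t' => .banglet (ssubst u t) (ssubst (shift u) t')
  | .copow t t' => .copow (ssubst u t) (ssubst u t')
  | .copowlet s t => .copowlet (ssubst u s) t
  | .cimage A t => .cimage A (ssubst u t)
  | .cinl t => .cinl (ssubst u t)
  | .cinr t => .cinr (ssubst u t)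
  | .ccase s t t' => .ccase (ssubst u s) t t'
  | .llam A t => .llam A t
  | .lapp s t => .lapp (ssubst u s) (ssubst u t)

end Tm

/-- Typing derivations of EEC (Figure 1 of the paper).  `Deriv Γ none t A`
is the judgement `Γ ⊢ t : A` (empty stoup); `Deriv Γ (some A̲) t (.comp B̲)`
is the judgement `Γ | z:A̲ ⊢ t : B̲`.  In the rules below `Δ` ranges over an
arbitrary (possibly empty) stoup. -/
inductive Deriv : List VType → Option CType → Tm → VType → Type
  | var (Γ : List VType) (n : ℕ) (A : VType) :
      Γ[n]? = some A → Deriv Γ none (.var n) A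
  | svar (Γ : List VType) (A : CType) : Deriv Γ (some A) .svar (.comp A)
  | unit (Γ : List VType) : Deriv Γ none .unit .unit
  | vpair (Γ : List VType) (t u : Tm) (A B : VType) :
      Deriv Γ none t A → Deriv Γ none u B → Deriv Γ none (.vpair t u) (.prod A B)
  | vfst (Γ : List VType) (t : Tm) (A B : VType) :
      Deriv Γ none t (.prod A B) → Deriv Γ none (.vfst t) A
  | vsnd (Γ : List VType) (t : Tm) (A B : VType) :
      Deriv Γ none t (.prod A B) → Deriv Γ none (.vsnd t) B
  | vlam (Γ : List VType) (t : Tm) (A B : VType) :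
      Deriv (A :: Γ) none t B → Deriv Γ none (.vlam A t) (.arr A B)
  | vapp (Γ : List VType) (s t : Tm) (A B : VType) :
      Deriv Γ none s (.arr A B) → Deriv Γ none t A → Deriv Γ none (.vapp s t) B
  | cunit (Γ : List VType) (Δ : Option CType) : Deriv Γ Δ .cunit (.comp .cunit)
  | cpair (Γ : List VType) (Δ : Option CType) (t u : Tm) (A B : CType) :
      Deriv Γ Δ t (.comp A) → Deriv Γ Δ u (.comp B) →
      Deriv Γ Δ (.cpair t u) (.comp (.cand A B))
  | cfst (Γ : List VType) (Δ : Option CType) (t : Tm) (A B : CType) :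
      Deriv Γ Δ t (.comp (.cand A B)) → Deriv Γ Δ (.cfst t) (.comp A)
  | csnd (Γ : List VType) (Δ : Option CType) (t : Tm) (A B : CType) :
      Deriv Γ Δ t (.comp (.cand A B)) → Deriv Γ Δ (.csnd t) (.comp B)
  | clam (Γ : List VType) (Δ : Option CType) (t : Tm) (A : VType) (B : CType) :
      Deriv (A :: Γ) Δ t (.comp B) → Deriv Γ Δ (.clam A t) (.comp (.carr A B))
  | capp (Γ : List VType) (Δ : Option CType) (s t : Tm) (A : VType) (B : CType) :
      Deriv Γ Δ s (.comp (.carr A B)) → Deriv Γ none t A →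
      Deriv Γ Δ (.capp s t) (.comp B)
  | top (Γ : List VType) : Deriv Γ none .top (.comp .iunit)
  | ilet (Γ : List VType) (Δ : Option CType) (t u : Tm) (A : CType) :
      Deriv Γ Δ t (.comp .iunit) → Deriv Γ none u (.comp A) →
      Deriv Γ Δ (.ilet t u) (.comp A)
  | bang (Γ : List VType) (t : Tm) (A : VType) :
      Deriv Γ none t A → Deriv Γ none (.bang t) (.comp (.bang A))
  | banglet (Γ : List VType) (Δ : Option CType) (t u : Tm) (A : VType) (B : CType) :
      Deriv Γ Δ t (.comp (.bang A)) → Deriv (A :: Γ) none u (.comp B) →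
      Deriv Γ Δ (.banglet t u) (.comp B)
  | copow (Γ : List VType) (Δ : Option CType) (t u : Tm) (A : VType) (B : CType) :
      Deriv Γ none t A → Deriv Γ Δ u (.comp B) →
      Deriv Γ Δ (.copow t u) (.comp (.copow A B))
  | copowlet (Γ : List VType) (Δ : Option CType) (s t : Tm) (A : VType) (B C : CType) :
      Deriv Γ Δ s (.comp (.copow A B)) → Deriv (A :: Γ) (some B) t (.comp C) →
      Deriv Γ Δ (.copowlet s t) (.comp C)
  | cimage (Γ : List VType) (Δ : Option CType) (t : Tm) (A : CType) :
      Deriv Γ Δ t (.comp .czero) → Deriv Γ Δ (.cimage A t) (.comp A)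
  | cinl (Γ : List VType) (Δ : Option CType) (t : Tm) (A B : CType) :
      Deriv Γ Δ t (.comp A) → Deriv Γ Δ (.cinl t) (.comp (.csum A B))
  | cinr (Γ : List VType) (Δ : Option CType) (t : Tm) (A B : CType) :
      Deriv Γ Δ t (.comp B) → Deriv Γ Δ (.cinr t) (.comp (.csum A B))
  | ccase (Γ : List VType) (Δ : Option CType) (s t u : Tm) (A B C : CType) :
      Deriv Γ Δ s (.comp (.csum A B)) → Deriv Γ (some A) t (.comp C) →
      Deriv Γ (some B) u (.comp C) → Deriv Γ Δ (.ccase s t u) (.comp C)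
  | llam (Γ : List VType) (t : Tm) (A B : CType) :
      Deriv Γ (some A) t (.comp B) → Deriv Γ none (.llam A t) (.lin A B)
  | lapp (Γ : List VType) (Δ : Option CType) (s t : Tm) (A B : CType) :
      Deriv Γ none s (.lin A B) → Deriv Γ Δ t (.comp A) →
      Deriv Γ Δ (.lapp s t) (.comp B)

/-- The equational theory of EEC: the smallest type-respecting congruence
containing the βη-equalities of Figure 2 of the paper. -/
inductive EEq : List VType → Option CType → Tm → Tm → VType → Prop
  -- equivalence
  | refl {Γ Δ t A} : Deriv Γ Δ t A → EEq Γ Δ t t A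
  | symm {Γ Δ t u A} : EEq Γ Δ t u A → EEq Γ Δ u t A
  | trans {Γ Δ t u v A} : EEq Γ Δ t u A → EEq Γ Δ u v A → EEq Γ Δ t v A
  -- congruence rules
  | vpair_cong {Γ t t' u u' A B} : EEq Γ none t t' A → EEq Γ none u u' B →
      EEq Γ none (.vpair t u) (.vpair t' u') (.prod A B)
  | vfst_cong {Γ t t' A B} : EEq Γ none t t' (.prod A B) →
      EEq Γ none (.vfst t) (.vfst t') A
  | vsnd_cong {Γ t t' A B} : EEq Γ none t t' (.prod A B) →
      EEq Γ none (.vsnd t) (.vsnd t') B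
  | vlam_cong {Γ t t' A B} : EEq (A :: Γ) none t t' B →
      EEq Γ none (.vlam A t) (.vlam A t') (.arr A B)
  | vapp_cong {Γ s s' t t' A B} : EEq Γ none s s' (.arr A B) → EEq Γ none t t' A →
      EEq Γ none (.vapp s t) (.vapp s' t') B
  | cpair_cong {Γ Δ t t' u u' A B} : EEq Γ Δ t t' (.comp A) → EEq Γ Δ u u' (.comp B) →
      EEq Γ Δ (.cpair t u) (.cpair t' u') (.comp (.cand A B))
  | cfst_cong {Γ Δ t t' A B} : EEq Γ Δ t t' (.comp (.cand A B)) →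
      EEq Γ Δ (.cfst t) (.cfst t') (.comp A)
  | csnd_cong {Γ Δ t t' A B} : EEq Γ Δ t t' (.comp (.cand A B)) →
      EEq Γ Δ (.csnd t) (.csnd t') (.comp B)
  | clam_cong {Γ Δ t t' A B} : EEq (A :: Γ) Δ t t' (.comp B) →
      EEq Γ Δ (.clam A t) (.clam A t') (.comp (.carr A B))
  | capp_cong {Γ Δ s s' t t' A B} : EEq Γ Δ s s' (.comp (.carr A B)) → EEq Γ none t t' A →
      EEq Γ Δ (.capp s t) (.capp s' t') (.comp B)
  | ilet_cong {Γ Δ t t' u u' A} : EEq Γ Δ t t' (.comp .iunit) → EEq Γ none u u' (.comp A) →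
      EEq Γ Δ (.ilet t u) (.ilet t' u') (.comp A)
  | bang_cong {Γ t t' A} : EEq Γ none t t' A →
      EEq Γ none (.bang t) (.bang t') (.comp (.bang A))
  | banglet_cong {Γ Δ t t' u u' A B} : EEq Γ Δ t t' (.comp (.bang A)) →
      EEq (A :: Γ) none u u' (.comp B) →
      EEq Γ Δ (.banglet t u) (.banglet t' u') (.comp B)
  | copow_cong {Γ Δ t t' u u' A B} : EEq Γ none t t' A → EEq Γ Δ u u' (.comp B) →
      EEq Γ Δ (.copow t u) (.copow t' u') (.comp (.copow A B))
  | copowlet_cong {Γ Δ s s' t t' A B C} : EEq Γ Δ s s' (.comp (.copow A B)) →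
      EEq (A :: Γ) (some B) t t' (.comp C) →
      EEq Γ Δ (.copowlet s t) (.copowlet s' t') (.comp C)
  | cimage_cong {Γ Δ t t' A} : EEq Γ Δ t t' (.comp .czero) →
      EEq Γ Δ (.cimage A t) (.cimage A t') (.comp A)
  | cinl_cong {Γ Δ t t' A B} : EEq Γ Δ t t' (.comp A) →
      EEq Γ Δ (.cinl t) (.cinl t') (.comp (.csum A B))
  | cinr_cong {Γ Δ t t' A B} : EEq Γ Δ t t' (.comp B) →
      EEq Γ Δ (.cinr t) (.cinr t') (.comp (.csum A B))
  | ccase_cong {Γ Δ s s' t t' u u' A B C} : EEq Γ Δ s s' (.comp (.csum A B)) →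
      EEq Γ (some A) t t' (.comp C) → EEq Γ (some B) u u' (.comp C) →
      EEq Γ Δ (.ccase s t u) (.ccase s' t' u') (.comp C)
  | llam_cong {Γ t t' A B} : EEq Γ (some A) t t' (.comp B) →
      EEq Γ none (.llam A t) (.llam A t') (.lin A B)
  | lapp_cong {Γ Δ s s' t t' A B} : EEq Γ none s s' (.lin A B) → EEq Γ Δ t t' (.comp A) →
      EEq Γ Δ (.lapp s t) (.lapp s' t') (.comp B)
  -- the equalities of Figure 2
  | unit_eta {Γ t} : Deriv Γ none t .unit → EEq Γ none t .unit .unit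
  | vfst_beta {Γ t u A B} : Deriv Γ none t A → Deriv Γ none u B →
      EEq Γ none (.vfst (.vpair t u)) t A
  | vsnd_beta {Γ t u A B} : Deriv Γ none t A → Deriv Γ none u B →
      EEq Γ none (.vsnd (.vpair t u)) u B
  | vpair_eta {Γ t A B} : Deriv Γ none t (.prod A B) →
      EEq Γ none (.vpair (.vfst t) (.vsnd t)) t (.prod A B)
  | vlam_beta {Γ t u A B} : Deriv (A :: Γ) none t B → Deriv Γ none u A →
      EEq Γ none (.vapp (.vlam A t) u) (Tm.subst0 u t) B
  | vlam_eta {Γ t A B} : Deriv Γ none t (.arr A B) →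
      EEq Γ none (.vlam A (.vapp (Tm.shift t) (.var 0))) t (.arr A B)
  | cunit_eta {Γ Δ t} : Deriv Γ Δ t (.comp .cunit) → EEq Γ Δ t .cunit (.comp .cunit)
  | cfst_beta {Γ Δ t u A B} : Deriv Γ Δ t (.comp A) → Deriv Γ Δ u (.comp B) →
      EEq Γ Δ (.cfst (.cpair t u)) t (.comp A)
  | csnd_beta {Γ Δ t u A B} : Deriv Γ Δ t (.comp A) → Deriv Γ Δ u (.comp B) →
      EEq Γ Δ (.csnd (.cpair t u)) u (.comp B)
  | cpair_eta {Γ Δ t A B} : Deriv Γ Δ t (.comp (.cand A B)) →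
      EEq Γ Δ (.cpair (.cfst t) (.csnd t)) t (.comp (.cand A B))
  | clam_beta {Γ Δ t u A B} : Deriv (A :: Γ) Δ t (.comp B) → Deriv Γ none u A →
      EEq Γ Δ (.capp (.clam A t) u) (Tm.subst0 u t) (.comp B)
  | clam_eta {Γ Δ t A B} : Deriv Γ Δ t (.comp (.carr A B)) →
      EEq Γ Δ (.clam A (.capp (Tm.shift t) (.var 0))) t (.comp (.carr A B))
  | ilet_beta {Γ t A} : Deriv Γ none t (.comp A) →
      EEq Γ none (.ilet .top t) t (.comp A)
  | ilet_eta {Γ Δ t u A} : Deriv Γ Δ t (.comp .iunit) → Deriv Γ (some .iunit) u (.comp A) →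
      EEq Γ Δ (.ilet t (Tm.ssubst .top u)) (Tm.ssubst t u) (.comp A)
  | bang_beta {Γ t u A B} : Deriv Γ none t A → Deriv (A :: Γ) none u (.comp B) →
      EEq Γ none (.banglet (.bang t) u) (Tm.subst0 t u) (.comp B)
  | bang_eta {Γ Δ t u A B} : Deriv Γ Δ t (.comp (.bang A)) →
      Deriv Γ (some (.bang A)) u (.comp B) →
      EEq Γ Δ (.banglet t (Tm.ssubst (.bang (.var 0)) (Tm.shift u))) (Tm.ssubst t u) (.comp B)
  | copow_beta {Γ Δ t s u A B C} : Deriv Γ none t A → Deriv Γ Δ s (.comp B) →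
      Deriv (A :: Γ) (some B) u (.comp C) →
      EEq Γ Δ (.copowlet (.copow t s) u) (Tm.ssubst s (Tm.subst0 t u)) (.comp C)
  | copow_eta {Γ Δ t u A B C} : Deriv Γ Δ t (.comp (.copow A B)) →
      Deriv Γ (some (.copow A B)) u (.comp C) →
      EEq Γ Δ (.copowlet t (Tm.ssubst (.copow (.var 0) .svar) (Tm.shift u))) (Tm.ssubst t u) (.comp C)
  | czero_eta {Γ Δ t u A} : Deriv Γ Δ t (.comp .czero) → Deriv Γ (some .czero) u (.comp A) →
      EEq Γ Δ (.cimage A t) (Tm.ssubst t u) (.comp A)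
  | csum_beta_inl {Γ Δ t u u' A B C} : Deriv Γ (some A) u (.comp C) →
      Deriv Γ (some B) u' (.comp C) → Deriv Γ Δ t (.comp A) →
      EEq Γ Δ (.ccase (.cinl t) u u') (Tm.ssubst t u) (.comp C)
  | csum_beta_inr {Γ Δ t u u' A B C} : Deriv Γ (some A) u (.comp C) →
      Deriv Γ (some B) u' (.comp C) → Deriv Γ Δ t (.comp B) →
      EEq Γ Δ (.ccase (.cinr t) u u') (Tm.ssubst t u') (.comp C)
  | csum_eta {Γ Δ t u A B C} : Deriv Γ Δ t (.comp (.csum A B)) →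
      Deriv Γ (some (.csum A B)) u (.comp C) →
      EEq Γ Δ (.ccase t (Tm.ssubst (.cinl .svar) u) (Tm.ssubst (.cinr .svar) u)) (Tm.ssubst t u) (.comp C)
  | llam_beta {Γ Δ t u A B} : Deriv Γ (some A) t (.comp B) → Deriv Γ Δ u (.comp A) →
      EEq Γ Δ (.lapp (.llam A t) u) (Tm.ssubst u t) (.comp B)
  | llam_eta {Γ t A B} : Deriv Γ none t (.lin A B) →
      EEq Γ none (.llam A (.lapp t .svar)) t (.lin A B)

end EEC

namespace EEC

/-! ## The generic linear-use CPS self-translation of EEC (Figures 4–6) -/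

mutual
  /-- CPS translation `Aᶜ` of value types, relative to the result type `R̲`. -/
  def cpsV (R : CType) : VType → VType
    | .base a => .base a
    | .unit => .unit
    | .prod A B => .prod (cpsV R A) (cpsV R B)
    | .arr A B => .arr (cpsV R A) (cpsV R B)
    | .comp A => .lin (cpsC R A) R
    | .lin A B => .lin (cpsC R B) (cpsC R A)
  /-- CPS translation `A̲ᶜ` of computation types, relative to the result type
  `R̲` (a computation-type constant equal to `R̲` is translated to `I̲`). -/
  def cpsC (R : CType) : CType → CType
    | .base a =>
        match R with
        | .base b => if b = a then .iunit else .base a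
        | _ => .base a
    | .cunit => .czero
    | .cand A B => .csum (cpsC R A) (cpsC R B)
    | .carr A B => .copow (cpsV R A) (cpsC R B)
    | .iunit => R
    | .bang A => .carr (cpsV R A) R
    | .copow A B => .carr (cpsV R A) (cpsC R B)
    | .czero => .cunit
    | .csum A B => .cand (cpsC R A) (cpsC R B)
end

/-- Pointwise CPS translation `Γᶜ` of a context. -/
def cpsCtx (R : CType) (Γ : List VType) : List VType := Γ.map (cpsV R)

/-- The generic linear-use CPS self-translation on terms (Figures 5 and 6 of
the paper), defined by recursion on typing derivations.  A value judgement
`Γ ⊢ t : A` is sent to a term `tᶜ` with `Γᶜ ⊢ tᶜ : Aᶜ`, and a stoup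
judgement `Γ | z:A̲ ⊢ t : B̲` is sent (contravariantly) to a term `tᶜ` with
`Γᶜ | k_z:B̲ᶜ ⊢ tᶜ : A̲ᶜ`. -/
def cps (R : CType) : {Γ : List VType} → {Δ : Option CType} → {t : Tm} → {A : VType} →
    Deriv Γ Δ t A → Tm
  | _, _, _, _, .var _ n _ _ => .var n
  | _, _, _, _, .svar _ _ => .svar
  | _, _, _, _, .unit _ => .unit
  | _, _, _, _, .vpair _ _ _ _ _ d1 d2 => .vpair (cps R d1) (cps R d2)
  | _, _, _, _, .vfst _ _ _ _ d => .vfst (cps R d)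
  | _, _, _, _, .vsnd _ _ _ _ d => .vsnd (cps R d)
  | _, _, _, _, .vlam _ _ A _ d => .vlam (cpsV R A) (cps R d)
  | _, _, _, _, .vapp _ _ _ _ _ d1 d2 => .vapp (cps R d1) (cps R d2)
  | _, _, _, _, .cunit _ none => .llam .czero (.cimage R .svar)
  | _, _, _, _, .cunit _ (some D) => .cimage (cpsC R D) .svar
  | _, _, _, _, .cpair _ none _ _ A B d1 d2 =>
      .llam (.csum (cpsC R A) (cpsC R B))
        (.ccase .svar (.lapp (cps R d1) .svar) (.lapp (cps R d2) .svar))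
  | _, _, _, _, .cpair _ (some _) _ _ _ _ d1 d2 => .ccase .svar (cps R d1) (cps R d2)
  | _, _, _, _, .cfst _ none _ A _ d => .llam (cpsC R A) (.lapp (cps R d) (.cinl .svar))
  | _, _, _, _, .cfst _ (some _) _ _ _ d => Tm.ssubst (.cinl .svar) (cps R d)
  | _, _, _, _, .csnd _ none _ _ B d => .llam (cpsC R B) (.lapp (cps R d) (.cinr .svar))
  | _, _, _, _, .csnd _ (some _) _ _ _ d => Tm.ssubst (.cinr .svar) (cps R d)
  | _, _, _, _, .clam _ none _ A B d =>
      .llam (.copow (cpsV R A) (cpsC R B)) (.copowlet .svar (.lapp (cps R d) .svar))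
  | _, _, _, _, .clam _ (some _) _ _ _ d => .copowlet .svar (cps R d)
  | _, _, _, _, .capp _ none _ _ _ B d1 d2 =>
      .llam (cpsC R B) (.lapp (cps R d1) (.copow (cps R d2) .svar))
  | _, _, _, _, .capp _ (some _) _ _ _ _ d1 d2 =>
      Tm.ssubst (.copow (cps R d2) .svar) (cps R d1)
  | _, _, _, _, .top _ => .llam R .svar
  | _, _, _, _, .ilet _ none _ _ A d1 d2 =>
      .llam (cpsC R A) (.lapp (cps R d1) (.lapp (cps R d2) .svar))
  | _, _, _, _, .ilet _ (some _) _ _ _ d1 d2 =>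
      Tm.ssubst (.lapp (cps R d2) .svar) (cps R d1)
  | _, _, _, _, .bang _ _ A d => .llam (.carr (cpsV R A) R) (.capp .svar (cps R d))
  | _, _, _, _, .banglet _ none _ _ A B d1 d2 =>
      .llam (cpsC R B) (.lapp (cps R d1) (.clam (cpsV R A) (.lapp (cps R d2) .svar)))
  | _, _, _, _, .banglet _ (some _) _ _ A _ d1 d2 =>
      Tm.ssubst (.clam (cpsV R A) (.lapp (cps R d2) .svar)) (cps R d1)
  | _, _, _, _, .copow _ none _ _ A B d1 d2 =>
      .llam (.carr (cpsV R A) (cpsC R B)) (.lapp (cps R d2) (.capp .svar (cps R d1)))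
  | _, _, _, _, .copow _ (some _) _ _ _ _ d1 d2 =>
      Tm.ssubst (.capp .svar (cps R d1)) (cps R d2)
  | _, _, _, _, .copowlet _ none _ _ A _ C d1 d2 =>
      .llam (cpsC R C) (.lapp (cps R d1) (.clam (cpsV R A) (cps R d2)))
  | _, _, _, _, .copowlet _ (some _) _ _ A _ _ d1 d2 =>
      Tm.ssubst (.clam (cpsV R A) (cps R d2)) (cps R d1)
  | _, _, _, _, .cimage _ none _ A d => .llam (cpsC R A) (.lapp (cps R d) .cunit)
  | _, _, _, _, .cimage _ (some _) _ _ d => Tm.ssubst .cunit (cps R d)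
  | _, _, _, _, .cinl _ none _ A B d =>
      .llam (.cand (cpsC R A) (cpsC R B)) (.lapp (cps R d) (.cfst .svar))
  | _, _, _, _, .cinl _ (some _) _ _ _ d => Tm.ssubst (.cfst .svar) (cps R d)
  | _, _, _, _, .cinr _ none _ A B d =>
      .llam (.cand (cpsC R A) (cpsC R B)) (.lapp (cps R d) (.csnd .svar))
  | _, _, _, _, .cinr _ (some _) _ _ _ d => Tm.ssubst (.csnd .svar) (cps R d)
  | _, _, _, _, .ccase _ none _ _ _ _ _ C d1 d2 d3 =>
      .llam (cpsC R C) (.lapp (cps R d1) (.cpair (cps R d2) (cps R d3)))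
  | _, _, _, _, .ccase _ (some _) _ _ _ _ _ _ d1 d2 d3 =>
      Tm.ssubst (.cpair (cps R d2) (cps R d3)) (cps R d1)
  | _, _, _, _, .llam _ _ _ B d => .llam (cpsC R B) (cps R d)
  | _, _, _, _, .lapp _ none _ _ _ B d1 d2 =>
      .llam (cpsC R B) (.lapp (cps R d2) (.lapp (cps R d1) .svar))
  | _, _, _, _, .lapp _ (some _) _ _ _ _ d1 d2 =>
      Tm.ssubst (.lapp (cps R d1) .svar) (cps R d2)

end EEC

namespace EEC

/-! ## The type isomorphisms `ι` of Figure 7, with explicit inverses -/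

mutual
  /-- The closed term `ι_A : (Aᶜ)ᶜ → A` (Figure 7). -/
  def iotaV (R : CType) : VType → Tm
    | .base a => .vlam (.base a) (.var 0)
    | .unit => .vlam .unit .unit
    | .prod A B => .vlam (cpsV R (cpsV R (.prod A B)))
        (.vpair (.vapp (iotaV R A) (.vfst (.var 0))) (.vapp (iotaV R B) (.vsnd (.var 0))))
    | .arr A B => .vlam (cpsV R (cpsV R (.arr A B)))
        (.vlam A (.vapp (iotaV R B) (.vapp (.var 1) (.vapp (iotaVinv R A) (.var 0)))))
    | .comp A => .vlam (cpsV R (cpsV R (.comp A)))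
        (.lapp (iotaC R A) (.lapp (.var 0) .top))
    | .lin A B => .vlam (cpsV R (cpsV R (.lin A B)))
        (.llam A (.lapp (iotaC R B) (.lapp (.var 0) (.lapp (iotaCinv R A) .svar))))
  /-- The closed term `ι_A⁻¹ : A → (Aᶜ)ᶜ`. -/
  def iotaVinv (R : CType) : VType → Tm
    | .base a => .vlam (.base a) (.var 0)
    | .unit => .vlam .unit .unit
    | .prod A B => .vlam (.prod A B)
        (.vpair (.vapp (iotaVinv R A) (.vfst (.var 0))) (.vapp (iotaVinv R B) (.vsnd (.var 0))))
    | .arr A B => .vlam (.arr A B)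
        (.vlam (cpsV R (cpsV R A)) (.vapp (iotaVinv R B) (.vapp (.var 1) (.vapp (iotaV R A) (.var 0)))))
    | .comp A => .vlam (.comp A)
        (.llam .iunit (.ilet .svar (.lapp (iotaCinv R A) (.var 0))))
    | .lin A B => .vlam (.lin A B)
        (.llam (cpsC R (cpsC R A)) (.lapp (iotaCinv R B) (.lapp (.var 0) (.lapp (iotaC R A) .svar))))
  /-- The closed term `ι_A̲ : (A̲ᶜ)ᶜ ⊸ A̲` (Figure 7). -/
  def iotaC (R : CType) : CType → Tm
    | .base a => .llam (cpsC R (cpsC R (.base a))) .svar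
    | .cunit => .llam (cpsC R (cpsC R .cunit)) .cunit
    | .cand A B => .llam (cpsC R (cpsC R (.cand A B)))
        (.cpair (.lapp (iotaC R A) (.cfst .svar)) (.lapp (iotaC R B) (.csnd .svar)))
    | .carr A B => .llam (cpsC R (cpsC R (.carr A B)))
        (.clam A (.lapp (iotaC R B) (.capp .svar (.vapp (iotaVinv R A) (.var 0)))))
    | .iunit => .llam (cpsC R (cpsC R .iunit)) .svar
    | .bang A => .llam (cpsC R (cpsC R (.bang A)))
        (.copowlet .svar (.ilet .svar (.bang (.vapp (iotaV R A) (.var 0)))))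
    | .copow A B => .llam (cpsC R (cpsC R (.copow A B)))
        (.copowlet .svar (.copow (.vapp (iotaV R A) (.var 0)) (.lapp (iotaC R B) .svar)))
    | .czero => .llam (cpsC R (cpsC R .czero)) .svar
    | .csum A B => .llam (cpsC R (cpsC R (.csum A B)))
        (.ccase .svar (.cinl (.lapp (iotaC R A) .svar)) (.cinr (.lapp (iotaC R B) .svar)))
  /-- The closed term `ι_A̲⁻¹ : A̲ ⊸ (A̲ᶜ)ᶜ`. -/
  def iotaCinv (R : CType) : CType → Tm
    | .base a => .llam (.base a) .svar
    | .cunit => .llam .cunit .cunit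
    | .cand A B => .llam (.cand A B)
        (.cpair (.lapp (iotaCinv R A) (.cfst .svar)) (.lapp (iotaCinv R B) (.csnd .svar)))
    | .carr A B => .llam (.carr A B)
        (.clam (cpsV R (cpsV R A)) (.lapp (iotaCinv R B) (.capp .svar (.vapp (iotaV R A) (.var 0)))))
    | .iunit => .llam .iunit .svar
    | .bang A => .llam (.bang A)
        (.banglet .svar (.copow (.vapp (iotaVinv R A) (.var 0)) .top))
    | .copow A B => .llam (.copow A B)
        (.copowlet .svar (.copow (.vapp (iotaVinv R A) (.var 0)) (.lapp (iotaCinv R B) .svar)))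
    | .czero => .llam .czero .svar
    | .csum A B => .llam (.csum A B)
        (.ccase .svar (.cinl (.lapp (iotaCinv R A) .svar)) (.cinr (.lapp (iotaCinv R B) .svar)))
end

/-- The substitution `[ι⁻¹(Γ)]`, replacing each variable `xᵢ : Cᵢ` of `Γ` by
`ι_{Cᵢ}⁻¹(xᵢ)`. -/
def iotaSubst (R : CType) (Γ : List VType) (t : Tm) : Tm :=
  Tm.psubst (fun n =>
    match Γ[n]? with
    | some C => .vapp (iotaVinv R C) (.var n)
    | none => .var n) t

/-! ## The simply-typed λ-calculus -/

/-- Simple types. -/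
inductive STy : Type
  | base : ℕ → STy
  | unit : STy
  | prod : STy → STy → STy
  | arr : STy → STy → STy

/-- Raw simply-typed λ-terms (de Bruijn indices). -/
inductive LTm : Type
  | var : ℕ → LTm
  | unit : LTm
  | pair : LTm → LTm → LTm
  | fst : LTm → LTm
  | snd : LTm → LTm
  | lam : STy → LTm → LTm
  | app : LTm → LTm → LTm

namespace LTm

/-- Renaming of variables. -/
def rename (f : ℕ → ℕ) : LTm → LTm
  | .var n => .var (f n)
  | .unit => .unit
  | .pair M N => .pair (rename f M) (rename f N)
  | .fst M => .fst (rename f M)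
  | .snd M => .snd (rename f M)
  | .lam σ M => .lam σ (rename (Tm.liftN f) M)
  | .app M N => .app (rename f M) (rename f N)

/-- Weakening. -/
def shift (M : LTm) : LTm := rename Nat.succ M

/-- Parallel capture-avoiding substitution. -/
def psubst (σ : ℕ → LTm) : LTm → LTm
  | .var n => σ n
  | .unit => .unit
  | .pair M N => .pair (psubst σ M) (psubst σ N)
  | .fst M => .fst (psubst σ M)
  | .snd M => .snd (psubst σ M)
  | .lam τ M => .lam τ (psubst (fun n => match n with | 0 => .var 0 | m + 1 => shift (σ m)) M)
  | .app M N => .app (psubst σ M) (psubst σ N)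

/-- Capture-avoiding substitution `M[N/x]` for the innermost variable. -/
def subst0 (N : LTm) (M : LTm) : LTm :=
  psubst (fun n => match n with | 0 => N | m + 1 => .var m) M

end LTm

/-- Typing derivations of the simply-typed λ-calculus (Figure 3). -/
inductive LDeriv : List STy → LTm → STy → Type
  | var (Θ : List STy) (n : ℕ) (σ : STy) : Θ[n]? = some σ → LDeriv Θ (.var n) σ
  | unit (Θ : List STy) : LDeriv Θ .unit .unit
  | pair (Θ : List STy) (M N : LTm) (σ τ : STy) :
      LDeriv Θ M σ → LDeriv Θ N τ → LDeriv Θ (.pair M N) (.prod σ τ)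
  | fst (Θ : List STy) (M : LTm) (σ τ : STy) :
      LDeriv Θ M (.prod σ τ) → LDeriv Θ (.fst M) σ
  | snd (Θ : List STy) (M : LTm) (σ τ : STy) :
      LDeriv Θ M (.prod σ τ) → LDeriv Θ (.snd M) τ
  | lam (Θ : List STy) (M : LTm) (σ τ : STy) :
      LDeriv (σ :: Θ) M τ → LDeriv Θ (.lam σ M) (.arr σ τ)
  | app (Θ : List STy) (M N : LTm) (σ τ : STy) :
      LDeriv Θ M (.arr σ τ) → LDeriv Θ N σ → LDeriv Θ (.app M N) τ

/-- Values of the (call-by-value) λ-calculus. -/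
inductive LVal : LTm → Prop
  | var (n : ℕ) : LVal (.var n)
  | unit : LVal .unit
  | lam (σ : STy) (M : LTm) : LVal (.lam σ M)
  | pair {M N : LTm} : LVal M → LVal N → LVal (.pair M N)

/-- βη-equality of the simply-typed λ-calculus. -/
inductive LBetaEta : List STy → LTm → LTm → STy → Prop
  | refl {Θ M σ} : LDeriv Θ M σ → LBetaEta Θ M M σ
  | symm {Θ M N σ} : LBetaEta Θ M N σ → LBetaEta Θ N M σ
  | trans {Θ M N P σ} : LBetaEta Θ M N σ → LBetaEta Θ N P σ → LBetaEta Θ M P σ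
  | pair_cong {Θ M M' N N' σ τ} : LBetaEta Θ M M' σ → LBetaEta Θ N N' τ →
      LBetaEta Θ (.pair M N) (.pair M' N') (.prod σ τ)
  | fst_cong {Θ M M' σ τ} : LBetaEta Θ M M' (.prod σ τ) → LBetaEta Θ (.fst M) (.fst M') σ
  | snd_cong {Θ M M' σ τ} : LBetaEta Θ M M' (.prod σ τ) → LBetaEta Θ (.snd M) (.snd M') τ
  | lam_cong {Θ M M' σ τ} : LBetaEta (σ :: Θ) M M' τ →
      LBetaEta Θ (.lam σ M) (.lam σ M') (.arr σ τ)
  | app_cong {Θ M M' N N' σ τ} : LBetaEta Θ M M' (.arr σ τ) → LBetaEta Θ N N' σ →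
      LBetaEta Θ (.app M N) (.app M' N') τ
  | beta {Θ M N σ τ} : LDeriv (σ :: Θ) M τ → LDeriv Θ N σ →
      LBetaEta Θ (.app (.lam σ M) N) (LTm.subst0 N M) τ
  | eta {Θ M σ τ} : LDeriv Θ M (.arr σ τ) →
      LBetaEta Θ (.lam σ (.app (LTm.shift M) (.var 0))) M (.arr σ τ)
  | fst_beta {Θ M N σ τ} : LDeriv Θ M σ → LDeriv Θ N τ →
      LBetaEta Θ (.fst (.pair M N)) M σ
  | snd_beta {Θ M N σ τ} : LDeriv Θ M σ → LDeriv Θ N τ →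
      LBetaEta Θ (.snd (.pair M N)) N τ
  | pair_eta {Θ M σ τ} : LDeriv Θ M (.prod σ τ) →
      LBetaEta Θ (.pair (.fst M) (.snd M)) M (.prod σ τ)
  | unit_eta {Θ M} : LDeriv Θ M .unit → LBetaEta Θ M .unit .unit

/-- Equality in Moggi's computational λ-calculus `λc` (call-by-value
βη-equalities restricted to values, together with the `let`-laws, expressed
via the standard encoding `let x = M in N := (λx.N) M`). -/
inductive LamC : List STy → LTm → LTm → STy → Prop
  | refl {Θ M σ} : LDeriv Θ M σ → LamC Θ M M σ
  | symm {Θ M N σ} : LamC Θ M N σ → LamC Θ N M σ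
  | trans {Θ M N P σ} : LamC Θ M N σ → LamC Θ N P σ → LamC Θ M P σ
  | pair_cong {Θ M M' N N' σ τ} : LamC Θ M M' σ → LamC Θ N N' τ →
      LamC Θ (.pair M N) (.pair M' N') (.prod σ τ)
  | fst_cong {Θ M M' σ τ} : LamC Θ M M' (.prod σ τ) → LamC Θ (.fst M) (.fst M') σ
  | snd_cong {Θ M M' σ τ} : LamC Θ M M' (.prod σ τ) → LamC Θ (.snd M) (.snd M') τ
  | lam_cong {Θ M M' σ τ} : LamC (σ :: Θ) M M' τ →
      LamC Θ (.lam σ M) (.lam σ M') (.arr σ τ)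
  | app_cong {Θ M M' N N' σ τ} : LamC Θ M M' (.arr σ τ) → LamC Θ N N' σ →
      LamC Θ (.app M N) (.app M' N') τ
  | beta_v {Θ M V σ τ} : LDeriv (σ :: Θ) M τ → LDeriv Θ V σ → LVal V →
      LamC Θ (.app (.lam σ M) V) (LTm.subst0 V M) τ
  | eta_v {Θ V σ τ} : LVal V → LDeriv Θ V (.arr σ τ) →
      LamC Θ (.lam σ (.app (LTm.shift V) (.var 0))) V (.arr σ τ)
  | fst_beta_v {Θ V W σ τ} : LVal V → LVal W → LDeriv Θ V σ → LDeriv Θ W τ →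
      LamC Θ (.fst (.pair V W)) V σ
  | snd_beta_v {Θ V W σ τ} : LVal V → LVal W → LDeriv Θ V σ → LDeriv Θ W τ →
      LamC Θ (.snd (.pair V W)) W τ
  | pair_eta_v {Θ V σ τ} : LVal V → LDeriv Θ V (.prod σ τ) →
      LamC Θ (.pair (.fst V) (.snd V)) V (.prod σ τ)
  | unit_eta_v {Θ V} : LVal V → LDeriv Θ V .unit → LamC Θ V .unit .unit
  | let_eta {Θ M σ} : LDeriv Θ M σ → LamC Θ (.app (.lam σ (.var 0)) M) M σ
  | let_assoc {Θ M N L σ ρ τ} : LDeriv (σ :: Θ) M τ → LDeriv (ρ :: Θ) N σ →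
      LDeriv Θ L ρ →
      LamC Θ (.app (.lam σ M) (.app (.lam ρ N) L))
        (.app (.lam ρ (.app (.lam σ (LTm.rename (Tm.liftN Nat.succ) M)) N)) L) τ
  | app_left {Θ M N σ τ} : LDeriv Θ M (.arr σ τ) → LDeriv Θ N σ →
      LamC Θ (.app M N) (.app (.lam (.arr σ τ) (.app (.var 0) (LTm.shift N))) M) τ
  | app_right {Θ V N σ τ} : LVal V → LDeriv Θ V (.arr σ τ) → LDeriv Θ N σ →
      LamC Θ (.app V N) (.app (.lam σ (.app (LTm.shift V) (.var 0))) N) τ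
  | pair_left {Θ M N σ τ} : LDeriv Θ M σ → LDeriv Θ N τ →
      LamC Θ (.pair M N) (.app (.lam σ (.pair (.var 0) (LTm.shift N))) M) (.prod σ τ)
  | pair_right {Θ V N σ τ} : LVal V → LDeriv Θ V σ → LDeriv Θ N τ →
      LamC Θ (.pair V N) (.app (.lam τ (.pair (LTm.shift V) (.var 0))) N) (.prod σ τ)
  | fst_cc {Θ M σ τ} : LDeriv Θ M (.prod σ τ) →
      LamC Θ (.fst M) (.app (.lam (.prod σ τ) (.fst (.var 0))) M) σ
  | snd_cc {Θ M σ τ} : LDeriv Θ M (.prod σ τ) →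
      LamC Θ (.snd M) (.app (.lam (.prod σ τ) (.snd (.var 0))) M) τ

end EEC

namespace EEC

/-! ## The standard cbv and cbn translations of typed λ-calculus into EEC -/

/-- The computation-type constant `α̲` associated with a simply-typed
λ-calculus type constant `α` (the association is injective but not
surjective, so that some computation-type constants of EEC are different
from `α̲` for every λ-calculus type constant `α`). -/
def assocC (a : ℕ) : CType := .base (a + 1)

/-- The call-by-value translation `σᵛ` on types. -/
def cbvT : STy → VType
  | .base a => .base a
  | .unit => .unit
  | .prod σ τ => .prod (cbvT σ) (cbvT τ)
  | .arr σ τ => .arr (cbvT σ) (.comp (.bang (cbvT τ)))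

/-- The call-by-value translation `Θᵛ` on contexts. -/
def cbvCtx (Θ : List STy) : List VType := Θ.map cbvT

/-- The call-by-value translation on terms: `Θ ⊢ M : τ` is sent to
`Θᵛ ⊢ Mᵛ : !(τᵛ)`. -/
def cbvTm : LTm → Tm
  | .var n => .bang (.var n)
  | .unit => .bang .unit
  | .pair M N => .banglet (cbvTm M) (.banglet (Tm.shift (cbvTm N)) (.bang (.vpair (.var 1) (.var 0))))
  | .fst M => .banglet (cbvTm M) (.bang (.vfst (.var 0)))
  | .snd M => .banglet (cbvTm M) (.bang (.vsnd (.var 0)))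
  | .lam σ M => .bang (.vlam (cbvT σ) (cbvTm M))
  | .app M N => .banglet (cbvTm M) (.banglet (Tm.shift (cbvTm N)) (.vapp (.var 1) (.var 0)))

/-- The call-by-name translation `σⁿ` on types. -/
def cbnT : STy → CType
  | .base a => assocC a
  | .unit => .cunit
  | .prod σ τ => .cand (cbnT σ) (cbnT τ)
  | .arr σ τ => .carr (.comp (cbnT σ)) (cbnT τ)

/-- The call-by-name translation `Θⁿ` on contexts. -/
def cbnCtx (Θ : List STy) : List VType := Θ.map (fun σ => .comp (cbnT σ))

/-- The call-by-name translation on terms: `Θ ⊢ M : τ` is sent to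
`Θⁿ ⊢ Mⁿ : τⁿ`, mimicking each construct by the corresponding
computation-type construct of EEC. -/
def cbnTm : LTm → Tm
  | .var n => .var n
  | .unit => .cunit
  | .pair M N => .cpair (cbnTm M) (cbnTm N)
  | .fst M => .cfst (cbnTm M)
  | .snd M => .csnd (cbnTm M)
  | .lam σ M => .clam (.comp (cbnT σ)) (cbnTm M)
  | .app M N => .capp (cbnTm M) (cbnTm N)

/-! ## Hasegawa's linear-use CPS translations (Section 4) -/

/-- The call-by-value linear-use CPS translation `σᵛᶜ` on types. -/
def cbvcpsT (R : CType) : STy → VType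
  | .base a => .base a
  | .unit => .unit
  | .prod σ τ => .prod (cbvcpsT R σ) (cbvcpsT R τ)
  | .arr σ τ => .arr (cbvcpsT R σ) (.lin (.carr (cbvcpsT R τ) R) R)

/-- `Θᵛᶜ`. -/
def cbvcpsCtx (R : CType) (Θ : List STy) : List VType := Θ.map (cbvcpsT R)

/-- The call-by-value linear-use CPS translation on terms: `Θ ⊢ M : τ` is
sent to `Θᵛᶜ ⊢ Mᵛᶜ : (τᵛᶜ ⇒ R̲) ⊸ R̲`. -/
def cbvcps (R : CType) : {Θ : List STy} → {M : LTm} → {σ : STy} → LDeriv Θ M σ → Tm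
  | _, _, _, .var _ n σ _ => .llam (.carr (cbvcpsT R σ) R) (.capp .svar (.var n))
  | _, _, _, .unit _ => .llam (.carr .unit R) (.capp .svar .unit)
  | _, _, _, .pair _ _ _ σ τ dM dN =>
      .llam (.carr (.prod (cbvcpsT R σ) (cbvcpsT R τ)) R)
        (.lapp (cbvcps R dM)
          (.clam (cbvcpsT R σ)
            (.lapp (Tm.shift (cbvcps R dN))
              (.clam (cbvcpsT R τ) (.capp .svar (.vpair (.var 1) (.var 0)))))))
  | _, _, _, .fst _ _ σ τ dM =>
      .llam (.carr (cbvcpsT R σ) R)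
        (.lapp (cbvcps R dM)
          (.clam (.prod (cbvcpsT R σ) (cbvcpsT R τ)) (.capp .svar (.vfst (.var 0)))))
  | _, _, _, .snd _ _ σ τ dM =>
      .llam (.carr (cbvcpsT R τ) R)
        (.lapp (cbvcps R dM)
          (.clam (.prod (cbvcpsT R σ) (cbvcpsT R τ)) (.capp .svar (.vsnd (.var 0)))))
  | _, _, _, .lam _ _ σ τ dM =>
      .llam (.carr (.arr (cbvcpsT R σ) (.lin (.carr (cbvcpsT R τ) R) R)) R)
        (.capp .svar (.vlam (cbvcpsT R σ) (cbvcps R dM)))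
  | _, _, _, .app _ _ _ σ τ dM dN =>
      .llam (.carr (cbvcpsT R τ) R)
        (.lapp (cbvcps R dM)
          (.clam (.arr (cbvcpsT R σ) (.lin (.carr (cbvcpsT R τ) R) R))
            (.lapp (Tm.shift (cbvcps R dN))
              (.clam (cbvcpsT R σ) (.lapp (.vapp (.var 1) (.var 0)) .svar)))))

/-- The call-by-name linear-use CPS translation `σⁿᶜ` on types. -/
def cbncpsT (R : CType) : STy → CType
  | .base a => assocC a
  | .unit => .czero
  | .prod σ τ => .csum (cbncpsT R σ) (cbncpsT R τ)
  | .arr σ τ => .copow (.lin (cbncpsT R σ) R) (cbncpsT R τ)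

/-- `Θⁿᶜ ⊸ R̲`, assigning each variable `xᵢ : σᵢ` the type `σᵢⁿᶜ ⊸ R̲`. -/
def cbncpsCtx (R : CType) (Θ : List STy) : List VType :=
  Θ.map (fun σ => .lin (cbncpsT R σ) R)

/-- The call-by-name linear-use CPS translation on terms: `Θ ⊢ M : τ` is
sent to `Θⁿᶜ ⊸ R̲ ⊢ Mⁿᶜ : τⁿᶜ ⊸ R̲`. -/
def cbncps (R : CType) : {Θ : List STy} → {M : LTm} → {σ : STy} → LDeriv Θ M σ → Tm
  | _, _, _, .var _ n _ _ => .var n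
  | _, _, _, .unit _ => .llam .czero (.cimage R .svar)
  | _, _, _, .pair _ _ _ σ τ dM dN =>
      .llam (.csum (cbncpsT R σ) (cbncpsT R τ))
        (.ccase .svar (.lapp (cbncps R dM) .svar) (.lapp (cbncps R dN) .svar))
  | _, _, _, .fst _ _ σ _τ dM => .llam (cbncpsT R σ) (.lapp (cbncps R dM) (.cinl .svar))
  | _, _, _, .snd _ _ _ τ dM => .llam (cbncpsT R τ) (.lapp (cbncps R dM) (.cinr .svar))
  | _, _, _, .lam _ _ σ τ dM =>
      .llam (.copow (.lin (cbncpsT R σ) R) (cbncpsT R τ))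
        (.copowlet .svar (.lapp (cbncps R dM) .svar))
  | _, _, _, .app _ _ _ σ τ dM dN =>
      .llam (cbncpsT R τ) (.lapp (cbncps R dM) (.copow (cbncps R dN) .svar))

end EEC

namespace EEC

namespace Tm

/-! ## Substitution calculus on raw terms -/

/-- The stoup variable does not occur free in the term. -/
def SFree : Tm → Prop
  | .var _ => True
  | .svar => False
  | .unit => True
  | .vpair t t' => SFree t ∧ SFree t'
  | .vfst t => SFree t
  | .vsnd t => SFree t
  | .vlam _ t => SFree t
  | .vapp s t => SFree s ∧ SFree t
  | .cunit => True
  | .cpair t t' => SFree t ∧ SFree t'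
  | .cfst t => SFree t
  | .csnd t => SFree t
  | .clam _ t => SFree t
  | .capp s t => SFree s ∧ SFree t
  | .top => True
  | .ilet t t' => SFree t ∧ SFree t'
  | .bang t => SFree t
  | .banglet t t' => SFree t ∧ SFree t'
  | .copow t t' => SFree t ∧ SFree t'
  | .copowlet s _ => SFree s
  | .cimage _ t => SFree t
  | .cinl t => SFree t
  | .cinr t => SFree t
  | .ccase s _ _ => SFree s
  | .llam _ _ => True
  | .lapp s t => SFree s ∧ SFree t

theorem SFree.ssubst_eq {t : Tm} (h : SFree t) (u : Tm) : ssubst u t = t := by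
  induction t generalizing u <;> simp_all [SFree, ssubst]

theorem SFree.rename {t : Tm} (h : SFree t) (f : ℕ → ℕ) : SFree (rename f t) := by
  induction t generalizing f <;> simp_all [SFree, Tm.rename]

theorem SFree.shift {t : Tm} (h : SFree t) : SFree (shift t) := h.rename _

theorem SFree.liftS {σ : ℕ → Tm} (h : ∀ n, SFree (σ n)) : ∀ n, SFree (liftS σ n)
  | 0 => trivial
  | n + 1 => (h n).shift

theorem liftN_comp (f g : ℕ → ℕ) : liftN f ∘ liftN g = liftN (f ∘ g) := by
  funext n; cases n <;> rfl

theorem rename_rename (f g : ℕ → ℕ) (t : Tm) : rename f (rename g t) = rename (f ∘ g) t := by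
  induction t generalizing f g <;> simp_all [rename, liftN_comp]

theorem liftS_comp_liftN (σ : ℕ → Tm) (g : ℕ → ℕ) : liftS σ ∘ liftN g = liftS (σ ∘ g) := by
  funext n; cases n <;> rfl

theorem psubst_rename (σ : ℕ → Tm) (g : ℕ → ℕ) (t : Tm) :
    psubst σ (rename g t) = psubst (σ ∘ g) t := by
  induction t generalizing σ g <;> simp_all [rename, psubst, liftS_comp_liftN]

theorem shift_rename (f : ℕ → ℕ) (t : Tm) : shift (rename f t) = rename (liftN f) (shift t) := by
  simp only [shift, rename_rename]; rfl

theorem rename_comp_liftS (f : ℕ → ℕ) (σ : ℕ → Tm) :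
    rename (liftN f) ∘ liftS σ = liftS (rename f ∘ σ) := by
  funext n
  cases n with
  | zero => rfl
  | succ n => exact (shift_rename f (σ n)).symm

theorem rename_psubst (f : ℕ → ℕ) (σ : ℕ → Tm) (t : Tm) :
    rename f (psubst σ t) = psubst (rename f ∘ σ) t := by
  induction t generalizing f σ <;> simp_all [rename, psubst, rename_comp_liftS]

theorem shift_psubst (σ : ℕ → Tm) (t : Tm) :
    shift (psubst σ t) = psubst (liftS σ) (shift t) := by
  simp only [shift, rename_psubst, psubst_rename]; rfl

theorem psubst_comp_liftS (τ σ : ℕ → Tm) :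
    psubst (liftS τ) ∘ liftS σ = liftS (psubst τ ∘ σ) := by
  funext n
  cases n with
  | zero => rfl
  | succ n => exact (shift_psubst τ (σ n)).symm

theorem psubst_psubst (τ σ : ℕ → Tm) (t : Tm) :
    psubst τ (psubst σ t) = psubst (psubst τ ∘ σ) t := by
  induction t generalizing τ σ <;> simp_all [psubst, psubst_comp_liftS]

theorem liftS_var : liftS Tm.var = Tm.var := by
  funext n; cases n <;> rfl

theorem psubst_var (t : Tm) : psubst Tm.var t = t := by
  induction t <;> simp_all [psubst, liftS_var]

theorem rename_ssubst (f : ℕ → ℕ) (u t : Tm) :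
    rename f (ssubst u t) = ssubst (rename f u) (rename f t) := by
  induction t generalizing f u <;> simp_all [rename, ssubst, shift_rename]

theorem shift_ssubst (u t : Tm) : shift (ssubst u t) = ssubst (shift u) (shift t) :=
  rename_ssubst _ u t

theorem psubst_ssubst {σ : ℕ → Tm} (hσ : ∀ n, SFree (σ n)) (u t : Tm) :
    psubst σ (ssubst u t) = ssubst (psubst σ u) (psubst σ t) := by
  induction t generalizing σ u with
  | var n => exact ((hσ n).ssubst_eq _).symm
  | _ => simp_all [psubst, ssubst, shift_psubst, SFree.liftS]

theorem ssubst_ssubst (u v t : Tm) : ssubst u (ssubst v t) = ssubst (ssubst u v) t := by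
  induction t generalizing u v <;> simp_all [ssubst, shift_ssubst]

theorem ssubst_svar (t : Tm) : ssubst .svar t = t := by
  have h : shift .svar = .svar := rfl
  induction t <;> simp_all [ssubst]

/-- The substitution extending `σ` by the term `u` for the innermost variable. -/
def consS (u : Tm) (σ : ℕ → Tm) : ℕ → Tm
  | 0 => u
  | n + 1 => σ n

theorem subst0_eq (u t : Tm) : subst0 u t = psubst (consS u Tm.var) t := by
  unfold subst0; congr 1

theorem SFree.consS {u : Tm} {σ : ℕ → Tm} (hu : SFree u) (h : ∀ n, SFree (σ n)) :
    ∀ n, SFree (consS u σ n)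
  | 0 => hu
  | n + 1 => h n

theorem psubst_consS_shift (u t : Tm) (σ : ℕ → Tm) : psubst (consS u σ) (shift t) = psubst σ t := by
  simp only [shift, psubst_rename]; rfl

theorem subst0_shift (u t : Tm) : subst0 u (shift t) = t := by
  rw [subst0_eq, psubst_consS_shift, psubst_var]

theorem subst0_var_rename (t : Tm) : subst0 (.var 0) (rename (liftN Nat.succ) t) = t := by
  rw [subst0_eq, psubst_rename]
  conv_rhs => rw [← psubst_var t]
  congr 1; funext n; cases n <;> rfl

end Tm

open Tm

/-! ## Renaming and substitution on derivations -/

theorem Deriv.sfree {Γ : List VType} {t : Tm} {A : VType} (d : Deriv Γ none t A) : SFree t := by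
  generalize hΔ : (none : Option CType) = Δ at d
  induction d <;> simp_all [SFree]

theorem getElem?_lift {Γ Γ' : List VType} {f : ℕ → ℕ}
    (hf : ∀ n B, Γ[n]? = some B → Γ'[f n]? = some B) (A : VType) :
    ∀ n B, (A :: Γ)[n]? = some B → (A :: Γ')[liftN f n]? = some B
  | 0, _, h => h
  | n + 1, B, h => hf n B h

theorem Deriv.exists_rename (R : CType) {Γ : List VType} {Δ : Option CType} {t : Tm} {A : VType}
    (d : Deriv Γ Δ t A) : ∀ {Γ' : List VType} {f : ℕ → ℕ},
      (∀ n B, Γ[n]? = some B → Γ'[f n]? = some B) →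
      ∃ d' : Deriv Γ' Δ (rename f t) A, cps R d' = rename f (cps R d) := by
  induction d with
  | var Γ n A h => exact fun hf => ⟨.var _ _ _ (hf _ _ h), rfl⟩
  | svar => exact fun hf => ⟨.svar _ _, rfl⟩
  | unit => exact fun hf => ⟨.unit _, rfl⟩
  | cunit _ Δ => exact fun hf => ⟨.cunit _ Δ, by cases Δ <;> rfl⟩
  | top => exact fun hf => ⟨.top _, rfl⟩
  | vpair Γ t u A B d1 d2 ih1 ih2 =>
    intro Γ' f hf
    obtain ⟨d1', h1⟩ := ih1 hf
    obtain ⟨d2', h2⟩ := ih2 hf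
    exact ⟨.vpair _ _ _ _ _ d1' d2', by simp [cps, rename, h1, h2]⟩
  | vapp Γ s t A B d1 d2 ih1 ih2 =>
    intro Γ' f hf
    obtain ⟨d1', h1⟩ := ih1 hf
    obtain ⟨d2', h2⟩ := ih2 hf
    exact ⟨.vapp _ _ _ _ _ d1' d2', by simp [cps, rename, h1, h2]⟩
  | vfst Γ t A B d ih =>
    intro Γ' f hf
    obtain ⟨d', h⟩ := ih hf
    exact ⟨.vfst _ _ _ _ d', by simp [cps, rename, h]⟩
  | vsnd Γ t A B d ih =>
    intro Γ' f hf
    obtain ⟨d', h⟩ := ih hf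
    exact ⟨.vsnd _ _ _ _ d', by simp [cps, rename, h]⟩
  | vlam Γ t A B d ih =>
    intro Γ' f hf
    obtain ⟨d', h⟩ := ih (getElem?_lift hf A)
    exact ⟨.vlam _ _ _ _ d', by simp [cps, rename, h]⟩
  | bang Γ t A d ih =>
    intro Γ' f hf
    obtain ⟨d', h⟩ := ih hf
    exact ⟨.bang _ _ _ d', by simp [cps, rename, h]⟩
  | llam Γ t A B d ih =>
    intro Γ' f hf
    obtain ⟨d', h⟩ := ih hf
    exact ⟨.llam _ _ _ _ d', by simp [cps, rename, h]⟩
  | cpair Γ Δ t u A B d1 d2 ih1 ih2 =>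
    intro Γ' f hf
    obtain ⟨d1', h1⟩ := ih1 hf
    obtain ⟨d2', h2⟩ := ih2 hf
    exact ⟨.cpair _ _ _ _ _ _ d1' d2', by cases Δ <;> simp [cps, rename, h1, h2]⟩
  | cfst Γ Δ t A B d ih =>
    intro Γ' f hf
    obtain ⟨d', h⟩ := ih hf
    exact ⟨.cfst _ _ _ _ _ d', by cases Δ <;> simp [cps, rename, rename_ssubst, h]⟩
  | csnd Γ Δ t A B d ih =>
    intro Γ' f hf
    obtain ⟨d', h⟩ := ih hf
    exact ⟨.csnd _ _ _ _ _ d', by cases Δ <;> simp [cps, rename, rename_ssubst, h]⟩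
  | clam Γ Δ t A B d ih =>
    intro Γ' f hf
    obtain ⟨d', h⟩ := ih (getElem?_lift hf A)
    exact ⟨.clam _ _ _ _ _ d', by cases Δ <;> simp [cps, rename, h]⟩
  | capp Γ Δ s t A B d1 d2 ih1 ih2 =>
    intro Γ' f hf
    obtain ⟨d1', h1⟩ := ih1 hf
    obtain ⟨d2', h2⟩ := ih2 hf
    exact ⟨.capp _ _ _ _ _ _ d1' d2', by cases Δ <;> simp [cps, rename, rename_ssubst, h1, h2]⟩
  | ilet Γ Δ t u A d1 d2 ih1 ih2 =>
    intro Γ' f hf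
    obtain ⟨d1', h1⟩ := ih1 hf
    obtain ⟨d2', h2⟩ := ih2 hf
    exact ⟨.ilet _ _ _ _ _ d1' d2', by cases Δ <;> simp [cps, rename, rename_ssubst, h1, h2]⟩
  | banglet Γ Δ t u A B d1 d2 ih1 ih2 =>
    intro Γ' f hf
    obtain ⟨d1', h1⟩ := ih1 hf
    obtain ⟨d2', h2⟩ := ih2 (getElem?_lift hf A)
    exact ⟨.banglet _ _ _ _ _ _ d1' d2', by cases Δ <;> simp [cps, rename, rename_ssubst, h1, h2]⟩
  | copow Γ Δ t u A B d1 d2 ih1 ih2 =>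
    intro Γ' f hf
    obtain ⟨d1', h1⟩ := ih1 hf
    obtain ⟨d2', h2⟩ := ih2 hf
    exact ⟨.copow _ _ _ _ _ _ d1' d2', by cases Δ <;> simp [cps, rename, rename_ssubst, h1, h2]⟩
  | copowlet Γ Δ s t A B C d1 d2 ih1 ih2 =>
    intro Γ' f hf
    obtain ⟨d1', h1⟩ := ih1 hf
    obtain ⟨d2', h2⟩ := ih2 (getElem?_lift hf A)
    exact ⟨.copowlet _ _ _ _ _ _ _ d1' d2',
      by cases Δ <;> simp [cps, rename, rename_ssubst, h1, h2]⟩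
  | cimage Γ Δ t A d ih =>
    intro Γ' f hf
    obtain ⟨d', h⟩ := ih hf
    exact ⟨.cimage _ _ _ _ d', by cases Δ <;> simp [cps, rename, rename_ssubst, h]⟩
  | cinl Γ Δ t A B d ih =>
    intro Γ' f hf
    obtain ⟨d', h⟩ := ih hf
    exact ⟨.cinl _ _ _ _ _ d', by cases Δ <;> simp [cps, rename, rename_ssubst, h]⟩
  | cinr Γ Δ t A B d ih =>
    intro Γ' f hf
    obtain ⟨d', h⟩ := ih hf
    exact ⟨.cinr _ _ _ _ _ d', by cases Δ <;> simp [cps, rename, rename_ssubst, h]⟩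
  | ccase Γ Δ s t u A B C d1 d2 d3 ih1 ih2 ih3 =>
    intro Γ' f hf
    obtain ⟨d1', h1⟩ := ih1 hf
    obtain ⟨d2', h2⟩ := ih2 hf
    obtain ⟨d3', h3⟩ := ih3 hf
    exact ⟨.ccase _ _ _ _ _ _ _ _ d1' d2' d3',
      by cases Δ <;> simp [cps, rename, rename_ssubst, h1, h2, h3]⟩
  | lapp Γ Δ s t A B d1 d2 ih1 ih2 =>
    intro Γ' f hf
    obtain ⟨d1', h1⟩ := ih1 hf
    obtain ⟨d2', h2⟩ := ih2 hf
    exact ⟨.lapp _ _ _ _ _ _ d1' d2', by cases Δ <;> simp [cps, rename, rename_ssubst, h1, h2]⟩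

theorem Deriv.exists_shift (R : CType) {Γ : List VType} {Δ : Option CType} {t : Tm} {A : VType}
    (d : Deriv Γ Δ t A) (B : VType) :
    ∃ d' : Deriv (B :: Γ) Δ (shift t) A, cps R d' = shift (cps R d) :=
  d.exists_rename R fun _ _ h => h

/-- `σ` is a well-typed substitution whose CPS translation is `τ`. -/
structure SubstCps (R : CType) (Γ Γ' : List VType) (σ τ : ℕ → Tm) : Prop where
  deriv : ∀ n B, Γ[n]? = some B → ∃ e : Deriv Γ' none (σ n) B, cps R e = τ n
  sfree : ∀ n, SFree (τ n)

theorem SubstCps.lift {R : CType} {Γ Γ' : List VType} {σ τ : ℕ → Tm}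
    (h : SubstCps R Γ Γ' σ τ) (A : VType) :
    SubstCps R (A :: Γ) (A :: Γ') (liftS σ) (liftS τ) where
  deriv
    | 0, B, hB => ⟨.var _ _ _ hB, rfl⟩
    | n + 1, B, hB => by
      obtain ⟨e, he⟩ := h.deriv n B hB
      obtain ⟨e', he'⟩ := e.exists_shift R A
      exact ⟨e', he'.trans (by rw [he]; rfl)⟩
  sfree := SFree.liftS h.sfree

theorem Deriv.exists_psubst (R : CType) {Γ : List VType} {Δ : Option CType} {t : Tm} {A : VType}
    (d : Deriv Γ Δ t A) : ∀ {Γ' : List VType} {σ τ : ℕ → Tm}, SubstCps R Γ Γ' σ τ →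
      ∃ d' : Deriv Γ' Δ (psubst σ t) A, cps R d' = psubst τ (cps R d) := by
  induction d with
  | var Γ n A h => exact fun hf => hf.deriv _ _ h
  | svar => exact fun hf => ⟨.svar _ _, rfl⟩
  | unit => exact fun hf => ⟨.unit _, rfl⟩
  | cunit _ Δ => exact fun hf => ⟨.cunit _ Δ, by cases Δ <;> rfl⟩
  | top => exact fun hf => ⟨.top _, rfl⟩
  | vpair Γ t u A B d1 d2 ih1 ih2 =>
    intro Γ' σ τ hf
    obtain ⟨d1', h1⟩ := ih1 hf
    obtain ⟨d2', h2⟩ := ih2 hf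
    exact ⟨.vpair _ _ _ _ _ d1' d2', by simp [cps, psubst, h1, h2]⟩
  | vapp Γ s t A B d1 d2 ih1 ih2 =>
    intro Γ' σ τ hf
    obtain ⟨d1', h1⟩ := ih1 hf
    obtain ⟨d2', h2⟩ := ih2 hf
    exact ⟨.vapp _ _ _ _ _ d1' d2', by simp [cps, psubst, h1, h2]⟩
  | vfst Γ t A B d ih =>
    intro Γ' σ τ hf
    obtain ⟨d', h⟩ := ih hf
    exact ⟨.vfst _ _ _ _ d', by simp [cps, psubst, h]⟩
  | vsnd Γ t A B d ih =>
    intro Γ' σ τ hf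
    obtain ⟨d', h⟩ := ih hf
    exact ⟨.vsnd _ _ _ _ d', by simp [cps, psubst, h]⟩
  | vlam Γ t A B d ih =>
    intro Γ' σ τ hf
    obtain ⟨d', h⟩ := ih (hf.lift A)
    exact ⟨.vlam _ _ _ _ d', by simp [cps, psubst, h]⟩
  | bang Γ t A d ih =>
    intro Γ' σ τ hf
    obtain ⟨d', h⟩ := ih hf
    exact ⟨.bang _ _ _ d', by simp [cps, psubst, h]⟩
  | llam Γ t A B d ih =>
    intro Γ' σ τ hf
    obtain ⟨d', h⟩ := ih hf
    exact ⟨.llam _ _ _ _ d', by simp [cps, psubst, h]⟩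
  | cpair Γ Δ t u A B d1 d2 ih1 ih2 =>
    intro Γ' σ τ hf
    obtain ⟨d1', h1⟩ := ih1 hf
    obtain ⟨d2', h2⟩ := ih2 hf
    exact ⟨.cpair _ _ _ _ _ _ d1' d2', by cases Δ <;> simp [cps, psubst, h1, h2]⟩
  | cfst Γ Δ t A B d ih =>
    intro Γ' σ τ hf
    obtain ⟨d', h⟩ := ih hf
    exact ⟨.cfst _ _ _ _ _ d', by cases Δ <;> simp [cps, psubst, psubst_ssubst hf.sfree, h]⟩
  | csnd Γ Δ t A B d ih =>
    intro Γ' σ τ hf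
    obtain ⟨d', h⟩ := ih hf
    exact ⟨.csnd _ _ _ _ _ d', by cases Δ <;> simp [cps, psubst, psubst_ssubst hf.sfree, h]⟩
  | clam Γ Δ t A B d ih =>
    intro Γ' σ τ hf
    obtain ⟨d', h⟩ := ih (hf.lift A)
    exact ⟨.clam _ _ _ _ _ d', by cases Δ <;> simp [cps, psubst, h]⟩
  | capp Γ Δ s t A B d1 d2 ih1 ih2 =>
    intro Γ' σ τ hf
    obtain ⟨d1', h1⟩ := ih1 hf
    obtain ⟨d2', h2⟩ := ih2 hf
    exact ⟨.capp _ _ _ _ _ _ d1' d2',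
      by cases Δ <;> simp [cps, psubst, psubst_ssubst hf.sfree, h1, h2]⟩
  | ilet Γ Δ t u A d1 d2 ih1 ih2 =>
    intro Γ' σ τ hf
    obtain ⟨d1', h1⟩ := ih1 hf
    obtain ⟨d2', h2⟩ := ih2 hf
    exact ⟨.ilet _ _ _ _ _ d1' d2',
      by cases Δ <;> simp [cps, psubst, psubst_ssubst hf.sfree, h1, h2]⟩
  | banglet Γ Δ t u A B d1 d2 ih1 ih2 =>
    intro Γ' σ τ hf
    obtain ⟨d1', h1⟩ := ih1 hf
    obtain ⟨d2', h2⟩ := ih2 (hf.lift A)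
    exact ⟨.banglet _ _ _ _ _ _ d1' d2',
      by cases Δ <;> simp [cps, psubst, psubst_ssubst hf.sfree, h1, h2]⟩
  | copow Γ Δ t u A B d1 d2 ih1 ih2 =>
    intro Γ' σ τ hf
    obtain ⟨d1', h1⟩ := ih1 hf
    obtain ⟨d2', h2⟩ := ih2 hf
    exact ⟨.copow _ _ _ _ _ _ d1' d2',
      by cases Δ <;> simp [cps, psubst, psubst_ssubst hf.sfree, h1, h2]⟩
  | copowlet Γ Δ s t A B C d1 d2 ih1 ih2 =>
    intro Γ' σ τ hf
    obtain ⟨d1', h1⟩ := ih1 hf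
    obtain ⟨d2', h2⟩ := ih2 (hf.lift A)
    exact ⟨.copowlet _ _ _ _ _ _ _ d1' d2',
      by cases Δ <;> simp [cps, psubst, psubst_ssubst hf.sfree, h1, h2]⟩
  | cimage Γ Δ t A d ih =>
    intro Γ' σ τ hf
    obtain ⟨d', h⟩ := ih hf
    exact ⟨.cimage _ _ _ _ d', by cases Δ <;> simp [cps, psubst, psubst_ssubst hf.sfree, h]⟩
  | cinl Γ Δ t A B d ih =>
    intro Γ' σ τ hf
    obtain ⟨d', h⟩ := ih hf
    exact ⟨.cinl _ _ _ _ _ d', by cases Δ <;> simp [cps, psubst, psubst_ssubst hf.sfree, h]⟩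
  | cinr Γ Δ t A B d ih =>
    intro Γ' σ τ hf
    obtain ⟨d', h⟩ := ih hf
    exact ⟨.cinr _ _ _ _ _ d', by cases Δ <;> simp [cps, psubst, psubst_ssubst hf.sfree, h]⟩
  | ccase Γ Δ s t u A B C d1 d2 d3 ih1 ih2 ih3 =>
    intro Γ' σ τ hf
    obtain ⟨d1', h1⟩ := ih1 hf
    obtain ⟨d2', h2⟩ := ih2 hf
    obtain ⟨d3', h3⟩ := ih3 hf
    exact ⟨.ccase _ _ _ _ _ _ _ _ d1' d2' d3',
      by cases Δ <;> simp [cps, psubst, psubst_ssubst hf.sfree, h1, h2, h3]⟩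
  | lapp Γ Δ s t A B d1 d2 ih1 ih2 =>
    intro Γ' σ τ hf
    obtain ⟨d1', h1⟩ := ih1 hf
    obtain ⟨d2', h2⟩ := ih2 hf
    exact ⟨.lapp _ _ _ _ _ _ d1' d2',
      by cases Δ <;> simp [cps, psubst, psubst_ssubst hf.sfree, h1, h2]⟩

theorem Deriv.sfree_cps (R : CType) {Γ : List VType} {t : Tm} {A : VType}
    (d : Deriv Γ none t A) : SFree (cps R d) := by
  generalize hΔ : (none : Option CType) = Δ at d
  induction d <;> first | subst hΔ | skip
  all_goals simp_all [SFree, cps]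

theorem SubstCps.cons {R : CType} {Γ : List VType} {A : VType} {u : Tm} (e : Deriv Γ none u A) :
    SubstCps R (A :: Γ) Γ (consS u Tm.var) (consS (cps R e) Tm.var) where
  deriv
    | 0, B, hB => by
      obtain rfl : A = B := by simpa using hB
      exact ⟨e, rfl⟩
    | n + 1, B, hB => ⟨.var _ _ _ (by simpa using hB), rfl⟩
  sfree := SFree.consS (e.sfree_cps R) fun _ => trivial

theorem Deriv.exists_subst0 (R : CType) {Γ : List VType} {Δ : Option CType} {t u : Tm}
    {A B : VType} (d : Deriv (A :: Γ) Δ t B) (e : Deriv Γ none u A) :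
    ∃ d' : Deriv Γ Δ (subst0 u t) B, cps R d' = subst0 (cps R e) (cps R d) := by
  rw [subst0_eq, subst0_eq]
  exact d.exists_psubst R (SubstCps.cons e)

theorem Deriv.nonempty_ssubst {Γ : List VType} {Δ' : Option CType} {t : Tm} {A : VType}
    (d : Deriv Γ Δ' t A) : ∀ {D : CType} {Δ : Option CType} {u : Tm}, Δ' = some D →
      Deriv Γ Δ u (.comp D) → Nonempty (Deriv Γ Δ (ssubst u t) A) := by
  induction d with
  | svar => rintro _ _ _ ⟨⟩ e; exact ⟨e⟩
  | cunit => rintro _ _ _ ⟨⟩ e; exact ⟨.cunit _ _⟩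
  | cpair Γ Δ t u A B d1 d2 ih1 ih2 =>
    rintro D Δ u rfl e
    obtain ⟨d1'⟩ := ih1 rfl e
    obtain ⟨d2'⟩ := ih2 rfl e
    exact ⟨.cpair _ _ _ _ _ _ d1' d2'⟩
  | cfst Γ Δ t A B d ih =>
    rintro D Δ u rfl e
    obtain ⟨d'⟩ := ih rfl e
    exact ⟨.cfst _ _ _ _ _ d'⟩
  | csnd Γ Δ t A B d ih =>
    rintro D Δ u rfl e
    obtain ⟨d'⟩ := ih rfl e
    exact ⟨.csnd _ _ _ _ _ d'⟩
  | clam Γ Δ t A B d ih =>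
    rintro D Δ u rfl e
    obtain ⟨e', -⟩ := e.exists_shift .iunit A
    obtain ⟨d'⟩ := ih rfl e'
    exact ⟨.clam _ _ _ _ _ d'⟩
  | capp Γ Δ s t A B d1 d2 ih1 ih2 =>
    rintro D Δ u rfl e
    obtain ⟨d1'⟩ := ih1 rfl e
    exact ⟨.capp _ _ _ _ _ _ d1' (by rw [d2.sfree.ssubst_eq u]; exact d2)⟩
  | ilet Γ Δ t u A d1 d2 ih1 ih2 =>
    rintro D Δ u rfl e
    obtain ⟨d1'⟩ := ih1 rfl e
    exact ⟨.ilet _ _ _ _ _ d1' (by rw [d2.sfree.ssubst_eq u]; exact d2)⟩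
  | banglet Γ Δ t u A B d1 d2 ih1 ih2 =>
    rintro D Δ u rfl e
    obtain ⟨d1'⟩ := ih1 rfl e
    exact ⟨.banglet _ _ _ _ _ _ d1' (by rw [d2.sfree.ssubst_eq (shift u)]; exact d2)⟩
  | copow Γ Δ t u A B d1 d2 ih1 ih2 =>
    rintro D Δ u rfl e
    obtain ⟨d2'⟩ := ih2 rfl e
    exact ⟨.copow _ _ _ _ _ _ (by rw [d1.sfree.ssubst_eq u]; exact d1) d2'⟩
  | copowlet Γ Δ s t A B C d1 d2 ih1 ih2 =>
    rintro D Δ u rfl e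
    obtain ⟨d1'⟩ := ih1 rfl e
    exact ⟨.copowlet _ _ _ _ _ _ _ d1' d2⟩
  | cimage Γ Δ t A d ih =>
    rintro D Δ u rfl e
    obtain ⟨d'⟩ := ih rfl e
    exact ⟨.cimage _ _ _ _ d'⟩
  | cinl Γ Δ t A B d ih =>
    rintro D Δ u rfl e
    obtain ⟨d'⟩ := ih rfl e
    exact ⟨.cinl _ _ _ _ _ d'⟩
  | cinr Γ Δ t A B d ih =>
    rintro D Δ u rfl e
    obtain ⟨d'⟩ := ih rfl e
    exact ⟨.cinr _ _ _ _ _ d'⟩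
  | ccase Γ Δ s t u A B C d1 d2 d3 ih1 ih2 ih3 =>
    rintro D Δ u rfl e
    obtain ⟨d1'⟩ := ih1 rfl e
    exact ⟨.ccase _ _ _ _ _ _ _ _ d1' d2 d3⟩
  | lapp Γ Δ s t A B d1 d2 ih1 ih2 =>
    rintro D Δ u rfl e
    obtain ⟨d2'⟩ := ih2 rfl e
    exact ⟨.lapp _ _ _ _ _ _ (by rw [d1.sfree.ssubst_eq u]; exact d1) d2'⟩
  | _ => rintro _ _ _ ⟨⟩

/-! ## Both sides of a provable equation are typable -/

theorem EEq.regular {Γ : List VType} {Δ : Option CType} {t u : Tm} {A : VType}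
    (h : EEq Γ Δ t u A) : Nonempty (Deriv Γ Δ t A) ∧ Nonempty (Deriv Γ Δ u A) := by
  have subst0_typed : ∀ {Γ Δ t u A B}, Deriv (A :: Γ) Δ t B → Deriv Γ none u A →
      Nonempty (Deriv Γ Δ (subst0 u t) B) := fun d e => ⟨(d.exists_subst0 .iunit e).choose⟩
  have shift_typed : ∀ {Γ Δ t A} (B), Deriv Γ Δ t A → Nonempty (Deriv (B :: Γ) Δ (shift t) A) :=
    fun B d => ⟨(d.exists_shift .iunit B).choose⟩
  have ssubst_typed : ∀ {Γ Δ t u A B}, Deriv Γ (some A) t B → Deriv Γ Δ u (.comp A) →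
      Nonempty (Deriv Γ Δ (ssubst u t) B) := fun d e => d.nonempty_ssubst rfl e
  have var0 : ∀ A Γ, Deriv (A :: Γ) none (.var 0) A := fun A Γ => .var _ _ _ rfl
  induction h with
  | refl d => exact ⟨⟨d⟩, ⟨d⟩⟩
  | symm _ ih => exact ih.symm
  | trans _ _ ih1 ih2 => exact ⟨ih1.1, ih2.2⟩
  | vpair_cong _ _ ih1 ih2 =>
    obtain ⟨⟨⟨a⟩, ⟨a'⟩⟩, ⟨⟨b⟩, ⟨b'⟩⟩⟩ := And.intro ih1 ih2
    exact ⟨⟨.vpair _ _ _ _ _ a b⟩, ⟨.vpair _ _ _ _ _ a' b'⟩⟩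
  | vfst_cong _ ih =>
    obtain ⟨⟨a⟩, ⟨a'⟩⟩ := ih
    exact ⟨⟨.vfst _ _ _ _ a⟩, ⟨.vfst _ _ _ _ a'⟩⟩
  | vsnd_cong _ ih =>
    obtain ⟨⟨a⟩, ⟨a'⟩⟩ := ih
    exact ⟨⟨.vsnd _ _ _ _ a⟩, ⟨.vsnd _ _ _ _ a'⟩⟩
  | vlam_cong _ ih =>
    obtain ⟨⟨a⟩, ⟨a'⟩⟩ := ih
    exact ⟨⟨.vlam _ _ _ _ a⟩, ⟨.vlam _ _ _ _ a'⟩⟩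
  | vapp_cong _ _ ih1 ih2 =>
    obtain ⟨⟨⟨a⟩, ⟨a'⟩⟩, ⟨⟨b⟩, ⟨b'⟩⟩⟩ := And.intro ih1 ih2
    exact ⟨⟨.vapp _ _ _ _ _ a b⟩, ⟨.vapp _ _ _ _ _ a' b'⟩⟩
  | cpair_cong _ _ ih1 ih2 =>
    obtain ⟨⟨⟨a⟩, ⟨a'⟩⟩, ⟨⟨b⟩, ⟨b'⟩⟩⟩ := And.intro ih1 ih2
    exact ⟨⟨.cpair _ _ _ _ _ _ a b⟩, ⟨.cpair _ _ _ _ _ _ a' b'⟩⟩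
  | cfst_cong _ ih =>
    obtain ⟨⟨a⟩, ⟨a'⟩⟩ := ih
    exact ⟨⟨.cfst _ _ _ _ _ a⟩, ⟨.cfst _ _ _ _ _ a'⟩⟩
  | csnd_cong _ ih =>
    obtain ⟨⟨a⟩, ⟨a'⟩⟩ := ih
    exact ⟨⟨.csnd _ _ _ _ _ a⟩, ⟨.csnd _ _ _ _ _ a'⟩⟩
  | clam_cong _ ih =>
    obtain ⟨⟨a⟩, ⟨a'⟩⟩ := ih
    exact ⟨⟨.clam _ _ _ _ _ a⟩, ⟨.clam _ _ _ _ _ a'⟩⟩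
  | capp_cong _ _ ih1 ih2 =>
    obtain ⟨⟨⟨a⟩, ⟨a'⟩⟩, ⟨⟨b⟩, ⟨b'⟩⟩⟩ := And.intro ih1 ih2
    exact ⟨⟨.capp _ _ _ _ _ _ a b⟩, ⟨.capp _ _ _ _ _ _ a' b'⟩⟩
  | ilet_cong _ _ ih1 ih2 =>
    obtain ⟨⟨⟨a⟩, ⟨a'⟩⟩, ⟨⟨b⟩, ⟨b'⟩⟩⟩ := And.intro ih1 ih2
    exact ⟨⟨.ilet _ _ _ _ _ a b⟩, ⟨.ilet _ _ _ _ _ a' b'⟩⟩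
  | bang_cong _ ih =>
    obtain ⟨⟨a⟩, ⟨a'⟩⟩ := ih
    exact ⟨⟨.bang _ _ _ a⟩, ⟨.bang _ _ _ a'⟩⟩
  | banglet_cong _ _ ih1 ih2 =>
    obtain ⟨⟨⟨a⟩, ⟨a'⟩⟩, ⟨⟨b⟩, ⟨b'⟩⟩⟩ := And.intro ih1 ih2
    exact ⟨⟨.banglet _ _ _ _ _ _ a b⟩, ⟨.banglet _ _ _ _ _ _ a' b'⟩⟩
  | copow_cong _ _ ih1 ih2 =>
    obtain ⟨⟨⟨a⟩, ⟨a'⟩⟩, ⟨⟨b⟩, ⟨b'⟩⟩⟩ := And.intro ih1 ih2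
    exact ⟨⟨.copow _ _ _ _ _ _ a b⟩, ⟨.copow _ _ _ _ _ _ a' b'⟩⟩
  | copowlet_cong _ _ ih1 ih2 =>
    obtain ⟨⟨⟨a⟩, ⟨a'⟩⟩, ⟨⟨b⟩, ⟨b'⟩⟩⟩ := And.intro ih1 ih2
    exact ⟨⟨.copowlet _ _ _ _ _ _ _ a b⟩, ⟨.copowlet _ _ _ _ _ _ _ a' b'⟩⟩
  | cimage_cong _ ih =>
    obtain ⟨⟨a⟩, ⟨a'⟩⟩ := ih
    exact ⟨⟨.cimage _ _ _ _ a⟩, ⟨.cimage _ _ _ _ a'⟩⟩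
  | cinl_cong _ ih =>
    obtain ⟨⟨a⟩, ⟨a'⟩⟩ := ih
    exact ⟨⟨.cinl _ _ _ _ _ a⟩, ⟨.cinl _ _ _ _ _ a'⟩⟩
  | cinr_cong _ ih =>
    obtain ⟨⟨a⟩, ⟨a'⟩⟩ := ih
    exact ⟨⟨.cinr _ _ _ _ _ a⟩, ⟨.cinr _ _ _ _ _ a'⟩⟩
  | ccase_cong _ _ _ ih1 ih2 ih3 =>
    obtain ⟨⟨⟨a⟩, ⟨a'⟩⟩, ⟨⟨b⟩, ⟨b'⟩⟩⟩ := And.intro ih1 ih2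
    obtain ⟨⟨c⟩, ⟨c'⟩⟩ := ih3
    exact ⟨⟨.ccase _ _ _ _ _ _ _ _ a b c⟩, ⟨.ccase _ _ _ _ _ _ _ _ a' b' c'⟩⟩
  | llam_cong _ ih =>
    obtain ⟨⟨a⟩, ⟨a'⟩⟩ := ih
    exact ⟨⟨.llam _ _ _ _ a⟩, ⟨.llam _ _ _ _ a'⟩⟩
  | lapp_cong _ _ ih1 ih2 =>
    obtain ⟨⟨⟨a⟩, ⟨a'⟩⟩, ⟨⟨b⟩, ⟨b'⟩⟩⟩ := And.intro ih1 ih2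
    exact ⟨⟨.lapp _ _ _ _ _ _ a b⟩, ⟨.lapp _ _ _ _ _ _ a' b'⟩⟩
  | unit_eta d => exact ⟨⟨d⟩, ⟨.unit _⟩⟩
  | vfst_beta d1 d2 => exact ⟨⟨.vfst _ _ _ _ (.vpair _ _ _ _ _ d1 d2)⟩, ⟨d1⟩⟩
  | vsnd_beta d1 d2 => exact ⟨⟨.vsnd _ _ _ _ (.vpair _ _ _ _ _ d1 d2)⟩, ⟨d2⟩⟩
  | vpair_eta d => exact ⟨⟨.vpair _ _ _ _ _ (.vfst _ _ _ _ d) (.vsnd _ _ _ _ d)⟩, ⟨d⟩⟩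
  | vlam_beta d e => exact ⟨⟨.vapp _ _ _ _ _ (.vlam _ _ _ _ d) e⟩, subst0_typed d e⟩
  | @vlam_eta _ _ A _ d =>
    obtain ⟨d'⟩ := shift_typed A d
    exact ⟨⟨.vlam _ _ _ _ (.vapp _ _ _ _ _ d' (var0 _ _))⟩, ⟨d⟩⟩
  | cunit_eta d => exact ⟨⟨d⟩, ⟨.cunit _ _⟩⟩
  | cfst_beta d1 d2 => exact ⟨⟨.cfst _ _ _ _ _ (.cpair _ _ _ _ _ _ d1 d2)⟩, ⟨d1⟩⟩
  | csnd_beta d1 d2 => exact ⟨⟨.csnd _ _ _ _ _ (.cpair _ _ _ _ _ _ d1 d2)⟩, ⟨d2⟩⟩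
  | cpair_eta d => exact ⟨⟨.cpair _ _ _ _ _ _ (.cfst _ _ _ _ _ d) (.csnd _ _ _ _ _ d)⟩, ⟨d⟩⟩
  | clam_beta d e => exact ⟨⟨.capp _ _ _ _ _ _ (.clam _ _ _ _ _ d) e⟩, subst0_typed d e⟩
  | @clam_eta _ _ _ A _ d =>
    obtain ⟨d'⟩ := shift_typed A d
    exact ⟨⟨.clam _ _ _ _ _ (.capp _ _ _ _ _ _ d' (var0 _ _))⟩, ⟨d⟩⟩
  | ilet_beta d => exact ⟨⟨.ilet _ _ _ _ _ (.top _) d⟩, ⟨d⟩⟩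
  | ilet_eta d e =>
    obtain ⟨e'⟩ := ssubst_typed e (.top _)
    exact ⟨⟨.ilet _ _ _ _ _ d e'⟩, ssubst_typed e d⟩
  | bang_beta d e => exact ⟨⟨.banglet _ _ _ _ _ _ (.bang _ _ _ d) e⟩, subst0_typed e d⟩
  | @bang_eta _ _ _ _ A _ d e =>
    obtain ⟨e'⟩ := shift_typed A e
    obtain ⟨e''⟩ := ssubst_typed e' (.bang _ _ _ (var0 _ _))
    exact ⟨⟨.banglet _ _ _ _ _ _ d e''⟩, ssubst_typed e d⟩
  | copow_beta d1 d2 e =>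
    obtain ⟨e'⟩ := subst0_typed e d1
    exact ⟨⟨.copowlet _ _ _ _ _ _ _ (.copow _ _ _ _ _ _ d1 d2) e⟩, ssubst_typed e' d2⟩
  | @copow_eta _ _ _ _ A _ _ d e =>
    obtain ⟨e'⟩ := shift_typed A e
    obtain ⟨e''⟩ := ssubst_typed e' (.copow _ _ _ _ _ _ (var0 _ _) (.svar _ _))
    exact ⟨⟨.copowlet _ _ _ _ _ _ _ d e''⟩, ssubst_typed e d⟩
  | czero_eta d e => exact ⟨⟨.cimage _ _ _ _ d⟩, ssubst_typed e d⟩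
  | csum_beta_inl d1 d2 e =>
    exact ⟨⟨.ccase _ _ _ _ _ _ _ _ (.cinl _ _ _ _ _ e) d1 d2⟩, ssubst_typed d1 e⟩
  | csum_beta_inr d1 d2 e =>
    exact ⟨⟨.ccase _ _ _ _ _ _ _ _ (.cinr _ _ _ _ _ e) d1 d2⟩, ssubst_typed d2 e⟩
  | csum_eta d e =>
    obtain ⟨e1⟩ := ssubst_typed e (.cinl _ _ _ _ _ (.svar _ _))
    obtain ⟨e2⟩ := ssubst_typed e (.cinr _ _ _ _ _ (.svar _ _))
    exact ⟨⟨.ccase _ _ _ _ _ _ _ _ d e1 e2⟩, ssubst_typed e d⟩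
  | llam_beta d e => exact ⟨⟨.lapp _ _ _ _ _ _ (.llam _ _ _ _ d) e⟩, ssubst_typed d e⟩
  | llam_eta d => exact ⟨⟨.llam _ _ _ _ (.lapp _ _ _ _ _ _ d (.svar _ _))⟩, ⟨d⟩⟩

theorem EEq.left {Γ : List VType} {Δ : Option CType} {t u : Tm} {A : VType}
    (h : EEq Γ Δ t u A) : EEq Γ Δ t t A := h.trans h.symm

theorem EEq.right {Γ : List VType} {Δ : Option CType} {t u : Tm} {A : VType}
    (h : EEq Γ Δ t u A) : EEq Γ Δ u u A := h.symm.trans h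

theorem EEq.sfree {Γ : List VType} {t u : Tm} {A : VType} (h : EEq Γ none t u A) : SFree t :=
  h.regular.1.elim Deriv.sfree

/-! ## Derived equations -/

section
variable {Γ : List VType} {Δ : Option CType} {A : VType} {B C D : CType} {t t' u u' s s' k : Tm}

theorem EEq.shift (h : EEq Γ Δ t u A) (A' : VType) :
    EEq (A' :: Γ) Δ (Tm.shift t) (Tm.shift t) A := by
  obtain ⟨d⟩ := h.regular.1
  exact .refl (d.exists_shift .iunit A').choose

theorem EEq.var (n : ℕ) (h : Γ[n]? = some A) : EEq Γ none (.var n) (.var n) A :=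
  .refl (.var _ _ _ h)

theorem EEq.svar : EEq Γ (some B) .svar .svar (.comp B) := .refl (.svar _ _)

theorem EEq.cunit : EEq Γ Δ .cunit .cunit (.comp .cunit) := .refl (.cunit _ _)

theorem EEq.beta_llam (h : EEq Γ (some B) t t' (.comp C)) (hu : EEq Γ Δ u u' (.comp B)) :
    EEq Γ Δ (.lapp (.llam B t) u) (ssubst u' t') (.comp C) := by
  obtain ⟨d⟩ := h.regular.2
  obtain ⟨e⟩ := hu.regular.2
  exact (EEq.lapp_cong (.llam_cong h) hu).trans (.llam_beta d e)

theorem EEq.ssubst (h : EEq Γ (some B) t t' (.comp C)) (hu : EEq Γ Δ u u' (.comp B)) :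
    EEq Γ Δ (Tm.ssubst u t) (Tm.ssubst u' t') (.comp C) :=
  (EEq.beta_llam h.left hu.left).symm.trans (EEq.beta_llam h hu)

theorem EEq.beta_vlam {A' : VType} (h : EEq (A :: Γ) none t t' A') (hu : EEq Γ none u u' A) :
    EEq Γ none (.vapp (.vlam A t) u) (Tm.subst0 u' t') A' := by
  obtain ⟨d⟩ := h.regular.2
  obtain ⟨e⟩ := hu.regular.2
  exact (EEq.vapp_cong (.vlam_cong h) hu).trans (.vlam_beta d e)

theorem EEq.beta_clam (h : EEq (A :: Γ) Δ t t' (.comp B)) (hu : EEq Γ none u u' A) :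
    EEq Γ Δ (.capp (.clam A t) u) (Tm.subst0 u' t') (.comp B) := by
  obtain ⟨d⟩ := h.regular.2
  obtain ⟨e⟩ := hu.regular.2
  exact (EEq.capp_cong (.clam_cong h) hu).trans (.clam_beta d e)

theorem EEq.beta_vfst {A' : VType} (h : EEq Γ none t t' A) (hu : EEq Γ none u u' A') :
    EEq Γ none (.vfst (.vpair t u)) t' A := by
  obtain ⟨d⟩ := h.regular.2
  obtain ⟨e⟩ := hu.regular.2
  exact (EEq.vfst_cong (.vpair_cong h hu)).trans (.vfst_beta d e)

theorem EEq.beta_vsnd {A' : VType} (h : EEq Γ none t t' A) (hu : EEq Γ none u u' A') :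
    EEq Γ none (.vsnd (.vpair t u)) u' A' := by
  obtain ⟨d⟩ := h.regular.2
  obtain ⟨e⟩ := hu.regular.2
  exact (EEq.vsnd_cong (.vpair_cong h hu)).trans (.vsnd_beta d e)

theorem EEq.beta_cfst (h : EEq Γ Δ t t' (.comp B)) (hu : EEq Γ Δ u u' (.comp C)) :
    EEq Γ Δ (.cfst (.cpair t u)) t' (.comp B) := by
  obtain ⟨d⟩ := h.regular.2
  obtain ⟨e⟩ := hu.regular.2
  exact (EEq.cfst_cong (.cpair_cong h hu)).trans (.cfst_beta d e)

theorem EEq.beta_csnd (h : EEq Γ Δ t t' (.comp B)) (hu : EEq Γ Δ u u' (.comp C)) :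
    EEq Γ Δ (.csnd (.cpair t u)) u' (.comp C) := by
  obtain ⟨d⟩ := h.regular.2
  obtain ⟨e⟩ := hu.regular.2
  exact (EEq.csnd_cong (.cpair_cong h hu)).trans (.csnd_beta d e)

theorem EEq.beta_copow (ht : EEq Γ none t t' A) (hs : EEq Γ Δ s s' (.comp B))
    (hu : EEq (A :: Γ) (some B) u u' (.comp C)) :
    EEq Γ Δ (.copowlet (.copow t s) u) (Tm.ssubst s' (Tm.subst0 t' u')) (.comp C) := by
  obtain ⟨d1⟩ := ht.regular.2
  obtain ⟨d2⟩ := hs.regular.2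
  obtain ⟨d3⟩ := hu.regular.2
  exact (EEq.copowlet_cong (.copow_cong ht hs) hu).trans (.copow_beta d1 d2 d3)

theorem EEq.beta_cinl (hs : EEq Γ Δ s s' (.comp B)) (ht : EEq Γ (some B) t t' (.comp D))
    (hu : EEq Γ (some C) u u' (.comp D)) :
    EEq Γ Δ (.ccase (.cinl s) t u) (Tm.ssubst s' t') (.comp D) := by
  obtain ⟨d1⟩ := hs.regular.2
  obtain ⟨d2⟩ := ht.regular.2
  obtain ⟨d3⟩ := hu.regular.2
  exact (EEq.ccase_cong (.cinl_cong hs) ht hu).trans (.csum_beta_inl d2 d3 d1)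

theorem EEq.beta_cinr (hs : EEq Γ Δ s s' (.comp C)) (ht : EEq Γ (some B) t t' (.comp D))
    (hu : EEq Γ (some C) u u' (.comp D)) :
    EEq Γ Δ (.ccase (.cinr s) t u) (Tm.ssubst s' u') (.comp D) := by
  obtain ⟨d1⟩ := hs.regular.2
  obtain ⟨d2⟩ := ht.regular.2
  obtain ⟨d3⟩ := hu.regular.2
  exact (EEq.ccase_cong (.cinr_cong hs) ht hu).trans (.csum_beta_inr d2 d3 d1)

theorem EEq.eta_cimage (ht : EEq Γ Δ t t' (.comp .czero))
    (hu : EEq Γ (some .czero) u u' (.comp B)) :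
    EEq Γ Δ (.cimage B t) (Tm.ssubst t' u') (.comp B) := by
  obtain ⟨d1⟩ := ht.regular.2
  obtain ⟨d2⟩ := hu.regular.2
  exact (EEq.cimage_cong ht).trans (.czero_eta d1 d2)

/-- Two terms agree as soon as they come from the stoup type `0̲`. -/
theorem EEq.of_czero (ht : EEq Γ (some .czero) t t (.comp B))
    (hu : EEq Γ (some .czero) u u (.comp B)) :
    EEq Γ (some .czero) t u (.comp B) := by
  have h1 := EEq.eta_cimage EEq.svar ht
  have h2 := EEq.eta_cimage EEq.svar hu
  rw [ssubst_svar] at h1 h2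
  exact h1.symm.trans h2

theorem EEq.eta_cunit (ht : EEq Γ Δ t t (.comp .cunit)) : EEq Γ Δ t .cunit (.comp .cunit) :=
  ht.regular.1.elim .cunit_eta

theorem EEq.eta_cpair (ht : EEq Γ Δ t t' (.comp (.cand B C))) :
    EEq Γ Δ (.cpair (.cfst t) (.csnd t)) t' (.comp (.cand B C)) := by
  obtain ⟨d⟩ := ht.regular.1
  exact (EEq.cpair_eta d).trans ht

theorem EEq.eta_clam (ht : EEq Γ Δ t t' (.comp (.carr A B))) :
    EEq Γ Δ (.clam A (.capp (Tm.shift t) (.var 0))) t' (.comp (.carr A B)) := by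
  obtain ⟨d⟩ := ht.regular.1
  exact (EEq.clam_eta d).trans ht

theorem EEq.eta_llam (ht : EEq Γ none t t' (.lin B C)) :
    EEq Γ none (.llam B (.lapp t .svar)) t' (.lin B C) := by
  obtain ⟨d⟩ := ht.regular.1
  exact (EEq.llam_eta d).trans ht

theorem EEq.eta_ccase (ht : EEq Γ (some (.csum B C)) t t' (.comp D)) :
    EEq Γ (some (.csum B C))
      (.ccase .svar (Tm.ssubst (.cinl .svar) t) (Tm.ssubst (.cinr .svar) t)) t' (.comp D) := by
  obtain ⟨d⟩ := ht.regular.1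
  have h := EEq.csum_eta (Deriv.svar Γ _) d
  rw [ssubst_svar] at h
  exact h.trans ht

theorem EEq.eta_copowlet (ht : EEq Γ (some (.copow A B)) t t' (.comp D)) :
    EEq Γ (some (.copow A B))
      (.copowlet .svar (Tm.ssubst (.copow (.var 0) .svar) (Tm.shift t))) t' (.comp D) := by
  obtain ⟨d⟩ := ht.regular.1
  have h := EEq.copow_eta (Deriv.svar Γ _) d
  rw [ssubst_svar] at h
  exact h.trans ht

theorem EEq.comm_ccase {E : CType} (ht : EEq Γ (some B) t t' (.comp D))
    (hu : EEq Γ (some C) u u' (.comp D))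
    (hk : EEq Γ (some D) k k (.comp E)) :
    EEq Γ (some (.csum B C)) (.ccase .svar (Tm.ssubst t k) (Tm.ssubst u k))
      (Tm.ssubst (.ccase .svar t' u') k) (.comp E) := by
  have e1 := hk.ssubst ((EEq.beta_cinl EEq.svar ht.left hu.left).trans
    (by simpa [ssubst_svar] using ht.left))
  have e2 := hk.ssubst ((EEq.beta_cinr EEq.svar ht.left hu.left).trans
    (by simpa [ssubst_svar] using hu.left))
  have h := (hk.ssubst (EEq.ccase_cong .svar ht.left hu.left)).eta_ccase
  rw [ssubst_ssubst, ssubst_ssubst] at h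
  exact ((EEq.ccase_cong .svar e1 e2).symm.trans h).trans (hk.ssubst (.ccase_cong .svar ht hu))

theorem EEq.comm_copowlet {E : CType} (ht : EEq (A :: Γ) (some B) t t' (.comp D))
    (hk : EEq Γ (some D) k k (.comp E)) :
    EEq Γ (some (.copow A B)) (.copowlet .svar (Tm.ssubst t (Tm.shift k)))
      (Tm.ssubst (.copowlet .svar t') k) (.comp E) := by
  obtain ⟨d⟩ := ht.regular.1
  have ht1 : EEq (A :: A :: Γ) (some B) (Tm.rename (liftN Nat.succ) t)
      (Tm.rename (liftN Nat.succ) t) (.comp D) :=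
    .refl (d.exists_rename .iunit (getElem?_lift (A := A) (fun n _ h => by simpa using h))).choose
  have e := (hk.shift A).ssubst (EEq.beta_copow (EEq.var 0 rfl) EEq.svar ht1)
  rw [ssubst_svar, subst0_var_rename] at e
  have h := (hk.ssubst (EEq.copowlet_cong .svar ht.left)).eta_copowlet
  rw [shift_ssubst, ssubst_ssubst] at h
  exact ((EEq.copowlet_cong .svar e).symm.trans h).trans (hk.ssubst (.copowlet_cong .svar ht))

end

/-! ## A uniform presentation of the translation of computation terms -/

/-- The body of the translation of a computation term: a term with a stoup variable of the
translated type. For an empty stoup this is the application of the translation to the stoup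
variable. -/
def Tm.uncurry : Option CType → Tm → Tm
  | none, x => .lapp x .svar
  | some _, x => x

/-- The inverse of `Tm.uncurry`, abstracting over the stoup variable if the stoup is empty. -/
def Tm.curry (K : CType) : Option CType → Tm → Tm
  | none, X => .llam K X
  | some _, X => X

/-- The codomain of the body of the translation of a computation term with a given stoup. -/
def cpsOut (R : CType) : Option CType → CType
  | none => R
  | some D => cpsC R D

section
variable {R : CType} {Γ : List VType} {Δ : Option CType} {t u s : Tm} {A : VType} {B C D : CType}

theorem cps_cunit : cps R (.cunit Γ Δ) = curry .czero Δ (.cimage (cpsOut R Δ) .svar) := by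
  cases Δ <;> rfl

theorem cps_cpair (d1 : Deriv Γ Δ t (.comp B)) (d2 : Deriv Γ Δ u (.comp C)) :
    cps R (.cpair _ _ _ _ _ _ d1 d2) = curry (.csum (cpsC R B) (cpsC R C)) Δ
      (.ccase .svar (uncurry Δ (cps R d1)) (uncurry Δ (cps R d2))) := by
  cases Δ <;> rfl

theorem cps_cfst (d : Deriv Γ Δ t (.comp (.cand B C))) :
    cps R (.cfst _ _ _ _ _ d) =
      curry (cpsC R B) Δ (Tm.ssubst (.cinl .svar) (uncurry Δ (cps R d))) := by
  cases Δ with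
  | none => simp [cps, curry, uncurry, ssubst, (d.sfree_cps R).ssubst_eq]
  | some _ => rfl

theorem cps_csnd (d : Deriv Γ Δ t (.comp (.cand B C))) :
    cps R (.csnd _ _ _ _ _ d) =
      curry (cpsC R C) Δ (Tm.ssubst (.cinr .svar) (uncurry Δ (cps R d))) := by
  cases Δ with
  | none => simp [cps, curry, uncurry, ssubst, (d.sfree_cps R).ssubst_eq]
  | some _ => rfl

theorem cps_clam (d : Deriv (A :: Γ) Δ t (.comp B)) :
    cps R (.clam _ _ _ _ _ d) =
      curry (.copow (cpsV R A) (cpsC R B)) Δ (.copowlet .svar (uncurry Δ (cps R d))) := by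
  cases Δ <;> rfl

theorem cps_capp (d1 : Deriv Γ Δ s (.comp (.carr A B))) (d2 : Deriv Γ none t A) :
    cps R (.capp _ _ _ _ _ _ d1 d2) = curry (cpsC R B) Δ
      (Tm.ssubst (.copow (cps R d2) .svar) (uncurry Δ (cps R d1))) := by
  cases Δ with
  | none => simp [cps, curry, uncurry, ssubst, (d1.sfree_cps R).ssubst_eq]
  | some _ => rfl

theorem cps_ilet (d1 : Deriv Γ Δ t (.comp .iunit)) (d2 : Deriv Γ none u (.comp B)) :
    cps R (.ilet _ _ _ _ _ d1 d2) = curry (cpsC R B) Δ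
      (Tm.ssubst (.lapp (cps R d2) .svar) (uncurry Δ (cps R d1))) := by
  cases Δ with
  | none => simp [cps, curry, uncurry, ssubst, (d1.sfree_cps R).ssubst_eq]
  | some _ => rfl

theorem cps_banglet (d1 : Deriv Γ Δ t (.comp (.bang A))) (d2 : Deriv (A :: Γ) none u (.comp B)) :
    cps R (.banglet _ _ _ _ _ _ d1 d2) = curry (cpsC R B) Δ
      (Tm.ssubst (.clam (cpsV R A) (.lapp (cps R d2) .svar)) (uncurry Δ (cps R d1))) := by
  cases Δ with
  | none => simp [cps, curry, uncurry, ssubst, (d1.sfree_cps R).ssubst_eq]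
  | some _ => rfl

theorem cps_copow (d1 : Deriv Γ none t A) (d2 : Deriv Γ Δ u (.comp B)) :
    cps R (.copow _ _ _ _ _ _ d1 d2) = curry (.carr (cpsV R A) (cpsC R B)) Δ
      (Tm.ssubst (.capp .svar (cps R d1)) (uncurry Δ (cps R d2))) := by
  cases Δ with
  | none => simp [cps, curry, uncurry, ssubst, (d2.sfree_cps R).ssubst_eq]
  | some _ => rfl

theorem cps_copowlet (d1 : Deriv Γ Δ s (.comp (.copow A B)))
    (d2 : Deriv (A :: Γ) (some B) t (.comp C)) :
    cps R (.copowlet _ _ _ _ _ _ _ d1 d2) = curry (cpsC R C) Δ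
      (Tm.ssubst (.clam (cpsV R A) (cps R d2)) (uncurry Δ (cps R d1))) := by
  cases Δ with
  | none => simp [cps, curry, uncurry, ssubst, (d1.sfree_cps R).ssubst_eq]
  | some _ => rfl

theorem cps_cimage (d : Deriv Γ Δ t (.comp .czero)) :
    cps R (.cimage _ _ _ B d) =
      curry (cpsC R B) Δ (Tm.ssubst .cunit (uncurry Δ (cps R d))) := by
  cases Δ with
  | none => simp [cps, curry, uncurry, ssubst, (d.sfree_cps R).ssubst_eq]
  | some _ => rfl

theorem cps_cinl (d : Deriv Γ Δ t (.comp B)) :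
    cps R (.cinl _ _ _ _ C d) = curry (.cand (cpsC R B) (cpsC R C)) Δ
      (Tm.ssubst (.cfst .svar) (uncurry Δ (cps R d))) := by
  cases Δ with
  | none => simp [cps, curry, uncurry, ssubst, (d.sfree_cps R).ssubst_eq]
  | some _ => rfl

theorem cps_cinr (d : Deriv Γ Δ t (.comp C)) :
    cps R (.cinr _ _ _ B _ d) = curry (.cand (cpsC R B) (cpsC R C)) Δ
      (Tm.ssubst (.csnd .svar) (uncurry Δ (cps R d))) := by
  cases Δ with
  | none => simp [cps, curry, uncurry, ssubst, (d.sfree_cps R).ssubst_eq]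
  | some _ => rfl

theorem cps_ccase (d1 : Deriv Γ Δ s (.comp (.csum B C))) (d2 : Deriv Γ (some B) t (.comp D))
    (d3 : Deriv Γ (some C) u (.comp D)) :
    cps R (.ccase _ _ _ _ _ _ _ _ d1 d2 d3) = curry (cpsC R D) Δ
      (Tm.ssubst (.cpair (cps R d2) (cps R d3)) (uncurry Δ (cps R d1))) := by
  cases Δ with
  | none => simp [cps, curry, uncurry, ssubst, (d1.sfree_cps R).ssubst_eq]
  | some _ => rfl

theorem cps_lapp (d1 : Deriv Γ none s (.lin B C)) (d2 : Deriv Γ Δ t (.comp B)) :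
    cps R (.lapp _ _ _ _ _ _ d1 d2) = curry (cpsC R C) Δ
      (Tm.ssubst (.lapp (cps R d1) .svar) (uncurry Δ (cps R d2))) := by
  cases Δ with
  | none => simp [cps, curry, uncurry, ssubst, (d2.sfree_cps R).ssubst_eq]
  | some _ => rfl

end

/-- The translation of the computation term derived by `d`, with its value variables instantiated
by `τ`, is equal to `X`. -/
def CEq (R : CType) (G : List VType) (τ : ℕ → Tm) {Γ : List VType} {Δ : Option CType} {t : Tm}
    {B : CType} (d : Deriv Γ Δ t (.comp B)) (X : Tm) : Prop :=
  EEq G (some (cpsC R B)) (psubst τ (uncurry Δ (cps R d))) X (.comp (cpsOut R Δ))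

/-- The translation of the term derived by `d`, with its value variables instantiated
by `τ`, is equal to `X`. -/
def VEq (R : CType) (G : List VType) (τ : ℕ → Tm) {Γ : List VType} {t : Tm}
    {A : VType} (d : Deriv Γ none t A) (X : Tm) : Prop :=
  EEq G none (psubst τ (cps R d)) X (cpsV R A)

section
variable {R : CType} {G : List VType} {τ : ℕ → Tm} {Γ : List VType} {Δ : Option CType} {t u s : Tm}
  {A A' : VType} {B C D : CType} {X Y Z : Tm}

theorem EEq.psubst_uncurry_curry {K : CType}
    (h : EEq G (some K) (psubst τ X) Y (.comp C)) :
    EEq G (some K) (psubst τ (uncurry Δ (curry K Δ X))) Y (.comp C) := by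
  cases Δ with
  | none => simpa [ssubst_svar, uncurry, curry, psubst] using EEq.beta_llam h EEq.svar
  | some _ => exact h

theorem VEq.toCEq {d : Deriv Γ none t (.comp B)} (h : VEq R G τ d X) :
    CEq R G τ d (.lapp X .svar) := EEq.lapp_cong h EEq.svar

theorem EEq.of_lapp_svar {x : Tm} (h : EEq G (some B) (.lapp x .svar) X (.comp C)) :
    EEq G none x (.llam B X) (.lin B C) := by
  obtain ⟨d⟩ := h.regular.1
  cases d with
  | lapp _ _ _ _ _ _ d1 d2 => cases d2; exact (EEq.llam_eta d1).symm.trans (.llam_cong h)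

theorem CEq.toVEq {d : Deriv Γ none t (.comp B)} (h : CEq R G τ d X) :
    VEq R G τ d (.llam (cpsC R B) X) := EEq.of_lapp_svar h

theorem VEq.var {n : ℕ} {h : Γ[n]? = some A} (hn : EEq G none (τ n) X (cpsV R A)) :
    VEq R G τ (.var _ _ _ h) X := hn

theorem VEq.unit : VEq R G τ (.unit Γ) .unit := .refl (.unit _)

theorem VEq.vpair {d1 : Deriv Γ none t A} {d2 : Deriv Γ none u A'}
    (h1 : VEq R G τ d1 X) (h2 : VEq R G τ d2 Y) : VEq R G τ (.vpair _ _ _ _ _ d1 d2) (.vpair X Y) :=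
  EEq.vpair_cong h1 h2

theorem VEq.vfst {d : Deriv Γ none t (.prod A A')}
    (h : VEq R G τ d X) : VEq R G τ (.vfst _ _ _ _ d) (.vfst X) := EEq.vfst_cong h

theorem VEq.vsnd {d : Deriv Γ none t (.prod A A')}
    (h : VEq R G τ d X) : VEq R G τ (.vsnd _ _ _ _ d) (.vsnd X) := EEq.vsnd_cong h

theorem VEq.vlam {d : Deriv (A :: Γ) none t A'} (h : VEq R (cpsV R A :: G) (liftS τ) d X) :
    VEq R G τ (.vlam _ _ _ _ d) (.vlam (cpsV R A) X) := EEq.vlam_cong h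

theorem VEq.vapp {d1 : Deriv Γ none t (.arr A A')} {d2 : Deriv Γ none u A}
    (h1 : VEq R G τ d1 X) (h2 : VEq R G τ d2 Y) : VEq R G τ (.vapp _ _ _ _ _ d1 d2) (.vapp X Y) :=
  EEq.vapp_cong h1 h2

theorem VEq.llam {d : Deriv Γ (some B) t (.comp C)} (h : CEq R G τ d X) :
    VEq R G τ (.llam _ _ _ _ d) (.llam (cpsC R C) X) := EEq.llam_cong h

theorem CEq.svar : CEq R G τ (.svar Γ B) .svar := EEq.svar

theorem CEq.cunit : CEq R G τ (.cunit Γ Δ) (.cimage (cpsOut R Δ) .svar) := by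
  unfold CEq
  rw [cps_cunit]
  exact EEq.psubst_uncurry_curry (.cimage_cong .svar)

theorem CEq.cpair {d1 : Deriv Γ Δ t (.comp B)} {d2 : Deriv Γ Δ u (.comp C)}
    (h1 : CEq R G τ d1 X) (h2 : CEq R G τ d2 Y) :
    CEq R G τ (.cpair _ _ _ _ _ _ d1 d2) (.ccase .svar X Y) := by
  unfold CEq
  rw [cps_cpair]
  exact EEq.psubst_uncurry_curry (.ccase_cong .svar h1 h2)

theorem CEq.cfst (hτ : ∀ n, SFree (τ n)) {d : Deriv Γ Δ t (.comp (.cand B C))}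
    (h : CEq R G τ d X) : CEq R G τ (.cfst _ _ _ _ _ d) (Tm.ssubst (.cinl .svar) X) := by
  unfold CEq
  rw [cps_cfst]
  refine EEq.psubst_uncurry_curry ?_
  rw [psubst_ssubst hτ]
  exact EEq.ssubst h (.cinl_cong .svar)

theorem CEq.csnd (hτ : ∀ n, SFree (τ n)) {d : Deriv Γ Δ t (.comp (.cand B C))}
    (h : CEq R G τ d X) : CEq R G τ (.csnd _ _ _ _ _ d) (Tm.ssubst (.cinr .svar) X) := by
  unfold CEq
  rw [cps_csnd]
  refine EEq.psubst_uncurry_curry ?_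
  rw [psubst_ssubst hτ]
  exact EEq.ssubst h (.cinr_cong .svar)

theorem CEq.clam {d : Deriv (A :: Γ) Δ t (.comp B)}
    (h : CEq R (cpsV R A :: G) (liftS τ) d X) :
    CEq R G τ (.clam _ _ _ _ _ d) (.copowlet .svar X) := by
  unfold CEq
  rw [cps_clam]
  exact EEq.psubst_uncurry_curry (.copowlet_cong .svar h)

theorem CEq.capp (hτ : ∀ n, SFree (τ n)) {d1 : Deriv Γ Δ s (.comp (.carr A B))}
    {d2 : Deriv Γ none t A} (h1 : CEq R G τ d1 X) (h2 : VEq R G τ d2 Y) :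
    CEq R G τ (.capp _ _ _ _ _ _ d1 d2) (Tm.ssubst (.copow Y .svar) X) := by
  unfold CEq
  rw [cps_capp]
  refine EEq.psubst_uncurry_curry ?_
  rw [psubst_ssubst hτ]
  exact EEq.ssubst h1 (.copow_cong h2 .svar)

theorem CEq.top : CEq R G τ (.top Γ) .svar :=
  EEq.psubst_uncurry_curry (Δ := none) .svar

theorem CEq.ilet (hτ : ∀ n, SFree (τ n)) {d1 : Deriv Γ Δ t (.comp .iunit)}
    {d2 : Deriv Γ none u (.comp B)} (h1 : CEq R G τ d1 X) (h2 : CEq R G τ d2 Y) :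
    CEq R G τ (.ilet _ _ _ _ _ d1 d2) (Tm.ssubst Y X) := by
  unfold CEq
  rw [cps_ilet]
  refine EEq.psubst_uncurry_curry ?_
  rw [psubst_ssubst hτ]
  exact EEq.ssubst h1 h2

theorem CEq.bang {d : Deriv Γ none t A} (h : VEq R G τ d X) :
    CEq R G τ (.bang _ _ _ d) (.capp .svar X) :=
  EEq.psubst_uncurry_curry (Δ := none) (.capp_cong .svar h)

theorem CEq.banglet (hτ : ∀ n, SFree (τ n)) {d1 : Deriv Γ Δ t (.comp (.bang A))}
    {d2 : Deriv (A :: Γ) none u (.comp B)} (h1 : CEq R G τ d1 X)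
    (h2 : CEq R (cpsV R A :: G) (liftS τ) d2 Y) :
    CEq R G τ (.banglet _ _ _ _ _ _ d1 d2) (Tm.ssubst (.clam (cpsV R A) Y) X) := by
  unfold CEq
  rw [cps_banglet]
  refine EEq.psubst_uncurry_curry ?_
  rw [psubst_ssubst hτ]
  exact EEq.ssubst h1 (.clam_cong h2)

theorem CEq.copow (hτ : ∀ n, SFree (τ n)) {d1 : Deriv Γ none t A} {d2 : Deriv Γ Δ u (.comp B)}
    (h1 : VEq R G τ d1 X) (h2 : CEq R G τ d2 Y) :
    CEq R G τ (.copow _ _ _ _ _ _ d1 d2) (Tm.ssubst (.capp .svar X) Y) := by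
  unfold CEq
  rw [cps_copow]
  refine EEq.psubst_uncurry_curry ?_
  rw [psubst_ssubst hτ]
  exact EEq.ssubst h2 (.capp_cong .svar h1)

theorem CEq.copowlet (hτ : ∀ n, SFree (τ n)) {d1 : Deriv Γ Δ s (.comp (.copow A B))}
    {d2 : Deriv (A :: Γ) (some B) t (.comp C)} (h1 : CEq R G τ d1 X)
    (h2 : CEq R (cpsV R A :: G) (liftS τ) d2 Y) :
    CEq R G τ (.copowlet _ _ _ _ _ _ _ d1 d2) (Tm.ssubst (.clam (cpsV R A) Y) X) := by
  unfold CEq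
  rw [cps_copowlet]
  refine EEq.psubst_uncurry_curry ?_
  rw [psubst_ssubst hτ]
  exact EEq.ssubst h1 (.clam_cong h2)

theorem CEq.cimage (hτ : ∀ n, SFree (τ n)) {d : Deriv Γ Δ t (.comp .czero)} (h : CEq R G τ d X) :
    CEq R G τ (.cimage _ _ _ B d) (Tm.ssubst .cunit X) := by
  unfold CEq
  rw [cps_cimage]
  refine EEq.psubst_uncurry_curry ?_
  rw [psubst_ssubst hτ]
  exact EEq.ssubst h .cunit

theorem CEq.cinl (hτ : ∀ n, SFree (τ n)) {d : Deriv Γ Δ t (.comp B)} (h : CEq R G τ d X) :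
    CEq R G τ (.cinl _ _ _ _ C d) (Tm.ssubst (.cfst .svar) X) := by
  unfold CEq
  rw [cps_cinl]
  refine EEq.psubst_uncurry_curry ?_
  rw [psubst_ssubst hτ]
  exact EEq.ssubst h (.cfst_cong .svar)

theorem CEq.cinr (hτ : ∀ n, SFree (τ n)) {d : Deriv Γ Δ t (.comp C)} (h : CEq R G τ d X) :
    CEq R G τ (.cinr _ _ _ B _ d) (Tm.ssubst (.csnd .svar) X) := by
  unfold CEq
  rw [cps_cinr]
  refine EEq.psubst_uncurry_curry ?_
  rw [psubst_ssubst hτ]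
  exact EEq.ssubst h (.csnd_cong .svar)

theorem CEq.ccase (hτ : ∀ n, SFree (τ n)) {d1 : Deriv Γ Δ s (.comp (.csum B C))}
    {d2 : Deriv Γ (some B) t (.comp D)} {d3 : Deriv Γ (some C) u (.comp D)}
    (h1 : CEq R G τ d1 X) (h2 : CEq R G τ d2 Y) (h3 : CEq R G τ d3 Z) :
    CEq R G τ (.ccase _ _ _ _ _ _ _ _ d1 d2 d3) (Tm.ssubst (.cpair Y Z) X) := by
  unfold CEq
  rw [cps_ccase]
  refine EEq.psubst_uncurry_curry ?_
  rw [psubst_ssubst hτ]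
  exact EEq.ssubst h1 (.cpair_cong h2 h3)

theorem CEq.lapp (hτ : ∀ n, SFree (τ n)) {d1 : Deriv Γ none s (.lin B C)}
    {d2 : Deriv Γ Δ t (.comp B)} (h1 : VEq R G τ d1 X) (h2 : CEq R G τ d2 Y) :
    CEq R G τ (.lapp _ _ _ _ _ _ d1 d2) (Tm.ssubst (.lapp X .svar) Y) := by
  unfold CEq
  rw [cps_lapp]
  refine EEq.psubst_uncurry_curry ?_
  rw [psubst_ssubst hτ]
  exact EEq.ssubst h2 (.lapp_cong h1 .svar)

end

/-! ## The translation preserves typing -/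

section
variable {R : CType} {Γ : List VType} {Δ : Option CType} {t u : Tm} {A : VType} {B : CType} {X : Tm}

theorem vEq_var {d : Deriv Γ none t A} : VEq R (cpsCtx R Γ) Tm.var d X ↔
    EEq (cpsCtx R Γ) none (cps R d) X (cpsV R A) := by
  rw [VEq, psubst_var]

theorem cEq_var {d : Deriv Γ Δ t (.comp B)} : CEq R (cpsCtx R Γ) Tm.var d X ↔
    EEq (cpsCtx R Γ) (some (cpsC R B)) (uncurry Δ (cps R d)) X (.comp (cpsOut R Δ)) := by
  rw [CEq, psubst_var]

theorem CEq.lift_var {d : Deriv (A :: Γ) Δ t (.comp B)} (h : CEq R (cpsCtx R (A :: Γ)) Tm.var d X) :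
    CEq R (cpsV R A :: cpsCtx R Γ) (liftS Tm.var) d X := by
  rw [liftS_var]; exact h

theorem getElem?_cpsCtx {n : ℕ} (h : Γ[n]? = some A) : (cpsCtx R Γ)[n]? = some (cpsV R A) := by
  simp [cpsCtx, h]

theorem uncurry_shift (x : Tm) : uncurry Δ (shift x) = shift (uncurry Δ x) := by
  cases Δ <;> rfl

/-- The terms `x` and `y` are equal as translations of terms of type `A` with stoup `Δ`. -/
def CpsEq (R : CType) (Γ : List VType) (Δ : Option CType) (x y : Tm) (A : VType) : Prop :=
  (Δ = none → EEq (cpsCtx R Γ) none x y (cpsV R A)) ∧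
    ∀ B, A = .comp B → EEq (cpsCtx R Γ) (some (cpsC R B)) (uncurry Δ x) (uncurry Δ y)
      (.comp (cpsOut R Δ))

theorem CpsEq.ofC {d : Deriv Γ Δ t (.comp B)} {d' : Deriv Γ Δ u (.comp B)}
    (h : CEq R (cpsCtx R Γ) Tm.var d X) (h' : CEq R (cpsCtx R Γ) Tm.var d' X) :
    CpsEq R Γ Δ (cps R d) (cps R d') (.comp B) := by
  refine ⟨?_, ?_⟩
  · rintro rfl
    exact (vEq_var.1 h.toVEq).trans (vEq_var.1 h'.toVEq).symm
  · rintro _ ⟨⟩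
    exact (cEq_var.1 h).trans (cEq_var.1 h').symm

theorem CpsEq.ofV {d : Deriv Γ none t A} {d' : Deriv Γ none u A}
    (h : VEq R (cpsCtx R Γ) Tm.var d X) (h' : VEq R (cpsCtx R Γ) Tm.var d' X) :
    CpsEq R Γ none (cps R d) (cps R d') A := by
  refine ⟨fun _ => (vEq_var.1 h).trans (vEq_var.1 h').symm, ?_⟩
  rintro _ rfl
  exact (cEq_var.1 h.toCEq).trans (cEq_var.1 h'.toCEq).symm

theorem CpsEq.toC {d : Deriv Γ Δ t (.comp B)} {d' : Deriv Γ Δ u (.comp B)}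
    (h : CpsEq R Γ Δ (cps R d) (cps R d') (.comp B)) :
    ∃ X, CEq R (cpsCtx R Γ) Tm.var d X ∧ CEq R (cpsCtx R Γ) Tm.var d' X :=
  ⟨_, cEq_var.2 (h.2 _ rfl), cEq_var.2 (h.2 _ rfl).right⟩

theorem CpsEq.toV {d : Deriv Γ none t A} {d' : Deriv Γ none u A}
    (h : CpsEq R Γ none (cps R d) (cps R d') A) :
    ∃ X, VEq R (cpsCtx R Γ) Tm.var d X ∧ VEq R (cpsCtx R Γ) Tm.var d' X :=
  ⟨_, vEq_var.2 (h.1 rfl), vEq_var.2 (h.1 rfl).right⟩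

theorem SFree.var (n : ℕ) : SFree (Tm.var n) := trivial

theorem Deriv.cpsEq_self (d : Deriv Γ Δ t A) : CpsEq R Γ Δ (cps R d) (cps R d) A := by
  have ofC : ∀ {Γ Δ t B X} {d : Deriv Γ Δ t (.comp B)}, CEq R (cpsCtx R Γ) Tm.var d X →
      CpsEq R Γ Δ (cps R d) (cps R d) (.comp B) := fun h => .ofC h h
  have ofV : ∀ {Γ t A X} {d : Deriv Γ none t A}, VEq R (cpsCtx R Γ) Tm.var d X →
      CpsEq R Γ none (cps R d) (cps R d) A := fun h => .ofV h h
  have toV : ∀ {Γ t A} {d : Deriv Γ none t A},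
      EEq (cpsCtx R Γ) none (cps R d) (cps R d) (cpsV R A)
        → VEq R (cpsCtx R Γ) Tm.var d (cps R d) :=
    vEq_var.2
  have toC : ∀ {Γ Δ t B} {d : Deriv Γ Δ t (.comp B)},
      EEq (cpsCtx R Γ) (some (cpsC R B)) (uncurry Δ (cps R d)) (uncurry Δ (cps R d))
        (.comp (cpsOut R Δ)) → CEq R (cpsCtx R Γ) Tm.var d (uncurry Δ (cps R d)) := cEq_var.2
  induction d with
  | var Γ n A h => exact ofV (.var (.var n (getElem?_cpsCtx h)))
  | svar Γ A => exact ofC .svar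
  | unit Γ => exact ofV .unit
  | vpair Γ t u A B d1 d2 ih1 ih2 => exact ofV (.vpair (toV (ih1.1 rfl)) (toV (ih2.1 rfl)))
  | vfst Γ t A B d ih => exact ofV (.vfst (toV (ih.1 rfl)))
  | vsnd Γ t A B d ih => exact ofV (.vsnd (toV (ih.1 rfl)))
  | vlam Γ t A B d ih =>
    refine ofV (.vlam (X := cps R d) ?_)
    rw [liftS_var]
    exact toV (ih.1 rfl)
  | vapp Γ s t A B d1 d2 ih1 ih2 => exact ofV (.vapp (toV (ih1.1 rfl)) (toV (ih2.1 rfl)))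
  | cunit Γ Δ => exact ofC .cunit
  | cpair Γ Δ t u A B d1 d2 ih1 ih2 =>
    exact ofC (.cpair (toC (ih1.2 _ rfl)) (toC (ih2.2 _ rfl)))
  | cfst Γ Δ t A B d ih => exact ofC (.cfst SFree.var (toC (ih.2 _ rfl)))
  | csnd Γ Δ t A B d ih => exact ofC (.csnd SFree.var (toC (ih.2 _ rfl)))
  | clam Γ Δ t A B d ih => exact ofC (.clam (toC (ih.2 _ rfl)).lift_var)
  | capp Γ Δ s t A B d1 d2 ih1 ih2 =>
    exact ofC (.capp SFree.var (toC (ih1.2 _ rfl)) (toV (ih2.1 rfl)))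
  | top Γ => exact ofC .top
  | ilet Γ Δ t u A d1 d2 ih1 ih2 =>
    exact ofC (.ilet SFree.var (toC (ih1.2 _ rfl)) (toC (ih2.2 _ rfl)))
  | bang Γ t A d ih => exact ofC (.bang (toV (ih.1 rfl)))
  | banglet Γ Δ t u A B d1 d2 ih1 ih2 =>
    exact ofC (.banglet SFree.var (toC (ih1.2 _ rfl)) (toC (ih2.2 _ rfl)).lift_var)
  | copow Γ Δ t u A B d1 d2 ih1 ih2 =>
    exact ofC (.copow SFree.var (toV (ih1.1 rfl)) (toC (ih2.2 _ rfl)))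
  | copowlet Γ Δ s t A B C d1 d2 ih1 ih2 =>
    exact ofC (.copowlet SFree.var (toC (ih1.2 _ rfl)) (toC (ih2.2 _ rfl)).lift_var)
  | cimage Γ Δ t A d ih => exact ofC (.cimage SFree.var (toC (ih.2 _ rfl)))
  | cinl Γ Δ t A B d ih => exact ofC (.cinl SFree.var (toC (ih.2 _ rfl)))
  | cinr Γ Δ t A B d ih => exact ofC (.cinr SFree.var (toC (ih.2 _ rfl)))
  | ccase Γ Δ s t u A B C d1 d2 d3 ih1 ih2 ih3 =>
    exact ofC (.ccase SFree.var (toC (ih1.2 _ rfl)) (toC (ih2.2 _ rfl)) (toC (ih3.2 _ rfl)))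
  | llam Γ t A B d ih => exact ofV (.llam (toC (ih.2 _ rfl)))
  | lapp Γ Δ s t A B d1 d2 ih1 ih2 =>
    exact ofC (.lapp SFree.var (toV (ih1.1 rfl)) (toC (ih2.2 _ rfl)))

theorem VEq.self (d : Deriv Γ none t A) : VEq R (cpsCtx R Γ) Tm.var d (cps R d) :=
  vEq_var.2 (d.cpsEq_self.1 rfl)

theorem CEq.self (d : Deriv Γ Δ t (.comp B)) :
    CEq R (cpsCtx R Γ) Tm.var d (uncurry Δ (cps R d)) :=
  cEq_var.2 (d.cpsEq_self.2 _ rfl)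

end

/-! ## Translation of substitution for the stoup variable -/

theorem Deriv.exists_ssubst_aux (R : CType) {Γ : List VType} {Δ' : Option CType} {t : Tm}
    {A : VType} (d : Deriv Γ Δ' t A) : ∀ {B D : CType} {Δ : Option CType} {u : Tm}
      (e : Deriv Γ Δ u (.comp D)), A = .comp B → Δ' = some D →
      ∃ d' : Deriv Γ Δ (ssubst u t) (.comp B),
        CEq R (cpsCtx R Γ) Tm.var d' (ssubst (cps R d) (uncurry Δ (cps R e))) := by
    induction d with
  | svar =>
    rintro B D Δ u e ⟨⟩ ⟨⟩
    refine ⟨e, ?_⟩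
    rw [cps, ssubst_svar]
    exact CEq.self e
  | cunit =>
    rintro B D Δ u e ⟨⟩ ⟨⟩
    refine ⟨.cunit _ _, CEq.cunit.trans (EEq.of_czero (.cimage_cong .svar) ?_)⟩
    exact (cEq_var.1 (CEq.self e)).ssubst (.cimage_cong .svar)
  | cpair Γ Δ t u A B d1 d2 ih1 ih2 =>
    rintro _ D Δ u e ⟨⟩ rfl
    obtain ⟨d1', h1⟩ := ih1 e rfl rfl
    obtain ⟨d2', h2⟩ := ih2 e rfl rfl
    refine ⟨.cpair _ _ _ _ _ _ d1' d2', (h1.cpair h2).trans ?_⟩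
    exact EEq.comm_ccase (cEq_var.1 (CEq.self d1)) (cEq_var.1 (CEq.self d2))
      (cEq_var.1 (CEq.self e))
  | cfst Γ Δ t A B d ih =>
    rintro _ D Δ u e ⟨⟩ rfl
    obtain ⟨d', h⟩ := ih e rfl rfl
    refine ⟨.cfst _ _ _ _ _ d', ?_⟩
    have := h.cfst SFree.var
    rwa [ssubst_ssubst] at this
  | csnd Γ Δ t A B d ih =>
    rintro _ D Δ u e ⟨⟩ rfl
    obtain ⟨d', h⟩ := ih e rfl rfl
    refine ⟨.csnd _ _ _ _ _ d', ?_⟩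
    have := h.csnd SFree.var
    rwa [ssubst_ssubst] at this
  | clam Γ Δ t A B d ih =>
    rintro _ D Δ u e ⟨⟩ rfl
    obtain ⟨e', he⟩ := e.exists_shift R A
    obtain ⟨d', h⟩ := ih e' rfl rfl
    refine ⟨.clam _ _ _ _ _ d', h.lift_var.clam.trans ?_⟩
    rw [he, uncurry_shift]
    exact EEq.comm_copowlet (cEq_var.1 (CEq.self d)) (cEq_var.1 (CEq.self e))
  | capp Γ Δ s t A B d1 d2 ih1 ih2 =>
    rintro _ D Δ u e ⟨⟩ rfl
    obtain ⟨d1', h1⟩ := ih1 e rfl rfl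
    rw [ssubst, d2.sfree.ssubst_eq u]
    refine ⟨.capp _ _ _ _ _ _ d1' d2, ?_⟩
    have := h1.capp SFree.var (VEq.self d2)
    rwa [ssubst_ssubst] at this
  | ilet Γ Δ t u A d1 d2 ih1 ih2 =>
    rintro _ D Δ u e ⟨⟩ rfl
    obtain ⟨d1', h1⟩ := ih1 e rfl rfl
    rw [ssubst, d2.sfree.ssubst_eq u]
    refine ⟨.ilet _ _ _ _ _ d1' d2, ?_⟩
    have := h1.ilet SFree.var (CEq.self d2)
    rwa [ssubst_ssubst] at this
  | banglet Γ Δ t u A B d1 d2 ih1 ih2 =>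
    rintro _ D Δ u e ⟨⟩ rfl
    obtain ⟨d1', h1⟩ := ih1 e rfl rfl
    rw [ssubst, d2.sfree.ssubst_eq (shift u)]
    refine ⟨.banglet _ _ _ _ _ _ d1' d2, ?_⟩
    have := h1.banglet SFree.var (CEq.self d2).lift_var
    rwa [ssubst_ssubst] at this
  | copow Γ Δ t u A B d1 d2 ih1 ih2 =>
    rintro _ D Δ u e ⟨⟩ rfl
    obtain ⟨d2', h2⟩ := ih2 e rfl rfl
    rw [ssubst, d1.sfree.ssubst_eq u]
    refine ⟨.copow _ _ _ _ _ _ d1 d2', ?_⟩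
    have := h2.copow SFree.var (VEq.self d1)
    rwa [ssubst_ssubst] at this
  | copowlet Γ Δ s t A B C d1 d2 ih1 ih2 =>
    rintro _ D Δ u e ⟨⟩ rfl
    obtain ⟨d1', h1⟩ := ih1 e rfl rfl
    refine ⟨.copowlet _ _ _ _ _ _ _ d1' d2, ?_⟩
    have := h1.copowlet SFree.var (CEq.self d2).lift_var
    rwa [ssubst_ssubst] at this
  | cimage Γ Δ t A d ih =>
    rintro _ D Δ u e ⟨⟩ rfl
    obtain ⟨d', h⟩ := ih e rfl rfl
    refine ⟨.cimage _ _ _ _ d', ?_⟩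
    have := h.cimage (B := A) SFree.var
    rwa [ssubst_ssubst] at this
  | cinl Γ Δ t A B d ih =>
    rintro _ D Δ u e ⟨⟩ rfl
    obtain ⟨d', h⟩ := ih e rfl rfl
    refine ⟨.cinl _ _ _ _ _ d', ?_⟩
    have := h.cinl (C := B) SFree.var
    rwa [ssubst_ssubst] at this
  | cinr Γ Δ t A B d ih =>
    rintro _ D Δ u e ⟨⟩ rfl
    obtain ⟨d', h⟩ := ih e rfl rfl
    refine ⟨.cinr _ _ _ _ _ d', ?_⟩
    have := h.cinr (B := A) SFree.var
    rwa [ssubst_ssubst] at this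
  | ccase Γ Δ s t u A B C d1 d2 d3 ih1 ih2 ih3 =>
    rintro _ D Δ u e ⟨⟩ rfl
    obtain ⟨d1', h1⟩ := ih1 e rfl rfl
    refine ⟨.ccase _ _ _ _ _ _ _ _ d1' d2 d3, ?_⟩
    have := h1.ccase SFree.var (CEq.self d2) (CEq.self d3)
    rwa [ssubst_ssubst] at this
  | lapp Γ Δ s t A B d1 d2 ih1 ih2 =>
    rintro _ D Δ u e ⟨⟩ rfl
    obtain ⟨d2', h2⟩ := ih2 e rfl rfl
    rw [ssubst, d1.sfree.ssubst_eq u]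
    refine ⟨.lapp _ _ _ _ _ _ d1 d2', ?_⟩
    have := h2.lapp SFree.var (VEq.self d1)
    rwa [ssubst_ssubst] at this
  | _ => rintro _ _ _ _ _ _ ⟨⟩

theorem Deriv.exists_ssubst (R : CType) {Γ : List VType} {Δ : Option CType} {t u : Tm}
    {B D : CType} (d : Deriv Γ (some D) t (.comp B)) (e : Deriv Γ Δ u (.comp D)) :
    ∃ d' : Deriv Γ Δ (ssubst u t) (.comp B),
      CEq R (cpsCtx R Γ) Tm.var d' (ssubst (cps R d) (uncurry Δ (cps R e))) :=
  d.exists_ssubst_aux R e rfl rfl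

/-! ## Coercions

A raw term may have several types, because `cinl` and `cinr` do not record the missing
summand.  Types are compared by the order generated by `0̲ ≤ A̲` in positive positions; the
inequalities are realised by coercions between the translated types. -/

mutual
  /-- `CoV R H A f` states that `f : Hᶜ → Aᶜ` is the coercion for the inequality `H ≤ A`. -/
  inductive CoV (R : CType) : VType → VType → Tm → Prop
    | base (a : ℕ) : CoV R (.base a) (.base a) (.vlam (.base a) (.var 0))
    | unit : CoV R .unit .unit (.vlam .unit (.var 0))
    | prod {H A H' A' : VType} {f f' : Tm} : CoV R H A f → CoV R H' A' f' →
        CoV R (.prod H H') (.prod A A') (.vlam (.prod (cpsV R H) (cpsV R H'))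
          (.vpair (.vapp f (.vfst (.var 0))) (.vapp f' (.vsnd (.var 0)))))
    | arr {A H B : VType} {f : Tm} : CoV R H B f →
        CoV R (.arr A H) (.arr A B) (.vlam (.arr (cpsV R A) (cpsV R H))
          (.vlam (cpsV R A) (.vapp f (.vapp (.var 1) (.var 0)))))
    | comp {H A : CType} {e : Tm} : CoC R H A e →
        CoV R (.comp H) (.comp A) (.vlam (.lin (cpsC R H) R) (.llam (cpsC R A) (.lapp (.var 0) e)))
    | lin {A H B : CType} {e : Tm} : CoC R H B e →
        CoV R (.lin A H) (.lin A B)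
          (.vlam (.lin (cpsC R H) (cpsC R A)) (.llam (cpsC R B) (.lapp (.var 0) e)))
  /-- `CoC R H A e` states that `e`, with stoup `Aᶜ` and type `Hᶜ`, is the coercion for the
  inequality `H ≤ A`. -/
  inductive CoC (R : CType) : CType → CType → Tm → Prop
    | czero (A : CType) : CoC R .czero A .cunit
    | base (a : ℕ) : CoC R (.base a) (.base a) .svar
    | cunit : CoC R .cunit .cunit .svar
    | iunit : CoC R .iunit .iunit .svar
    | cand {H A H' A' : CType} {e e' : Tm} : CoC R H A e → CoC R H' A' e' →
        CoC R (.cand H H') (.cand A A') (.ccase .svar (.cinl e) (.cinr e'))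
    | carr {A : VType} {H B : CType} {e : Tm} : CoC R H B e →
        CoC R (.carr A H) (.carr A B) (.copowlet .svar (.copow (.var 0) e))
    | bang {H A : VType} {f : Tm} : CoV R H A f →
        CoC R (.bang H) (.bang A) (.clam (cpsV R H) (.capp .svar (.vapp f (.var 0))))
    | copow {H A : VType} {H' B : CType} {f e : Tm} : CoV R H A f → CoC R H' B e →
        CoC R (.copow H H') (.copow A B)
          (.clam (cpsV R H) (Tm.ssubst (.capp .svar (.vapp f (.var 0))) e))
    | csum {H A H' A' : CType} {e e' : Tm} : CoC R H A e → CoC R H' A' e' →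
        CoC R (.csum H H') (.csum A A')
          (.cpair (Tm.ssubst (.cfst .svar) e) (Tm.ssubst (.csnd .svar) e'))
end

section
variable {R : CType}

mutual
  theorem CoV.unique {H A : VType} {f f' : Tm} : CoV R H A f → CoV R H A f' → f = f'
    | .base _, .base _ => rfl
    | .unit, .unit => rfl
    | .prod h1 h2, .prod h1' h2' => by rw [h1.unique h1', h2.unique h2']
    | .arr h, .arr h' => by rw [h.unique h']
    | .comp h, .comp h' => by rw [h.unique h']
    | .lin h, .lin h' => by rw [h.unique h']
  theorem CoC.unique {H A : CType} {e e' : Tm} : CoC R H A e → CoC R H A e' → e = e'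
    | .czero _, .czero _ => rfl
    | .base _, .base _ => rfl
    | .cunit, .cunit => rfl
    | .iunit, .iunit => rfl
    | .cand h1 h2, .cand h1' h2' => by rw [h1.unique h1', h2.unique h2']
    | .carr h, .carr h' => by rw [h.unique h']
    | .bang h, .bang h' => by rw [h.unique h']
    | .copow h1 h2, .copow h1' h2' => by rw [h1.unique h1', h2.unique h2']
    | .csum h1 h2, .csum h1' h2' => by rw [h1.unique h1', h2.unique h2']
end

mutual
  theorem CoV.sfree {H A : VType} {f : Tm} : CoV R H A f → SFree f
    | .base _ => trivial
    | .unit => trivial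
    | .prod h1 h2 => ⟨⟨h1.sfree, trivial⟩, h2.sfree, trivial⟩
    | .arr h => ⟨h.sfree, trivial, trivial⟩
    | .comp _ => trivial
    | .lin _ => trivial
end

mutual
  theorem CoV.rename_eq {H A : VType} {f : Tm} : CoV R H A f → ∀ r, rename r f = f
    | .base _, _ => rfl
    | .unit, _ => rfl
    | .prod h1 h2, _ => by simp [rename, liftN, h1.rename_eq, h2.rename_eq]
    | .arr h, _ => by simp [rename, liftN, h.rename_eq]
    | .comp h, _ => by simp [rename, liftN, h.rename_eq]
    | .lin h, _ => by simp [rename, liftN, h.rename_eq]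
  theorem CoC.rename_eq {H A : CType} {e : Tm} : CoC R H A e → ∀ r, rename r e = e
    | .czero _, _ => rfl
    | .base _, _ => rfl
    | .cunit, _ => rfl
    | .iunit, _ => rfl
    | .cand h1 h2, _ => by simp [rename, h1.rename_eq, h2.rename_eq]
    | .carr h, _ => by simp [rename, liftN, h.rename_eq]
    | .bang h, _ => by simp [rename, liftN, h.rename_eq]
    | .copow h1 h2, _ => by simp [rename, liftN, rename_ssubst, h1.rename_eq, h2.rename_eq]
    | .csum h1 h2, _ => by simp [rename, rename_ssubst, h1.rename_eq, h2.rename_eq]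
end

theorem CoV.shift_eq {H A : VType} {f : Tm} (h : CoV R H A f) : shift f = f := h.rename_eq _

theorem CoC.shift_eq {H A : CType} {e : Tm} (h : CoC R H A e) : shift e = e := h.rename_eq _

theorem CoV.subst0_eq {H A : VType} {f : Tm} (h : CoV R H A f) (u : Tm) : subst0 u f = f := by
  conv_lhs => rw [← h.shift_eq]
  exact subst0_shift u f

theorem CoC.subst0_eq {H A : CType} {e : Tm} (h : CoC R H A e) (u : Tm) : subst0 u e = e := by
  conv_lhs => rw [← h.shift_eq]
  exact subst0_shift u e

mutual
  theorem CoV.typed {H A : VType} {f : Tm} : CoV R H A f → ∀ G,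
      EEq G none f f (.arr (cpsV R H) (cpsV R A))
    | .base _, _ => .vlam_cong (.var 0 rfl)
    | .unit, _ => .vlam_cong (.var 0 rfl)
    | .prod h1 h2, _ => .vlam_cong (.vpair_cong (.vapp_cong (h1.typed _) (.vfst_cong (.var 0 rfl)))
        (.vapp_cong (h2.typed _) (.vsnd_cong (.var 0 rfl))))
    | .arr h, _ => .vlam_cong (.vlam_cong
        (.vapp_cong (h.typed _) (.vapp_cong (.var 1 rfl) (.var 0 rfl))))
    | .comp h, _ => .vlam_cong (.llam_cong (.lapp_cong (.var 0 rfl) (h.typed _)))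
    | .lin h, _ => .vlam_cong (.llam_cong (.lapp_cong (.var 0 rfl) (h.typed _)))
  theorem CoC.typed {H A : CType} {e : Tm} : CoC R H A e → ∀ G,
      EEq G (some (cpsC R A)) e e (.comp (cpsC R H))
    | .czero _, _ => .cunit
    | .base _, _ => .svar
    | .cunit, _ => .svar
    | .iunit, _ => .svar
    | .cand h1 h2, _ => .ccase_cong .svar (.cinl_cong (h1.typed _)) (.cinr_cong (h2.typed _))
    | .carr h, _ => .copowlet_cong .svar (.copow_cong (.var 0 rfl) (h.typed _))
    | .bang h, _ => .clam_cong (.capp_cong .svar (.vapp_cong (h.typed _) (.var 0 rfl)))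
    | .copow h1 h2, _ => .clam_cong ((h2.typed _).ssubst
        (.capp_cong .svar (.vapp_cong (h1.typed _) (.var 0 rfl))))
    | .csum h1 h2, _ => .cpair_cong ((h1.typed _).ssubst (.cfst_cong .svar))
        ((h2.typed _).ssubst (.csnd_cong .svar))
end

/-! ### Computation rules for applied coercions -/

variable {G : List VType}

theorem CoV.vapp_prod {H A H' A' : VType} {f f' s : Tm} (h : CoV R H A f) (h' : CoV R H' A' f')
    (hs : EEq G none s s (.prod (cpsV R H) (cpsV R H'))) :
    EEq G none (.vapp (.vlam (.prod (cpsV R H) (cpsV R H'))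
      (.vpair (.vapp f (.vfst (.var 0))) (.vapp f' (.vsnd (.var 0))))) s)
      (.vpair (.vapp f (.vfst s)) (.vapp f' (.vsnd s))) (.prod (cpsV R A) (cpsV R A')) := by
  have e := EEq.beta_vlam (EEq.vpair_cong (.vapp_cong (h.typed _) (.vfst_cong (.var 0 rfl)))
    (.vapp_cong (h'.typed _) (.vsnd_cong (.var 0 rfl)))) hs
  have e1 := h.subst0_eq s
  have e2 := h'.subst0_eq s
  simp only [subst0, psubst] at e e1 e2
  rwa [e1, e2] at e

theorem CoV.vapp_arr {A H B : VType} {f s : Tm} (h : CoV R H B f)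
    (hs : EEq G none s s (.arr (cpsV R A) (cpsV R H))) :
    EEq G none (.vapp (.vlam (.arr (cpsV R A) (cpsV R H))
      (.vlam (cpsV R A) (.vapp f (.vapp (.var 1) (.var 0))))) s)
      (.vlam (cpsV R A) (.vapp f (.vapp (shift s) (.var 0)))) (.arr (cpsV R A) (cpsV R B)) := by
  have e := EEq.beta_vlam (EEq.vlam_cong
    (.vapp_cong (h.typed _) (.vapp_cong (.var 1 rfl) (.var 0 rfl)))) hs
  have e1 : psubst (liftS (consS s Tm.var)) f = f := by
    conv_lhs => rw [← h.shift_eq]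
    rw [← shift_psubst, ← Tm.subst0_eq, h.subst0_eq, h.shift_eq]
  simp only [Tm.subst0_eq, psubst] at e
  rwa [e1] at e

theorem CoC.vapp_llam {H B C : CType} {e s : Tm} (h : CoC R H B e)
    (hs : EEq G none s s (.lin (cpsC R H) C)) :
    EEq G none (.vapp (.vlam (.lin (cpsC R H) C) (.llam (cpsC R B) (.lapp (.var 0) e))) s)
      (.llam (cpsC R B) (.lapp s e)) (.lin (cpsC R B) C) := by
  have e := EEq.beta_vlam (EEq.llam_cong (.lapp_cong (.var 0 rfl) (h.typed _))) hs
  have e1 := h.subst0_eq s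
  simp only [subst0, psubst] at e e1
  rwa [e1] at e

theorem EEq.vapp_id {A : VType} {s s' : Tm} (hs : EEq G none s s' A) :
    EEq G none (.vapp (.vlam A (.var 0)) s) s' A :=
  EEq.beta_vlam (.var 0 rfl) hs

end

section
variable {R : CType} {G : List VType}

/-! ### Coercions form a preorder with bounded joins -/

theorem EEq.eta_vpair {A B : VType} {s s' : Tm} (hs : EEq G none s s' (.prod A B)) :
    EEq G none (.vpair (.vfst s) (.vsnd s)) s' (.prod A B) :=
  (hs.regular.1.elim EEq.vpair_eta).trans hs

theorem EEq.eta_vlam {A B : VType} {s s' : Tm} (hs : EEq G none s s' (.arr A B)) :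
    EEq G none (.vlam A (.vapp (Tm.shift s) (.var 0))) s' (.arr A B) :=
  (hs.regular.1.elim EEq.vlam_eta).trans hs

theorem EEq.beta_shift_vlam {A B : VType} {s s' : Tm} (hs : EEq (A :: G) none s s' B) :
    EEq (A :: G) none (.vapp (Tm.shift (.vlam A s)) (.var 0)) s' B := by
  obtain ⟨d⟩ := ((EEq.vlam_cong hs.left).shift A).regular.1
  cases d with
  | vlam _ _ _ _ d =>
    have e := EEq.vlam_beta d (.var _ 0 _ rfl)
    rw [subst0_var_rename] at e
    exact e.trans hs

mutual
  theorem CoV.exists_refl : ∀ A : VType, ∃ f, CoV R A A f ∧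
      ∀ G s, EEq G none s s (cpsV R A) → EEq G none (.vapp f s) s (cpsV R A)
    | .base a => ⟨_, .base a, fun _ _ hs => hs.vapp_id⟩
    | .unit => ⟨_, .unit, fun _ _ hs => hs.vapp_id⟩
    | .prod A B => by
      obtain ⟨f, hf, ef⟩ := CoV.exists_refl A
      obtain ⟨g, hg, eg⟩ := CoV.exists_refl B
      exact ⟨_, hf.prod hg, fun G s hs => (hf.vapp_prod hg hs).trans
        ((EEq.vpair_cong (ef _ _ hs.vfst_cong) (eg _ _ hs.vsnd_cong)).trans hs.eta_vpair)⟩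
    | .arr A B => by
      obtain ⟨g, hg, eg⟩ := CoV.exists_refl B
      exact ⟨_, hg.arr, fun G s hs => (hg.vapp_arr hs).trans
        ((EEq.vlam_cong (eg _ _ (.vapp_cong (hs.shift _) (.var 0 rfl)))).trans hs.eta_vlam)⟩
    | .comp A => by
      obtain ⟨e, he, ee⟩ := CoC.exists_refl A
      exact ⟨_, .comp he, fun G s hs => (he.vapp_llam hs).trans
        ((EEq.llam_cong (.lapp_cong hs (ee _))).trans hs.eta_llam)⟩
    | .lin A B => by
      obtain ⟨e, he, ee⟩ := CoC.exists_refl B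
      exact ⟨_, .lin he, fun G s hs => (he.vapp_llam hs).trans
        ((EEq.llam_cong (.lapp_cong hs (ee _))).trans hs.eta_llam)⟩
  theorem CoC.exists_refl : ∀ A : CType, ∃ e, CoC R A A e ∧
      ∀ G, EEq G (some (cpsC R A)) e .svar (.comp (cpsC R A))
    | .base a => ⟨_, .base a, fun _ => .svar⟩
    | .cunit => ⟨_, .cunit, fun _ => .svar⟩
    | .iunit => ⟨_, .iunit, fun _ => .svar⟩
    | .czero => ⟨_, .czero _, fun _ => (EEq.eta_cunit .svar).symm⟩
    | .cand A B => by
      obtain ⟨e, he, ee⟩ := CoC.exists_refl A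
      obtain ⟨e', he', ee'⟩ := CoC.exists_refl B
      exact ⟨_, he.cand he', fun G =>
        (EEq.ccase_cong .svar (.cinl_cong (ee _)) (.cinr_cong (ee' _))).trans (EEq.eta_ccase .svar)⟩
    | .carr A B => by
      obtain ⟨e, he, ee⟩ := CoC.exists_refl B
      exact ⟨_, he.carr, fun G =>
        (EEq.copowlet_cong .svar (.copow_cong (.var 0 rfl) (ee _))).trans (EEq.eta_copowlet .svar)⟩
    | .bang A => by
      obtain ⟨f, hf, ef⟩ := CoV.exists_refl A
      exact ⟨_, .bang hf, fun G =>
        (EEq.clam_cong (.capp_cong .svar (ef _ _ (.var 0 rfl)))).trans (EEq.eta_clam .svar)⟩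
    | .copow A B => by
      obtain ⟨f, hf, ef⟩ := CoV.exists_refl A
      obtain ⟨e, he, ee⟩ := CoC.exists_refl B
      exact ⟨_, .copow hf he, fun G =>
        (EEq.clam_cong ((ee _).ssubst (.capp_cong .svar (ef _ _ (.var 0 rfl))))).trans
          (EEq.eta_clam .svar)⟩
    | .csum A B => by
      obtain ⟨e, he, ee⟩ := CoC.exists_refl A
      obtain ⟨e', he', ee'⟩ := CoC.exists_refl B
      exact ⟨_, he.csum he', fun G =>
        (EEq.cpair_cong ((ee _).ssubst (.cfst_cong .svar))
          ((ee' _).ssubst (.csnd_cong .svar))).trans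
          (EEq.eta_cpair .svar)⟩
end

theorem CoC.vapp_vapp_llam {H A B C : CType} {c e k s : Tm} (h : CoC R H A c) (h' : CoC R A B e)
    (hk : CoC R H B k) (ek : EEq G (some (cpsC R B)) k (Tm.ssubst e c) (.comp (cpsC R H)))
    (hs : EEq G none s s (.lin (cpsC R H) C)) :
    EEq G none (.vapp (.vlam (.lin (cpsC R H) C) (.llam (cpsC R B) (.lapp (.var 0) k))) s)
      (.vapp (.vlam (.lin (cpsC R A) C) (.llam (cpsC R B) (.lapp (.var 0) e)))
        (.vapp (.vlam (.lin (cpsC R H) C) (.llam (cpsC R A) (.lapp (.var 0) c))) s))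
      (.lin (cpsC R B) C) := by
  have h1 := h.vapp_llam hs
  have h2 := EEq.beta_llam (EEq.lapp_cong hs (h.typed G)) (h'.typed G)
  rw [Tm.ssubst, hs.sfree.ssubst_eq] at h2
  refine (hk.vapp_llam hs).trans (.trans (.llam_cong ?_) (h'.vapp_llam h1.left).symm)
  exact (EEq.lapp_cong hs ek).trans (h2.symm.trans (.lapp_cong h1.symm (h'.typed G)))

mutual
  theorem CoV.exists_trans {H A B : VType} {f g : Tm} : CoV R H A f → CoV R A B g →
      ∃ k, CoV R H B k ∧ ∀ G s, EEq G none s s (cpsV R H) →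
        EEq G none (.vapp k s) (.vapp g (.vapp f s)) (cpsV R B)
    | .base a, .base _ => ⟨_, .base a, fun _ _ hs => hs.vapp_id.trans hs.vapp_id.vapp_id.symm⟩
    | .unit, .unit => ⟨_, .unit, fun _ _ hs => hs.vapp_id.trans hs.vapp_id.vapp_id.symm⟩
    | .prod hf hf', .prod hg hg' => by
      obtain ⟨k, hk, ek⟩ := hf.exists_trans hg
      obtain ⟨k', hk', ek'⟩ := hf'.exists_trans hg'
      refine ⟨_, hk.prod hk', fun G s hs => (hk.vapp_prod hk' hs).trans ?_⟩
      have h1 := hf.vapp_prod hf' hs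
      have t1 := EEq.vapp_cong (hf.typed G) hs.vfst_cong
      have t2 := EEq.vapp_cong (hf'.typed G) hs.vsnd_cong
      refine .trans (.vpair_cong ?_ ?_) (hg.vapp_prod hg' h1.left).symm
      · exact (ek _ _ hs.vfst_cong).trans
          (.vapp_cong (hg.typed G) (h1.vfst_cong.trans (EEq.beta_vfst t1 t2)).symm)
      · exact (ek' _ _ hs.vsnd_cong).trans
          (.vapp_cong (hg'.typed G) (h1.vsnd_cong.trans (EEq.beta_vsnd t1 t2)).symm)
    | .arr hf, .arr hg => by
      obtain ⟨k, hk, ek⟩ := hf.exists_trans hg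
      refine ⟨_, hk.arr, fun G s hs => (hk.vapp_arr hs).trans ?_⟩
      have h1 := hf.vapp_arr hs
      have hs' := EEq.vapp_cong (hs.shift _) (.var 0 rfl)
      refine .trans (.vlam_cong ?_)
        ((hg.vapp_arr h1.right).symm.trans (.vapp_cong (hg.arr.typed G) h1.symm))
      exact (ek _ _ hs').trans (.vapp_cong (hg.typed _)
        (EEq.beta_shift_vlam (.vapp_cong (hf.typed _) hs')).symm)
    | .comp hc, .comp he => by
      obtain ⟨k, hk, ek⟩ := hc.exists_trans he
      exact ⟨_, .comp hk, fun G s hs => hc.vapp_vapp_llam he hk (ek G) hs⟩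
    | .lin hc, .lin he => by
      obtain ⟨k, hk, ek⟩ := hc.exists_trans he
      exact ⟨_, .lin hk, fun G s hs => hc.vapp_vapp_llam he hk (ek G) hs⟩
  theorem CoC.exists_trans {H A B : CType} {c e : Tm} : CoC R H A c → CoC R A B e →
      ∃ k, CoC R H B k ∧ ∀ G, EEq G (some (cpsC R B)) k (Tm.ssubst e c) (.comp (cpsC R H))
    | .czero _, _ => ⟨_, .czero _, fun _ => .cunit⟩
    | .base a, .base _ => ⟨_, .base a, fun _ => .svar⟩
    | .cunit, .cunit => ⟨_, .cunit, fun _ => .svar⟩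
    | .iunit, .iunit => ⟨_, .iunit, fun _ => .svar⟩
    | .cand hc hc', .cand he he' => by
      obtain ⟨k, hk, ek⟩ := hc.exists_trans he
      obtain ⟨k', hk', ek'⟩ := hc'.exists_trans he'
      refine ⟨_, hk.cand hk', fun G => ?_⟩
      refine .trans (.ccase_cong .svar ?_ ?_)
        (EEq.comm_ccase (.cinl_cong (he.typed G)) (.cinr_cong (he'.typed G))
          ((hc.cand hc').typed G))
      · exact (EEq.cinl_cong (ek G)).trans (EEq.beta_cinl (he.typed G) (.cinl_cong (hc.typed G))
          (.cinr_cong (hc'.typed G))).symm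
      · exact (EEq.cinr_cong (ek' G)).trans (EEq.beta_cinr (he'.typed G) (.cinl_cong (hc.typed G))
          (.cinr_cong (hc'.typed G))).symm
    | .carr (A := V) hc, .carr he => by
      obtain ⟨k, hk, ek⟩ := hc.exists_trans he
      refine ⟨_, hk.carr, fun G => .trans (.copowlet_cong .svar ?_)
        (EEq.comm_copowlet (.copow_cong (.var 0 rfl) (he.typed _)) (hc.carr.typed G))⟩
      have h1 := EEq.beta_copow (Γ := cpsV R V :: G) (A := cpsV R V) (.var 0 rfl) (he.typed _)
        (.copow_cong (.var 0 rfl) (hc.typed _))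
      have h2 := hc.subst0_eq (.var 0)
      rw [(CoC.carr (A := V) hc).shift_eq]
      simp only [subst0, psubst, Tm.ssubst] at h1 h2 ⊢
      rw [h2] at h1
      exact (EEq.copow_cong (.var 0 rfl) (ek _)).trans h1.symm
    | .bang (H := H₀) (A := A₀) (f := f) hf, .bang hg => by
      obtain ⟨k, hk, ek⟩ := hf.exists_trans hg
      refine ⟨_, .bang hk, fun G => ?_⟩
      have h1 := EEq.beta_clam (Γ := cpsV R H₀ :: G) (A := cpsV R A₀) (B := R)
        (.capp_cong .svar (.vapp_cong (hg.typed _) (.var 0 rfl)))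
        (.vapp_cong (hf.typed _) (.var 0 rfl))
      have h2 := hg.subst0_eq (.vapp f (.var 0))
      simp only [subst0, psubst, Tm.ssubst, hf.sfree.ssubst_eq, (CoC.bang hg).shift_eq] at h1 h2 ⊢
      rw [h2] at h1
      exact .clam_cong ((EEq.capp_cong .svar (ek _ _ (.var 0 rfl))).trans h1.symm)
    | .copow (H := H₀) (A := A₀) (f := f) hf hc, .copow hg he => by
      obtain ⟨k, hk, ek⟩ := hf.exists_trans hg
      obtain ⟨k', hk', ek'⟩ := hc.exists_trans he
      refine ⟨_, .copow hk hk', fun G => ?_⟩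
      have h1 := EEq.beta_clam (Γ := cpsV R H₀ :: G) (A := cpsV R A₀) ((he.typed _).ssubst
        (.capp_cong .svar (.vapp_cong (hg.typed _) (.var 0 rfl))))
        (.vapp_cong (hf.typed _) (.var 0 rfl))
      rw [Tm.subst0_eq, psubst_ssubst
        (SFree.consS (u := .vapp f (.var 0)) ⟨hf.sfree, trivial⟩ SFree.var), ← Tm.subst0_eq,
        ← Tm.subst0_eq, he.subst0_eq] at h1
      have h2 := hg.subst0_eq (.vapp f (.var 0))
      simp only [subst0, psubst] at h1 h2
      rw [h2] at h1
      simp only [Tm.ssubst, hf.sfree.ssubst_eq, (CoC.copow hg he).shift_eq, ssubst_ssubst]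
      refine .clam_cong (((ek' _).ssubst (.capp_cong .svar (ek _ _ (.var 0 rfl)))).trans ?_)
      rw [ssubst_ssubst]
      exact (hc.typed _).ssubst h1.symm
    | .csum hc hc', .csum (A := A₁) (A' := A₂) he he' => by
      obtain ⟨k, hk, ek⟩ := hc.exists_trans he
      obtain ⟨k', hk', ek'⟩ := hc'.exists_trans he'
      refine ⟨_, hk.csum hk', fun G => ?_⟩
      have t1 := (he.typed G).ssubst (.cfst_cong (B := cpsC R A₂) .svar)
      have t2 := (he'.typed G).ssubst (.csnd_cong (A := cpsC R A₁) .svar)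
      simp only [Tm.ssubst, ssubst_ssubst]
      refine .cpair_cong (((ek G).ssubst (.cfst_cong .svar)).trans ?_)
        (((ek' G).ssubst (.csnd_cong .svar)).trans ?_)
      · rw [ssubst_ssubst]
        exact (hc.typed G).ssubst (EEq.beta_cfst t1 t2).symm
      · rw [ssubst_ssubst]
        exact (hc'.typed G).ssubst (EEq.beta_csnd t1 t2).symm
end

mutual
  theorem CoV.exists_join {H A : VType} {f : Tm} : CoV R H A f → ∀ {H' f'}, CoV R H' A f' →
      ∃ J, (∃ j, CoV R H J j) ∧ (∃ j, CoV R H' J j) ∧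
        ∀ B, (∃ g, CoV R H B g) → (∃ g, CoV R H' B g) → ∃ g, CoV R J B g
    | .base a, _, _, .base _ => ⟨_, ⟨_, .base a⟩, ⟨_, .base a⟩, fun _ h _ => h⟩
    | .unit, _, _, .unit => ⟨_, ⟨_, .unit⟩, ⟨_, .unit⟩, fun _ h _ => h⟩
    | .prod h1 h2, _, _, .prod h1' h2' => by
      obtain ⟨J, ⟨_, a⟩, ⟨_, b⟩, h⟩ := h1.exists_join h1'
      obtain ⟨J', ⟨_, a'⟩, ⟨_, b'⟩, h'⟩ := h2.exists_join h2'
      refine ⟨_, ⟨_, a.prod a'⟩, ⟨_, b.prod b'⟩, ?_⟩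
      rintro _ ⟨_, g⟩ ⟨_, k⟩
      cases g with | prod g g' => cases k with | prod k k' =>
      exact ⟨_, (h _ ⟨_, g⟩ ⟨_, k⟩).choose_spec.prod (h' _ ⟨_, g'⟩ ⟨_, k'⟩).choose_spec⟩
    | .arr h1, _, _, .arr h1' => by
      obtain ⟨J, ⟨_, a⟩, ⟨_, b⟩, h⟩ := h1.exists_join h1'
      refine ⟨_, ⟨_, a.arr⟩, ⟨_, b.arr⟩, ?_⟩
      rintro _ ⟨_, g⟩ ⟨_, k⟩
      cases g with | arr g => cases k with | arr k =>
      exact ⟨_, (h _ ⟨_, g⟩ ⟨_, k⟩).choose_spec.arr⟩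
    | .comp h1, _, _, .comp h1' => by
      obtain ⟨J, ⟨_, a⟩, ⟨_, b⟩, h⟩ := h1.exists_join h1'
      refine ⟨_, ⟨_, .comp a⟩, ⟨_, .comp b⟩, ?_⟩
      rintro _ ⟨_, g⟩ ⟨_, k⟩
      cases g with | comp g => cases k with | comp k =>
      exact ⟨_, .comp (h _ ⟨_, g⟩ ⟨_, k⟩).choose_spec⟩
    | .lin h1, _, _, .lin h1' => by
      obtain ⟨J, ⟨_, a⟩, ⟨_, b⟩, h⟩ := h1.exists_join h1'
      refine ⟨_, ⟨_, .lin a⟩, ⟨_, .lin b⟩, ?_⟩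
      rintro _ ⟨_, g⟩ ⟨_, k⟩
      cases g with | lin g => cases k with | lin k =>
      exact ⟨_, .lin (h _ ⟨_, g⟩ ⟨_, k⟩).choose_spec⟩
  theorem CoC.exists_join {H A : CType} {e : Tm} : CoC R H A e → ∀ {H' e'}, CoC R H' A e' →
      ∃ J, (∃ j, CoC R H J j) ∧ (∃ j, CoC R H' J j) ∧
        ∀ B, (∃ g, CoC R H B g) → (∃ g, CoC R H' B g) → ∃ g, CoC R J B g
    | .czero _, H', _, _ => ⟨H', ⟨_, .czero _⟩, (CoC.exists_refl H').imp fun _ h => h.1,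
        fun _ _ h => h⟩
    | h, _, _, .czero _ => ⟨H,
      (CoC.exists_refl H).imp fun _ h => h.1, ⟨_, .czero _⟩, fun _ h _ => h⟩
    | .base a, _, _, .base _ => ⟨_, ⟨_, .base a⟩, ⟨_, .base a⟩, fun _ h _ => h⟩
    | .cunit, _, _, .cunit => ⟨_, ⟨_, .cunit⟩, ⟨_, .cunit⟩, fun _ h _ => h⟩
    | .iunit, _, _, .iunit => ⟨_, ⟨_, .iunit⟩, ⟨_, .iunit⟩, fun _ h _ => h⟩
    | .cand h1 h2, _, _, .cand h1' h2' => by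
      obtain ⟨J, ⟨_, a⟩, ⟨_, b⟩, h⟩ := h1.exists_join h1'
      obtain ⟨J', ⟨_, a'⟩, ⟨_, b'⟩, h'⟩ := h2.exists_join h2'
      refine ⟨_, ⟨_, a.cand a'⟩, ⟨_, b.cand b'⟩, ?_⟩
      rintro _ ⟨_, g⟩ ⟨_, k⟩
      cases g with | cand g g' => cases k with | cand k k' =>
      exact ⟨_, (h _ ⟨_, g⟩ ⟨_, k⟩).choose_spec.cand (h' _ ⟨_, g'⟩ ⟨_, k'⟩).choose_spec⟩
    | .carr h1, _, _, .carr h1' => by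
      obtain ⟨J, ⟨_, a⟩, ⟨_, b⟩, h⟩ := h1.exists_join h1'
      refine ⟨_, ⟨_, a.carr⟩, ⟨_, b.carr⟩, ?_⟩
      rintro _ ⟨_, g⟩ ⟨_, k⟩
      cases g with | carr g => cases k with | carr k =>
      exact ⟨_, (h _ ⟨_, g⟩ ⟨_, k⟩).choose_spec.carr⟩
    | .bang h1, _, _, .bang h1' => by
      obtain ⟨J, ⟨_, a⟩, ⟨_, b⟩, h⟩ := h1.exists_join h1'
      refine ⟨_, ⟨_, .bang a⟩, ⟨_, .bang b⟩, ?_⟩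
      rintro _ ⟨_, g⟩ ⟨_, k⟩
      cases g with | bang g => cases k with | bang k =>
      exact ⟨_, .bang (h _ ⟨_, g⟩ ⟨_, k⟩).choose_spec⟩
    | .copow h1 h2, _, _, .copow h1' h2' => by
      obtain ⟨J, ⟨_, a⟩, ⟨_, b⟩, h⟩ := h1.exists_join h1'
      obtain ⟨J', ⟨_, a'⟩, ⟨_, b'⟩, h'⟩ := h2.exists_join h2'
      refine ⟨_, ⟨_, .copow a a'⟩, ⟨_, .copow b b'⟩, ?_⟩
      rintro _ ⟨_, g⟩ ⟨_, k⟩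
      cases g with | copow g g' => cases k with | copow k k' =>
      exact ⟨_, .copow (h _ ⟨_, g⟩ ⟨_, k⟩).choose_spec (h' _ ⟨_, g'⟩ ⟨_, k'⟩).choose_spec⟩
    | .csum h1 h2, _, _, .csum h1' h2' => by
      obtain ⟨J, ⟨_, a⟩, ⟨_, b⟩, h⟩ := h1.exists_join h1'
      obtain ⟨J', ⟨_, a'⟩, ⟨_, b'⟩, h'⟩ := h2.exists_join h2'
      refine ⟨_, ⟨_, a.csum a'⟩, ⟨_, b.csum b'⟩, ?_⟩
      rintro _ ⟨_, g⟩ ⟨_, k⟩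
      cases g with | csum g g' => cases k with | csum k k' =>
      exact ⟨_, (h _ ⟨_, g⟩ ⟨_, k⟩).choose_spec.csum (h' _ ⟨_, g'⟩ ⟨_, k'⟩).choose_spec⟩
end

end

/-! ## Principal translations

Every derivation of a raw term, in any context related to a fixed context by coercions,
has a translation which factors through one fixed term by a coercion. -/

section
variable {R : CType}

theorem EEq.psubst {Γ G : List VType} {Δ : Option CType} {σ : ℕ → Tm} {t : Tm} {A : VType}
    (h : EEq Γ Δ t t A) (hσ : ∀ n B, Γ[n]? = some B → EEq G none (σ n) (σ n) B) :
    EEq G Δ (Tm.psubst σ t) (Tm.psubst σ t) A := by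
  obtain ⟨d⟩ := h.regular.1
  have key : ∀ n, ∃ x, SFree x ∧ ∀ B, Γ[n]? = some B →
      ∃ e : Deriv G none (σ n) B, cps .iunit e = x := by
    intro n
    cases hn : Γ[n]? with
    | none => exact ⟨.unit, trivial, fun _ h => by cases h⟩
    | some B =>
      obtain ⟨e⟩ := (hσ n B hn).regular.1
      exact ⟨_, e.sfree_cps .iunit, by rintro _ ⟨⟩; exact ⟨e, rfl⟩⟩
  choose τ h1 h2 using key
  exact .refl (d.exists_psubst .iunit ⟨h2, h1⟩).choose

theorem CoV.refl_eq {A : VType} {f s : Tm} {G : List VType} (h : CoV R A A f)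
    (hs : EEq G none s s (cpsV R A)) : EEq G none (.vapp f s) s (cpsV R A) := by
  obtain ⟨f', hf', e⟩ := CoV.exists_refl (R := R) A
  rw [h.unique hf']
  exact e G s hs

theorem CoC.trans_eq {H A B : CType} {c e k : Tm} (hc : CoC R H A c) (he : CoC R A B e)
    (hk : CoC R H B k) (G : List VType) :
    EEq G (some (cpsC R B)) k (Tm.ssubst e c) (.comp (cpsC R H)) := by
  obtain ⟨k', hk', h⟩ := hc.exists_trans he
  rw [hk.unique hk']
  exact h G

/-- `σ` replaces the variables of `Γ` by variables of `Γ₀`, up to coercions. -/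
structure CtxCo (R : CType) (Γ₀ Γ : List VType) (σ : ℕ → Tm) : Prop where
  sfree : ∀ n, SFree (σ n)
  coe : ∀ n A, Γ[n]? = some A → ∃ H f, Γ₀[n]? = some H ∧ CoV R H A f ∧
    (σ n = .vapp f (.var n) ∨ H = A ∧ σ n = .var n)

/-- `c` is a coercion between the stoups `Δ₀` and `Δ`. -/
inductive StCo (R : CType) : Option CType → Option CType → Tm → Prop
  | none : StCo R none none .svar
  | some {D₀ D : CType} {c : Tm} : CoC R D₀ D c → StCo R (some D₀) (some D) c

variable {Γ₀ Γ : List VType} {Δ₀ Δ : Option CType} {σ : ℕ → Tm} {c : Tm}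

theorem CtxCo.var (Γ : List VType) : CtxCo R Γ Γ Tm.var where
  sfree := SFree.var
  coe _ A h := ⟨A, _, h, (CoV.exists_refl A).choose_spec.1, .inr ⟨rfl, rfl⟩⟩

theorem CtxCo.cons (h : CtxCo R Γ₀ Γ σ) {H A : VType} {f u : Tm} (hf : CoV R H A f)
    (hu : u = .vapp f (.var 0) ∨ H = A ∧ u = .var 0) :
    CtxCo R (H :: Γ₀) (A :: Γ) (consS u (Tm.shift ∘ σ)) where
  sfree := SFree.consS (by
    rcases hu with rfl | ⟨_, rfl⟩
    · exact ⟨hf.sfree, trivial⟩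
    · trivial) fun n => (h.sfree n).shift
  coe
    | 0, B, hB => by
      obtain rfl : A = B := by simpa using hB
      exact ⟨H, f, rfl, hf, hu⟩
    | n + 1, B, hB => by
      obtain ⟨H', f', h1, h2, h3⟩ := h.coe n B (by simpa using hB)
      refine ⟨H', f', h1, h2, ?_⟩
      rcases h3 with h3 | ⟨rfl, h3⟩
      · left
        simp only [consS, Function.comp, h3, shift, rename, h2.rename_eq]
      · exact .inr ⟨rfl, by simp only [consS, Function.comp, h3, shift, rename]⟩

theorem CtxCo.lift (h : CtxCo R Γ₀ Γ σ) (A : VType) : CtxCo R (A :: Γ₀) (A :: Γ) (liftS σ) := by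
  have e : liftS σ = consS (.var 0) (Tm.shift ∘ σ) := by funext n; cases n <;> rfl
  rw [e]
  exact h.cons (CoV.exists_refl A).choose_spec.1 (.inr ⟨rfl, rfl⟩)

theorem CtxCo.lookup (h : CtxCo R Γ₀ Γ σ) {n : ℕ} {A : VType} (hn : Γ[n]? = some A) :
    ∃ H f, Γ₀[n]? = some H ∧ CoV R H A f ∧
      EEq (cpsCtx R Γ₀) none (σ n) (.vapp f (.var n)) (cpsV R A) := by
  obtain ⟨H, f, h1, h2, h3⟩ := h.coe n A hn
  have hv := EEq.var n (getElem?_cpsCtx (R := R) h1)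
  refine ⟨H, f, h1, h2, ?_⟩
  rcases h3 with h3 | ⟨rfl, h3⟩
  · rw [h3]
    exact .vapp_cong (h2.typed _) hv
  · rw [h3]
    exact (h2.refl_eq hv).symm

theorem CtxCo.typed (h : CtxCo R Γ₀ Γ σ) (n : ℕ) (B : VType) (hn : (cpsCtx R Γ)[n]? = some B) :
    EEq (cpsCtx R Γ₀) none (σ n) (σ n) B := by
  simp only [cpsCtx, List.getElem?_map, Option.map_eq_some_iff] at hn
  obtain ⟨A, hA, rfl⟩ := hn
  obtain ⟨_, _, _, _, e⟩ := h.lookup hA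
  exact e.left

theorem CtxCo.cEq (h : CtxCo R Γ₀ Γ σ) {t : Tm} {A : CType} (d : Deriv Γ Δ t (.comp A)) :
    CEq R (cpsCtx R Γ₀) σ d (psubst σ (uncurry Δ (cps R d))) :=
  EEq.psubst (cEq_var.1 (CEq.self d)) h.typed

theorem StCo.typed (h : StCo R Δ₀ Δ c) (G : List VType) :
    EEq G (Option.some (cpsOut R Δ)) c c (.comp (cpsOut R Δ₀)) := by
  cases h with
  | none => exact .svar
  | some h => exact h.typed G

theorem StCo.shift_eq (h : StCo R Δ₀ Δ c) : shift c = c := by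
  cases h with
  | none => rfl
  | some h => exact h.shift_eq

/-- The translation of `d` is obtained from `s` by a coercion. -/
def VFactors (R : CType) (Γ₀ : List VType) (H : VType) (s : Tm) (σ : ℕ → Tm) {Γ : List VType}
    {t : Tm} {A : VType} (d : Deriv Γ none t A) : Prop :=
  EEq (cpsCtx R Γ₀) none s s (cpsV R H) ∧
    ∃ f, CoV R H A f ∧ VEq R (cpsCtx R Γ₀) σ d (.vapp f s)

/-- The body of the translation of `d` is obtained from `s` by a coercion. -/
def CFactors (R : CType) (Γ₀ : List VType) (Δ₀ : Option CType) (H : CType) (s : Tm) (σ : ℕ → Tm)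
    (c : Tm) {Γ : List VType} {Δ : Option CType} {t : Tm} {A : CType} (d : Deriv Γ Δ t (.comp A)) :
    Prop :=
  EEq (cpsCtx R Γ₀) (some (cpsC R H)) s s (.comp (cpsOut R Δ₀)) ∧
    ∃ e, CoC R H A e ∧ EEq (cpsCtx R Γ₀) (some (cpsC R A))
      (Tm.ssubst (psubst σ (uncurry Δ (cps R d))) c) (Tm.ssubst e s) (.comp (cpsOut R Δ₀))

/-- All translations of the value term `t` factor through a single term. -/
def PrincipalV (R : CType) (t : Tm) (Γ₀ : List VType) : Prop :=
  ∃ H s, ∀ {Γ : List VType} {σ : ℕ → Tm} {A : VType} (d : Deriv Γ none t A),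
    CtxCo R Γ₀ Γ σ → VFactors R Γ₀ H s σ d

/-- All translations of the computation term `t` factor through a single term. -/
def PrincipalC (R : CType) (t : Tm) (Γ₀ : List VType) (Δ₀ : Option CType) : Prop :=
  ∃ H s, ∀ {Γ : List VType} {Δ : Option CType} {σ : ℕ → Tm} {A : CType} {c : Tm}
    (d : Deriv Γ Δ t (.comp A)), CtxCo R Γ₀ Γ σ → StCo R Δ₀ Δ c → CFactors R Γ₀ Δ₀ H s σ c d

/-- All translations of the raw term `t` factor through a single term. -/
def Principal (R : CType) (t : Tm) : Prop :=
  ∀ Γ₀, PrincipalV R t Γ₀ ∧ ∀ Δ₀, PrincipalC R t Γ₀ Δ₀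

/-! ### Factorisations and the empty stoup -/

theorem CoC.vapp_llam_llam {H B C : CType} {e s : Tm} {G : List VType} (h : CoC R H B e)
    (hs : EEq G (some (cpsC R H)) s s (.comp C)) :
    EEq G none (.vapp (.vlam (.lin (cpsC R H) C) (.llam (cpsC R B) (.lapp (.var 0) e)))
      (.llam (cpsC R H) s)) (.llam (cpsC R B) (Tm.ssubst e s)) (.lin (cpsC R B) C) :=
  (h.vapp_llam (.llam_cong hs)).trans (.llam_cong (EEq.beta_llam hs (h.typed G)))

theorem Principal.ofV {t : Tm} (h : ∀ Γ₀, PrincipalV R t Γ₀)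
    (ht : ∀ {Γ Δ A}, Deriv Γ Δ t A → Δ = none) : Principal R t := by
  refine fun Γ₀ => ⟨h Γ₀, fun Δ₀ => ?_⟩
  obtain ⟨H, s, h⟩ := h Γ₀
  by_cases hH : ∃ H', H = .comp H'
  · obtain ⟨H, rfl⟩ := hH
    refine ⟨H, .lapp s .svar, fun {Γ Δ σ A c} d hσ hc => ?_⟩
    obtain rfl := ht d
    cases hc
    obtain ⟨hs, _, hf, e⟩ := h d hσ
    cases hf with
    | @comp _ _ k hk =>
      refine ⟨.lapp_cong hs .svar, k, hk, ?_⟩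
      have e1 : EEq (cpsCtx R Γ₀) (some (cpsC R A)) _ _ (.comp R) :=
        EEq.lapp_cong (e.trans (hk.vapp_llam hs)) EEq.svar
      refine (e1.trans (EEq.beta_llam (.lapp_cong hs (hk.typed _)) .svar)).trans ?_
      simp only [ssubst_svar, Tm.ssubst, hs.sfree.ssubst_eq]
      exact .lapp_cong hs (hk.typed _)
  · refine ⟨.czero, s, fun d hσ hc => ?_⟩
    obtain rfl := ht d
    obtain ⟨hs, _, hf, e⟩ := h d hσ
    cases hf with
    | comp hk => exact (hH ⟨_, rfl⟩).elim

theorem Principal.ofC {t : Tm} (h : ∀ Γ₀ Δ₀, PrincipalC R t Γ₀ Δ₀)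
    (ht : ∀ {Γ A}, Deriv Γ none t A → ∃ B, A = .comp B) : Principal R t := by
  refine fun Γ₀ => ⟨?_, h Γ₀⟩
  obtain ⟨H, s, h⟩ := h Γ₀ none
  refine ⟨.comp H, .llam (cpsC R H) s, fun d hσ => ?_⟩
  obtain ⟨A, rfl⟩ := ht d
  obtain ⟨hs, e, he, h⟩ := h d hσ .none
  refine ⟨.llam_cong hs, _, .comp he, ?_⟩
  exact (CEq.toVEq (X := Tm.ssubst e s) h).trans (he.vapp_llam_llam hs).symm

/-! ### Factorisations of value terms -/

theorem PrincipalV.var (n : ℕ) : PrincipalV R (.var n) Γ₀ := by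
  cases hn : Γ₀[n]? with
  | none =>
    refine ⟨.unit, .unit, fun d hσ => ?_⟩
    cases d with
    | var _ _ _ h =>
      obtain ⟨_, _, h', _⟩ := hσ.lookup h
      rw [hn] at h'
      cases h'
  | some H =>
    refine ⟨H, .var n, fun d hσ => ?_⟩
    cases d with
    | var _ _ _ h =>
      obtain ⟨_, f, h', hf, e⟩ := hσ.lookup h
      rw [hn] at h'
      cases h'
      exact ⟨.var n (getElem?_cpsCtx hn), f, hf, e⟩

theorem PrincipalV.unit : PrincipalV R .unit Γ₀ := by
  refine ⟨.unit, .unit, fun d hσ => ?_⟩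
  cases d
  exact ⟨.refl (.unit _), _, .unit, .symm (EEq.vapp_id (.refl (.unit _)))⟩

theorem PrincipalV.vpair {t u : Tm} (h1 : PrincipalV R t Γ₀) (h2 : PrincipalV R u Γ₀) :
    PrincipalV R (.vpair t u) Γ₀ := by
  obtain ⟨H1, s1, h1⟩ := h1
  obtain ⟨H2, s2, h2⟩ := h2
  refine ⟨.prod H1 H2, .vpair s1 s2, fun d hσ => ?_⟩
  cases d with
  | vpair _ _ _ _ _ d1 d2 =>
    obtain ⟨hs1, f1, hf1, e1⟩ := h1 d1 hσ
    obtain ⟨hs2, f2, hf2, e2⟩ := h2 d2 hσ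
    refine ⟨.vpair_cong hs1 hs2, _, hf1.prod hf2, (e1.vpair e2).trans ?_⟩
    refine .symm ((hf1.vapp_prod hf2 (.vpair_cong hs1 hs2)).trans ?_)
    exact .vpair_cong (.vapp_cong (hf1.typed _) (EEq.beta_vfst hs1 hs2))
      (.vapp_cong (hf2.typed _) (EEq.beta_vsnd hs1 hs2))

theorem PrincipalV.vfst {t : Tm} (h : PrincipalV R t Γ₀) : PrincipalV R (.vfst t) Γ₀ := by
  obtain ⟨H, s, h⟩ := h
  by_cases hH : ∃ H1 H2, H = .prod H1 H2
  · obtain ⟨H1, H2, rfl⟩ := hH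
    refine ⟨H1, .vfst s, fun d hσ => ?_⟩
    cases d with
    | vfst _ _ _ _ d =>
      obtain ⟨hs, _, hf, e⟩ := h d hσ
      cases hf with
      | prod hf1 hf2 =>
        refine ⟨.vfst_cong hs, _, hf1, (VEq.vfst (e.trans (hf1.vapp_prod hf2 hs))).trans ?_⟩
        exact EEq.beta_vfst (.vapp_cong (hf1.typed _) (.vfst_cong hs))
          (.vapp_cong (hf2.typed _) (.vsnd_cong hs))
  · refine ⟨.unit, .unit, fun d hσ => ?_⟩
    cases d with
    | vfst _ _ _ _ d =>
      obtain ⟨hs, _, hf, e⟩ := h d hσ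
      cases hf
      exact (hH ⟨_, _, rfl⟩).elim

theorem PrincipalV.vsnd {t : Tm} (h : PrincipalV R t Γ₀) : PrincipalV R (.vsnd t) Γ₀ := by
  obtain ⟨H, s, h⟩ := h
  by_cases hH : ∃ H1 H2, H = .prod H1 H2
  · obtain ⟨H1, H2, rfl⟩ := hH
    refine ⟨H2, .vsnd s, fun d hσ => ?_⟩
    cases d with
    | vsnd _ _ _ _ d =>
      obtain ⟨hs, _, hf, e⟩ := h d hσ
      cases hf with
      | prod hf1 hf2 =>
        refine ⟨.vsnd_cong hs, _, hf2, (VEq.vsnd (e.trans (hf1.vapp_prod hf2 hs))).trans ?_⟩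
        exact EEq.beta_vsnd (.vapp_cong (hf1.typed _) (.vfst_cong hs))
          (.vapp_cong (hf2.typed _) (.vsnd_cong hs))
  · refine ⟨.unit, .unit, fun d hσ => ?_⟩
    cases d with
    | vsnd _ _ _ _ d =>
      obtain ⟨hs, _, hf, e⟩ := h d hσ
      cases hf
      exact (hH ⟨_, _, rfl⟩).elim

theorem PrincipalV.vlam {A : VType} {t : Tm} (h : PrincipalV R t (A :: Γ₀)) :
    PrincipalV R (.vlam A t) Γ₀ := by
  obtain ⟨H, s, h⟩ := h
  refine ⟨.arr A H, .vlam (cpsV R A) s, fun d hσ => ?_⟩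
  cases d with
  | vlam _ _ _ _ d =>
    obtain ⟨hs, f, hf, e⟩ := h d (hσ.lift A)
    refine ⟨.vlam_cong hs, _, .arr hf, (VEq.vlam e).trans ?_⟩
    refine .symm ((hf.vapp_arr (.vlam_cong hs)).trans ?_)
    exact .vlam_cong (.vapp_cong (hf.typed _) (EEq.beta_shift_vlam hs))

theorem PrincipalV.vapp {t u : Tm} (h1 : PrincipalV R t Γ₀) (h2 : PrincipalV R u Γ₀) :
    PrincipalV R (.vapp t u) Γ₀ := by
  obtain ⟨H1, s1, h1⟩ := h1
  obtain ⟨H2, s2, h2⟩ := h2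
  by_cases hH : ∃ A H f, H1 = .arr A H ∧ CoV R H2 A f
  · obtain ⟨A, H, f, rfl, hf⟩ := hH
    refine ⟨H, .vapp s1 (.vapp f s2), fun d hσ => ?_⟩
    cases d with
    | vapp _ _ _ _ _ d1 d2 =>
      obtain ⟨hs1, _, hf1, e1⟩ := h1 d1 hσ
      obtain ⟨hs2, f2, hf2, e2⟩ := h2 d2 hσ
      cases hf1 with
      | @arr _ _ _ g hg =>
        obtain rfl := hf.unique hf2
        have ht := EEq.vapp_cong (hf.typed _) hs2
        refine ⟨.vapp_cong hs1 ht, _, hg, ?_⟩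
        refine (VEq.vapp (e1.trans (hg.vapp_arr hs1)) e2).trans ?_
        have e := EEq.beta_vlam (EEq.vapp_cong (hg.typed _)
          (EEq.vapp_cong (hs1.shift _) (.var 0 rfl))) ht
        have e3 := subst0_shift (.vapp f s2) s1
        have e4 := hg.subst0_eq (.vapp f s2)
        simp only [subst0, Tm.psubst] at e e3 e4
        rwa [e3, e4] at e
  · refine ⟨.unit, .unit, fun d hσ => ?_⟩
    cases d with
    | vapp _ _ _ _ _ d1 d2 =>
      obtain ⟨hs1, _, hf1, e1⟩ := h1 d1 hσ
      obtain ⟨hs2, f2, hf2, e2⟩ := h2 d2 hσ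
      cases hf1
      exact (hH ⟨_, _, _, rfl, hf2⟩).elim

theorem PrincipalV.llam {A : CType} {t : Tm} (h : PrincipalC R t Γ₀ (some A)) :
    PrincipalV R (.llam A t) Γ₀ := by
  obtain ⟨H, s, h⟩ := h
  obtain ⟨a, ha, ea⟩ := CoC.exists_refl (R := R) A
  refine ⟨.lin A H, .llam (cpsC R H) s, fun d hσ => ?_⟩
  cases d with
  | llam _ _ _ _ d =>
    obtain ⟨hs, e, he, h⟩ := h d hσ (.some ha)
    refine ⟨.llam_cong hs, _, .lin he, ?_⟩
    have h1 := (ea (cpsCtx R Γ₀)).symm.ssubst (hσ.cEq d)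
    exact (VEq.llam (X := Tm.ssubst e s) (EEq.trans h1 h)).trans (he.vapp_llam_llam hs).symm

end

/-! ### Factorisations of computation terms -/

theorem Tm.subst0_liftS (u : Tm) (σ : ℕ → Tm) (t : Tm) :
    subst0 u (rename (liftN Nat.succ) (psubst (liftS σ) t)) =
      psubst (consS u (Tm.shift ∘ σ)) t := by
  rw [Tm.subst0_eq, psubst_rename, psubst_psubst]
  congr 1
  funext n
  cases n with
  | zero => rfl
  | succ n =>
    change psubst _ (rename Nat.succ (σ n)) = rename Nat.succ (σ n)
    rw [psubst_rename, ← psubst_var (rename Nat.succ (σ n)), psubst_rename]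
    rfl

section
variable {R : CType} {Γ₀ Γ : List VType} {Δ₀ Δ : Option CType} {σ : ℕ → Tm} {c : Tm}

/-- Factorisations are preserved by precomposition. -/
theorem CFactors.elim {A B H H' : CType} {t t' s e e' Z W : Tm} {d₁ : Deriv Γ Δ t (.comp A)}
    {d : Deriv Γ Δ t' (.comp B)} (hσ : CtxCo R Γ₀ Γ σ) (hc : StCo R Δ₀ Δ c)
    (hs : EEq (cpsCtx R Γ₀) (some (cpsC R H)) s s (.comp (cpsOut R Δ₀)))
    (h : EEq (cpsCtx R Γ₀) (some (cpsC R A)) (Tm.ssubst (psubst σ (uncurry Δ (cps R d₁))) c)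
      (Tm.ssubst e s) (.comp (cpsOut R Δ₀)))
    (hd : ∀ {X}, CEq R (cpsCtx R Γ₀) σ d₁ X → CEq R (cpsCtx R Γ₀) σ d (Tm.ssubst Z X))
    (hZ : EEq (cpsCtx R Γ₀) (some (cpsC R B)) Z Z (.comp (cpsC R A)))
    (hW : EEq (cpsCtx R Γ₀) (some (cpsC R H')) W W (.comp (cpsC R H)))
    (he : CoC R H' B e')
    (heq : EEq (cpsCtx R Γ₀) (some (cpsC R B)) (Tm.ssubst Z e) (Tm.ssubst e' W)
      (.comp (cpsC R H))) :
    CFactors R Γ₀ Δ₀ H' (Tm.ssubst W s) σ c d := by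
  refine ⟨hs.ssubst hW, e', he, ?_⟩
  have h1 := (hc.typed (cpsCtx R Γ₀)).ssubst (hd (hσ.cEq d₁))
  rw [← ssubst_ssubst] at h1
  have h2 := hs.ssubst heq
  rw [← ssubst_ssubst Z, ← ssubst_ssubst e'] at h2
  exact h1.trans ((h.ssubst hZ).trans h2)

theorem CFactors.of_czero {A B : CType} {t t' s e Z : Tm} {d₁ : Deriv Γ Δ t (.comp A)}
    {d : Deriv Γ Δ t' (.comp B)} (hσ : CtxCo R Γ₀ Γ σ) (hc : StCo R Δ₀ Δ c)
    (hs : EEq (cpsCtx R Γ₀) (some (cpsC R .czero)) s s (.comp (cpsOut R Δ₀)))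
    (he : CoC R .czero A e)
    (h : EEq (cpsCtx R Γ₀) (some (cpsC R A)) (Tm.ssubst (psubst σ (uncurry Δ (cps R d₁))) c)
      (Tm.ssubst e s) (.comp (cpsOut R Δ₀)))
    (hd : ∀ {X}, CEq R (cpsCtx R Γ₀) σ d₁ X → CEq R (cpsCtx R Γ₀) σ d (Tm.ssubst Z X))
    (hZ : EEq (cpsCtx R Γ₀) (some (cpsC R B)) Z Z (.comp (cpsC R A))) :
    CFactors R Γ₀ Δ₀ .czero s σ c d := by
  cases he
  simpa only [ssubst_svar] using
    CFactors.elim (W := .svar) hσ hc hs h hd hZ .svar (.czero B) .cunit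

theorem PrincipalC.cfst {t : Tm} (h : PrincipalC R t Γ₀ Δ₀) : PrincipalC R (.cfst t) Γ₀ Δ₀ := by
  obtain ⟨H, s, h⟩ := h
  by_cases hH : ∃ H1 H2, H = .cand H1 H2
  · obtain ⟨H1, H2, rfl⟩ := hH
    refine ⟨H1, Tm.ssubst (.cinl .svar) s, fun d hσ hc => ?_⟩
    cases d with
    | cfst _ _ _ _ _ d =>
      obtain ⟨hs, _, he, h⟩ := h d hσ hc
      cases he with
      | cand he1 he2 =>
        refine .elim hσ hc hs h (CEq.cfst hσ.sfree) (.cinl_cong .svar) (.cinl_cong .svar) he1 ?_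
        have e := EEq.beta_cinl (EEq.svar (Γ := cpsCtx R Γ₀)) (.cinl_cong (he1.typed _))
          (.cinr_cong (he2.typed _))
        simpa only [Tm.ssubst, ssubst_svar] using! e
  · refine ⟨H, s, fun d hσ hc => ?_⟩
    cases d with
    | cfst _ _ _ _ _ d =>
      obtain ⟨hs, _, he, h⟩ := h d hσ hc
      cases he with
      | czero => exact .of_czero hσ hc hs (.czero _) h (CEq.cfst hσ.sfree) (.cinl_cong .svar)
      | cand => exact (hH ⟨_, _, rfl⟩).elim

theorem PrincipalC.csnd {t : Tm} (h : PrincipalC R t Γ₀ Δ₀) : PrincipalC R (.csnd t) Γ₀ Δ₀ := by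
  obtain ⟨H, s, h⟩ := h
  by_cases hH : ∃ H1 H2, H = .cand H1 H2
  · obtain ⟨H1, H2, rfl⟩ := hH
    refine ⟨H2, Tm.ssubst (.cinr .svar) s, fun d hσ hc => ?_⟩
    cases d with
    | csnd _ _ _ _ _ d =>
      obtain ⟨hs, _, he, h⟩ := h d hσ hc
      cases he with
      | cand he1 he2 =>
        refine .elim hσ hc hs h (CEq.csnd hσ.sfree) (.cinr_cong .svar) (.cinr_cong .svar) he2 ?_
        have e := EEq.beta_cinr (EEq.svar (Γ := cpsCtx R Γ₀)) (.cinl_cong (he1.typed _))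
          (.cinr_cong (he2.typed _))
        simpa only [Tm.ssubst, ssubst_svar] using! e
  · refine ⟨H, s, fun d hσ hc => ?_⟩
    cases d with
    | csnd _ _ _ _ _ d =>
      obtain ⟨hs, _, he, h⟩ := h d hσ hc
      cases he with
      | czero => exact .of_czero hσ hc hs (.czero _) h (CEq.csnd hσ.sfree) (.cinr_cong .svar)
      | cand => exact (hH ⟨_, _, rfl⟩).elim

theorem PrincipalC.capp {t u : Tm} (h1 : PrincipalC R t Γ₀ Δ₀) (h2 : PrincipalV R u Γ₀) :
    PrincipalC R (.capp t u) Γ₀ Δ₀ := by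
  obtain ⟨H, s, h1⟩ := h1
  obtain ⟨K, x, h2⟩ := h2
  by_cases hH : ∃ A H' f, H = .carr A H' ∧ CoV R K A f
  · obtain ⟨A, H', f, rfl, hf⟩ := hH
    refine ⟨H', Tm.ssubst (.copow (.vapp f x) .svar) s, fun d hσ hc => ?_⟩
    cases d with
    | capp _ _ _ _ _ _ d1 d2 =>
      obtain ⟨hs, _, he, h⟩ := h1 d1 hσ hc
      obtain ⟨hx, f', hf', e⟩ := h2 d2 hσ
      cases he with
      | carr he =>
        obtain rfl := hf.unique hf'
        have hfx := EEq.vapp_cong (hf.typed _) hx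
        refine .elim hσ hc hs h (fun hX => CEq.capp hσ.sfree hX e)
          (.copow_cong hfx .svar) (.copow_cong hfx .svar) he ?_
        have e1 := EEq.beta_copow (s := .svar) hfx .svar
          (.copow_cong (.var 0 rfl) (he.typed (_ :: cpsCtx R Γ₀)))
        have e2 := he.subst0_eq (.vapp f x)
        simp only [subst0, Tm.psubst] at e1 e2
        simp only [e2, ssubst_svar] at e1
        simpa only [Tm.ssubst, hf.sfree.ssubst_eq, hx.sfree.ssubst_eq] using! e1
  · refine ⟨H, s, fun d hσ hc => ?_⟩
    cases d with
    | capp _ _ _ _ _ _ d1 d2 =>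
      obtain ⟨hs, _, he, h⟩ := h1 d1 hσ hc
      obtain ⟨hx, f', hf', e⟩ := h2 d2 hσ
      cases he with
      | czero =>
        exact .of_czero hσ hc hs (.czero _) h (fun hX => CEq.capp hσ.sfree hX e)
          (.copow_cong (.vapp_cong (hf'.typed _) hx) .svar)
      | carr => exact (hH ⟨_, _, _, rfl, hf'⟩).elim

theorem PrincipalC.ilet {t u : Tm} (h1 : PrincipalC R t Γ₀ Δ₀) (h2 : PrincipalC R u Γ₀ none) :
    PrincipalC R (.ilet t u) Γ₀ Δ₀ := by
  obtain ⟨H, s, h1⟩ := h1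
  obtain ⟨K, x, h2⟩ := h2
  by_cases hH : H = .iunit
  · subst hH
    refine ⟨K, Tm.ssubst x s, fun d hσ hc => ?_⟩
    cases d with
    | ilet _ _ _ _ _ d1 d2 =>
      obtain ⟨hs, _, he, h⟩ := h1 d1 hσ hc
      obtain ⟨hx, _, he2, e⟩ := h2 d2 hσ .none
      cases he with
      | iunit =>
        simp only [Tm.ssubst] at e
        refine .elim hσ hc hs h (fun hX => CEq.ilet hσ.sfree hX e) e.right hx he2 ?_
        simpa only [Tm.ssubst] using! e.right
  · refine ⟨H, s, fun d hσ hc => ?_⟩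
    cases d with
    | ilet _ _ _ _ _ d1 d2 =>
      obtain ⟨hs, _, he, h⟩ := h1 d1 hσ hc
      obtain ⟨hx, _, he2, e⟩ := h2 d2 hσ .none
      cases he with
      | czero =>
        simp only [Tm.ssubst] at e
        exact .of_czero hσ hc hs (.czero _) h (fun hX => CEq.ilet hσ.sfree hX e) e.right
      | iunit => exact (hH rfl).elim

theorem PrincipalC.copow {t u : Tm} (h1 : PrincipalV R t Γ₀) (h2 : PrincipalC R u Γ₀ Δ₀) :
    PrincipalC R (.copow t u) Γ₀ Δ₀ := by
  obtain ⟨K, x, h1⟩ := h1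
  obtain ⟨H, s, h2⟩ := h2
  refine ⟨.copow K H, Tm.ssubst (.capp .svar x) s, fun d hσ hc => ?_⟩
  cases d with
  | copow _ _ _ _ _ _ d1 d2 =>
    obtain ⟨hx, f, hf, e⟩ := h1 d1 hσ
    obtain ⟨hs, _, he, h⟩ := h2 d2 hσ hc
    refine .elim hσ hc hs h (CEq.copow hσ.sfree e) (.capp_cong .svar e.right)
      (.capp_cong .svar hx) (CoC.copow hf he) ?_
    have e1 := EEq.beta_clam ((he.typed _).ssubst (EEq.capp_cong EEq.svar
      (EEq.vapp_cong (hf.typed _) (EEq.var 0 rfl)))) hx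
    have e2 := he.subst0_eq x
    have e3 := hf.subst0_eq x
    rw [Tm.subst0_eq] at e1 e2 e3
    rw [psubst_ssubst (SFree.consS hx.sfree SFree.var), e2] at e1
    simp only [Tm.psubst, e3, consS] at e1
    simpa only [Tm.ssubst, hx.sfree.ssubst_eq] using! e1.symm

theorem PrincipalC.cimage {A : CType} {t : Tm} (h : PrincipalC R t Γ₀ Δ₀) :
    PrincipalC R (.cimage A t) Γ₀ Δ₀ := by
  obtain ⟨H, s, h⟩ := h
  obtain ⟨a, ha, _⟩ := CoC.exists_refl (R := R) A
  refine ⟨A, Tm.ssubst .cunit s, fun d hσ hc => ?_⟩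
  cases d with
  | cimage _ _ _ _ d =>
    obtain ⟨hs, _, he, h⟩ := h d hσ hc
    cases he with
    | czero => exact .elim hσ hc hs h (CEq.cimage hσ.sfree) .cunit .cunit ha .cunit

theorem PrincipalC.cinl {t : Tm} (h : PrincipalC R t Γ₀ Δ₀) : PrincipalC R (.cinl t) Γ₀ Δ₀ := by
  obtain ⟨H, s, h⟩ := h
  refine ⟨.csum H .czero, Tm.ssubst (.cfst .svar) s, fun d hσ hc => ?_⟩
  cases d with
  | cinl _ _ _ _ _ d =>
    obtain ⟨hs, _, he, h⟩ := h d hσ hc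
    refine .elim hσ hc hs h (CEq.cinl hσ.sfree) (.cfst_cong .svar) (.cfst_cong .svar)
      (he.csum (.czero _)) ?_
    exact .symm (EEq.beta_cfst ((he.typed _).ssubst (.cfst_cong .svar)) .cunit)

theorem PrincipalC.cinr {t : Tm} (h : PrincipalC R t Γ₀ Δ₀) : PrincipalC R (.cinr t) Γ₀ Δ₀ := by
  obtain ⟨H, s, h⟩ := h
  refine ⟨.csum .czero H, Tm.ssubst (.csnd .svar) s, fun d hσ hc => ?_⟩
  cases d with
  | cinr _ _ _ _ _ d =>
    obtain ⟨hs, _, he, h⟩ := h d hσ hc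
    refine .elim hσ hc hs h (CEq.cinr hσ.sfree) (.csnd_cong .svar) (.csnd_cong .svar)
      (CoC.csum (.czero _) he) ?_
    exact .symm (EEq.beta_csnd .cunit ((he.typed _).ssubst (.csnd_cong .svar)))

theorem PrincipalC.svar : PrincipalC R .svar Γ₀ Δ₀ := by
  cases Δ₀ with
  | none =>
    refine ⟨.czero, .svar, fun d hσ hc => ?_⟩
    cases hc
    cases d
  | some D =>
    refine ⟨D, .svar, fun d hσ hc => ?_⟩
    cases d with
    | svar =>
      cases hc with
      | some hc =>
        refine ⟨.svar, _, hc, ?_⟩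
        simpa only [ssubst_svar, Tm.ssubst, cps, uncurry, psubst] using! hc.typed _

theorem PrincipalC.cunit : PrincipalC R .cunit Γ₀ Δ₀ := by
  refine ⟨.cunit, .cimage (cpsOut R Δ₀) .svar, fun d hσ hc => ?_⟩
  cases d with
  | cunit =>
    refine ⟨.cimage_cong .svar, _, .cunit, ?_⟩
    have h := (hc.typed (cpsCtx R Γ₀)).ssubst (hσ.cEq (.cunit _ _))
    exact EEq.of_czero h.left (.cimage_cong .svar)

theorem PrincipalC.top : PrincipalC R .top Γ₀ Δ₀ := by
  refine ⟨.iunit, .svar, fun d hσ hc => ?_⟩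
  cases d with
  | top =>
    cases hc
    refine ⟨.svar, _, .iunit, ?_⟩
    simpa only [ssubst_svar, Tm.ssubst] using! CEq.top

theorem PrincipalC.bang {t : Tm} (h : PrincipalV R t Γ₀) : PrincipalC R (.bang t) Γ₀ Δ₀ := by
  obtain ⟨K, x, h⟩ := h
  refine ⟨.bang K, .capp .svar x, fun d hσ hc => ?_⟩
  cases d with
  | bang _ _ _ d =>
    cases hc
    obtain ⟨hx, f, hf, e⟩ := h d hσ
    refine ⟨.capp_cong .svar hx, _, .bang hf, (CEq.bang e).trans ?_⟩
    have e1 := EEq.beta_clam (B := R) (EEq.capp_cong .svar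
      (.vapp_cong (hf.typed _) (.var 0 rfl))) hx
    have e2 := hf.subst0_eq x
    simp only [subst0, Tm.psubst] at e1 e2
    rw [e2] at e1
    simpa only [Tm.ssubst, hx.sfree.ssubst_eq] using! e1.symm

theorem PrincipalC.cpair {t u : Tm} (h1 : PrincipalC R t Γ₀ Δ₀) (h2 : PrincipalC R u Γ₀ Δ₀) :
    PrincipalC R (.cpair t u) Γ₀ Δ₀ := by
  obtain ⟨H1, s1, h1⟩ := h1
  obtain ⟨H2, s2, h2⟩ := h2
  refine ⟨.cand H1 H2, .ccase .svar s1 s2, fun d hσ hc => ?_⟩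
  cases d with
  | cpair _ _ _ _ _ _ d1 d2 =>
    obtain ⟨hs1, e1, he1, k1⟩ := h1 d1 hσ hc
    obtain ⟨hs2, e2, he2, k2⟩ := h2 d2 hσ hc
    refine ⟨.ccase_cong .svar hs1 hs2, _, he1.cand he2, ?_⟩
    have hd1 := hσ.cEq d1
    have hd2 := hσ.cEq d2
    refine ((hc.typed _).ssubst (CEq.cpair hd1 hd2)).trans ?_
    refine (EEq.comm_ccase hd1 hd2 (hc.typed _)).symm.trans ?_
    refine (EEq.ccase_cong .svar k1 k2).trans ?_
    have hs := EEq.ccase_cong .svar hs1 hs2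
    refine .trans (.ccase_cong .svar ?_ ?_) (EEq.comm_ccase
      (.cinl_cong (he1.typed _)) (.cinr_cong (he2.typed _)) hs)
    · exact .symm (EEq.beta_cinl (he1.typed _) hs1 hs2)
    · exact .symm (EEq.beta_cinr (he2.typed _) hs1 hs2)

theorem PrincipalC.clam {A : VType} {t : Tm} (h : PrincipalC R t (A :: Γ₀) Δ₀) :
    PrincipalC R (.clam A t) Γ₀ Δ₀ := by
  obtain ⟨H, s, h⟩ := h
  refine ⟨.carr A H, .copowlet .svar s, fun d hσ hc => ?_⟩
  cases d with
  | clam _ _ _ _ _ d =>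
    obtain ⟨hs, e, he, k⟩ := h d (hσ.lift A) hc
    refine ⟨.copowlet_cong .svar hs, _, .carr he, ?_⟩
    have hd := (hσ.lift A).cEq d
    refine ((hc.typed _).ssubst (CEq.clam hd)).trans ?_
    refine (EEq.comm_copowlet hd (hc.typed _)).symm.trans ?_
    rw [hc.shift_eq]
    refine (EEq.copowlet_cong .svar k).trans ?_
    have hs' := EEq.copowlet_cong .svar hs
    refine .trans (.copowlet_cong .svar ?_) (EEq.comm_copowlet
      (.copow_cong (.var 0 rfl) (he.typed _)) hs')
    obtain ⟨d'⟩ := (hs'.shift (cpsV R A)).regular.1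
    cases d' with
    | copowlet _ _ _ _ _ _ _ d1 d2 =>
      cases d1
      have e1 := EEq.beta_copow (Γ := cpsV R A :: cpsCtx R Γ₀) (.var 0 rfl) (he.typed _) (.refl d2)
      rw [subst0_var_rename] at e1
      exact e1.symm

end

section
variable {R : CType} {Γ₀ Γ : List VType} {Δ₀ Δ : Option CType} {σ : ℕ → Tm} {c : Tm}

theorem CoV.capp_shift_clam {A H : VType} {K C : CType} {f t : Tm} (hf : CoV R H A f)
    (h : EEq (cpsCtx R (A :: Γ₀)) (some K) (psubst (liftS σ) t) (psubst (liftS σ) t) (.comp C)) :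
    EEq (cpsCtx R (H :: Γ₀)) (some K)
      (.capp (Tm.shift (.clam (cpsV R A) (psubst (liftS σ) t))) (.vapp f (.var 0)))
      (psubst (consS (.vapp f (.var 0)) (Tm.shift ∘ σ)) t) (.comp C) := by
  obtain ⟨d⟩ := ((EEq.clam_cong h).shift (cpsV R H)).regular.1
  cases d with
  | clam _ _ _ _ _ d =>
    have e := EEq.beta_clam (.refl d)
      (EEq.vapp_cong (hf.typed (cpsV R H :: cpsCtx R Γ₀)) (.var 0 rfl))
    rwa [Tm.subst0_liftS] at e

theorem PrincipalC.banglet {t u : Tm} (h1 : PrincipalC R t Γ₀ Δ₀)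
    (h2 : ∀ Γ₀, PrincipalC R u Γ₀ none) : PrincipalC R (.banglet t u) Γ₀ Δ₀ := by
  obtain ⟨H, s, h1⟩ := h1
  by_cases hH : ∃ H', H = .bang H'
  · obtain ⟨H, rfl⟩ := hH
    obtain ⟨K, x, h2⟩ := h2 (H :: Γ₀)
    refine ⟨K, Tm.ssubst (.clam (cpsV R H) x) s, fun d hσ hc => ?_⟩
    cases d with
    | banglet _ _ _ _ _ _ d1 d2 =>
      obtain ⟨hs, _, he, h⟩ := h1 d1 hσ hc
      cases he with
      | bang hf =>
        obtain ⟨hx, _, hk, k⟩ := h2 d2 (hσ.cons hf (.inl rfl)) .none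
        have hY := (hσ.lift _).cEq d2
        refine .elim hσ hc hs h (fun hX => CEq.banglet hσ.sfree hX hY) (.clam_cong hY)
          (.clam_cong hx) hk ?_
        simp only [Tm.ssubst, hf.sfree.ssubst_eq, hk.shift_eq] at k ⊢
        exact .clam_cong ((hf.capp_shift_clam hY).trans k)
  · refine ⟨H, s, fun d hσ hc => ?_⟩
    cases d with
    | banglet _ _ _ _ _ _ d1 d2 =>
      obtain ⟨hs, _, he, h⟩ := h1 d1 hσ hc
      have hY := (hσ.lift _).cEq d2
      cases he with
      | czero =>
        exact .of_czero hσ hc hs (.czero _) h (fun hX => CEq.banglet hσ.sfree hX hY)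
          (.clam_cong hY)
      | bang => exact (hH ⟨_, rfl⟩).elim

theorem PrincipalC.copowlet {t u : Tm} (h1 : PrincipalC R t Γ₀ Δ₀)
    (h2 : ∀ Γ₀ Δ₀, PrincipalC R u Γ₀ Δ₀) : PrincipalC R (.copowlet t u) Γ₀ Δ₀ := by
  obtain ⟨H, s, h1⟩ := h1
  by_cases hH : ∃ H' D, H = .copow H' D
  · obtain ⟨H, D, rfl⟩ := hH
    obtain ⟨K, x, h2⟩ := h2 (H :: Γ₀) (some D)
    refine ⟨K, Tm.ssubst (.clam (cpsV R H) x) s, fun d hσ hc => ?_⟩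
    cases d with
    | copowlet _ _ _ _ _ _ _ d1 d2 =>
      obtain ⟨hs, _, he, h⟩ := h1 d1 hσ hc
      cases he with
      | copow hf he =>
        obtain ⟨hx, _, hk, k⟩ := h2 d2 (hσ.cons hf (.inl rfl)) (.some he)
        have hY := (hσ.lift _).cEq d2
        refine .elim hσ hc hs h (fun hX => CEq.copowlet hσ.sfree hX hY) (.clam_cong hY)
          (.clam_cong hx) hk ?_
        simp only [Tm.ssubst, ssubst_ssubst, hf.sfree.ssubst_eq, hk.shift_eq] at k ⊢
        exact .clam_cong (((he.typed _).ssubst (hf.capp_shift_clam hY)).trans k)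
  · refine ⟨H, s, fun d hσ hc => ?_⟩
    cases d with
    | copowlet _ _ _ _ _ _ _ d1 d2 =>
      obtain ⟨hs, _, he, h⟩ := h1 d1 hσ hc
      have hY := (hσ.lift _).cEq d2
      cases he with
      | czero =>
        exact .of_czero hσ hc hs (.czero _) h (fun hX => CEq.copowlet hσ.sfree hX hY)
          (.clam_cong hY)
      | copow => exact (hH ⟨_, _, rfl⟩).elim

theorem PrincipalC.ccase {t u v : Tm} (h1 : PrincipalC R t Γ₀ Δ₀)
    (h2 : ∀ Δ₀, PrincipalC R u Γ₀ Δ₀) (h3 : ∀ Δ₀, PrincipalC R v Γ₀ Δ₀) :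
    PrincipalC R (.ccase t u v) Γ₀ Δ₀ := by
  obtain ⟨H, s, h1⟩ := h1
  by_cases hH : ∃ H1 H2, H = .csum H1 H2
  · obtain ⟨H1, H2, rfl⟩ := hH
    obtain ⟨K1, s1, h2⟩ := h2 (some H1)
    obtain ⟨K2, s2, h3⟩ := h3 (some H2)
    by_cases hJ : ∃ J, (∃ j, CoC R K1 J j) ∧ (∃ j, CoC R K2 J j) ∧
        ∀ B, (∃ g, CoC R K1 B g) → (∃ g, CoC R K2 B g) → ∃ g, CoC R J B g
    · obtain ⟨J, ⟨j1, hj1⟩, ⟨j2, hj2⟩, hJ⟩ := hJ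
      refine ⟨J, Tm.ssubst (.cpair (Tm.ssubst j1 s1) (Tm.ssubst j2 s2)) s, fun d hσ hc => ?_⟩
      cases d with
      | ccase _ _ _ _ _ _ _ _ d1 d2 d3 =>
        obtain ⟨hs, _, he, h⟩ := h1 d1 hσ hc
        cases he with
        | csum he1 he2 =>
          obtain ⟨hs1, g1, hg1, k1⟩ := h2 d2 hσ (.some he1)
          obtain ⟨hs2, g2, hg2, k2⟩ := h3 d3 hσ (.some he2)
          obtain ⟨g, hg⟩ := hJ _ ⟨_, hg1⟩ ⟨_, hg2⟩
          have hY := hσ.cEq d2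
          have hZ := hσ.cEq d3
          refine .elim hσ hc hs h (fun hX => CEq.ccase hσ.sfree hX hY hZ) (.cpair_cong hY hZ)
            (.cpair_cong (hs1.ssubst (hj1.typed _)) (hs2.ssubst (hj2.typed _))) hg ?_
          simp only [Tm.ssubst, ssubst_ssubst]
          refine .cpair_cong ?_ ?_
          · exact (((he1.typed _).ssubst (EEq.beta_cfst hY hZ)).trans k1).trans
              (hs1.ssubst (hj1.trans_eq hg hg1 _))
          · exact (((he2.typed _).ssubst (EEq.beta_csnd hY hZ)).trans k2).trans
              (hs2.ssubst (hj2.trans_eq hg hg2 _))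
    · refine ⟨.czero, s, fun d hσ hc => ?_⟩
      cases d with
      | ccase _ _ _ _ _ _ _ _ d1 d2 d3 =>
        obtain ⟨hs, _, he, h⟩ := h1 d1 hσ hc
        cases he with
        | csum he1 he2 =>
          obtain ⟨_, _, hg1, _⟩ := h2 d2 hσ (.some he1)
          obtain ⟨_, _, hg2, _⟩ := h3 d3 hσ (.some he2)
          exact (hJ (hg1.exists_join hg2)).elim
  · refine ⟨H, s, fun d hσ hc => ?_⟩
    cases d with
    | ccase _ _ _ _ _ _ _ _ d1 d2 d3 =>
      obtain ⟨hs, _, he, h⟩ := h1 d1 hσ hc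
      have hY := hσ.cEq d2
      have hZ := hσ.cEq d3
      cases he with
      | czero =>
        exact .of_czero hσ hc hs (.czero _) h (fun hX => CEq.ccase hσ.sfree hX hY hZ)
          (.cpair_cong hY hZ)
      | csum => exact (hH ⟨_, _, rfl⟩).elim

theorem PrincipalC.lapp {t u : Tm} (h1 : PrincipalV R t Γ₀) (h2 : PrincipalC R u Γ₀ Δ₀) :
    PrincipalC R (.lapp t u) Γ₀ Δ₀ := by
  obtain ⟨K, x, h1⟩ := h1
  obtain ⟨H, s, h2⟩ := h2
  by_cases hH : ∃ A K' c, K = .lin A K' ∧ CoC R H A c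
  · obtain ⟨A, K, a, rfl, ha⟩ := hH
    refine ⟨K, Tm.ssubst (Tm.ssubst (.lapp x .svar) a) s, fun d hσ hc => ?_⟩
    cases d with
    | lapp _ _ _ _ _ _ d1 d2 =>
      obtain ⟨hx, _, hf, k⟩ := h1 d1 hσ
      obtain ⟨hs, _, ha', h⟩ := h2 d2 hσ hc
      cases hf with
      | lin he =>
        obtain rfl := ha.unique ha'
        have hl := EEq.lapp_cong hx (he.typed _)
        have e := EEq.beta_llam hl .svar
        refine .elim hσ hc hs h (CEq.lapp hσ.sfree (EEq.trans k (he.vapp_llam hx)))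
          e.left ((ha.typed _).ssubst (.lapp_cong hx .svar)) he ?_
        rw [ssubst_svar] at e
        simpa only [Tm.ssubst, ssubst_ssubst, hx.sfree.ssubst_eq] using (ha.typed _).ssubst e
  · refine ⟨H, s, fun d hσ hc => ?_⟩
    cases d with
    | lapp _ _ _ _ _ _ d1 d2 =>
      obtain ⟨_, _, hf, _⟩ := h1 d1 hσ
      obtain ⟨_, _, ha, _⟩ := h2 d2 hσ hc
      cases hf with
      | lin => exact (hH ⟨_, _, _, rfl, ha⟩).elim

/-- Every raw term has a principal translation. -/
theorem principal (R : CType) : ∀ t, Principal R t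
  | .var n => .ofV (fun _ => .var n) fun d => by cases d; rfl
  | .unit => .ofV (fun _ => .unit) fun d => by cases d; rfl
  | .vpair t u => .ofV (fun Γ₀ => .vpair (principal R t Γ₀).1 (principal R u Γ₀).1)
      fun d => by cases d; rfl
  | .vfst t => .ofV (fun Γ₀ => .vfst (principal R t Γ₀).1) fun d => by cases d; rfl
  | .vsnd t => .ofV (fun Γ₀ => .vsnd (principal R t Γ₀).1) fun d => by cases d; rfl
  | .vlam A t => .ofV (fun Γ₀ => .vlam (principal R t (A :: Γ₀)).1) fun d => by cases d; rfl
  | .vapp t u => .ofV (fun Γ₀ => .vapp (principal R t Γ₀).1 (principal R u Γ₀).1)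
      fun d => by cases d; rfl
  | .llam A t => .ofV (fun Γ₀ => .llam ((principal R t Γ₀).2 (some A))) fun d => by cases d; rfl
  | .svar => .ofC (fun _ _ => .svar) fun d => by cases d
  | .cunit => .ofC (fun _ _ => .cunit) fun d => by cases d; exact ⟨_, rfl⟩
  | .cpair t u => .ofC
      (fun Γ₀ Δ₀ => .cpair ((principal R t Γ₀).2 Δ₀) ((principal R u Γ₀).2 Δ₀))
      fun d => by cases d; exact ⟨_, rfl⟩
  | .cfst t => .ofC (fun Γ₀ Δ₀ => .cfst ((principal R t Γ₀).2 Δ₀))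
      fun d => by cases d; exact ⟨_, rfl⟩
  | .csnd t => .ofC (fun Γ₀ Δ₀ => .csnd ((principal R t Γ₀).2 Δ₀))
      fun d => by cases d; exact ⟨_, rfl⟩
  | .clam A t => .ofC (fun Γ₀ Δ₀ => .clam ((principal R t (A :: Γ₀)).2 Δ₀))
      fun d => by cases d; exact ⟨_, rfl⟩
  | .capp t u => .ofC (fun Γ₀ Δ₀ => .capp ((principal R t Γ₀).2 Δ₀) (principal R u Γ₀).1)
      fun d => by cases d; exact ⟨_, rfl⟩
  | .top => .ofC (fun _ _ => .top) fun d => by cases d; exact ⟨_, rfl⟩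
  | .ilet t u => .ofC
      (fun Γ₀ Δ₀ => .ilet ((principal R t Γ₀).2 Δ₀) ((principal R u Γ₀).2 none))
      fun d => by cases d; exact ⟨_, rfl⟩
  | .bang t => .ofC (fun Γ₀ _ => .bang (principal R t Γ₀).1)
      fun d => by cases d; exact ⟨_, rfl⟩
  | .banglet t u => .ofC
      (fun Γ₀ Δ₀ => .banglet ((principal R t Γ₀).2 Δ₀) fun Γ₀ => (principal R u Γ₀).2 none)
      fun d => by cases d; exact ⟨_, rfl⟩
  | .copow t u => .ofC (fun Γ₀ Δ₀ => .copow (principal R t Γ₀).1 ((principal R u Γ₀).2 Δ₀))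
      fun d => by cases d; exact ⟨_, rfl⟩
  | .copowlet t u => .ofC
      (fun Γ₀ Δ₀ => .copowlet ((principal R t Γ₀).2 Δ₀) fun Γ₀ => (principal R u Γ₀).2)
      fun d => by cases d; exact ⟨_, rfl⟩
  | .cimage A t => .ofC (fun Γ₀ Δ₀ => .cimage ((principal R t Γ₀).2 Δ₀))
      fun d => by cases d; exact ⟨_, rfl⟩
  | .cinl t => .ofC (fun Γ₀ Δ₀ => .cinl ((principal R t Γ₀).2 Δ₀))
      fun d => by cases d; exact ⟨_, rfl⟩
  | .cinr t => .ofC (fun Γ₀ Δ₀ => .cinr ((principal R t Γ₀).2 Δ₀))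
      fun d => by cases d; exact ⟨_, rfl⟩
  | .ccase t u v => .ofC (fun Γ₀ Δ₀ => .ccase ((principal R t Γ₀).2 Δ₀)
      (principal R u Γ₀).2 (principal R v Γ₀).2) fun d => by cases d; exact ⟨_, rfl⟩
  | .lapp t u => .ofC (fun Γ₀ Δ₀ => .lapp (principal R t Γ₀).1 ((principal R u Γ₀).2 Δ₀))
      fun d => by cases d; exact ⟨_, rfl⟩

end

/-! ## Coherence: the translation does not depend on the derivation -/

section
variable {R : CType} {Γ : List VType} {Δ : Option CType} {t u v x y z : Tm} {A : VType} {B : CType}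

theorem Deriv.exists_comp {D : CType} (d : Deriv Γ (some D) t A) : ∃ B, A = .comp B := by
  cases d <;> exact ⟨_, rfl⟩

theorem CpsEq.symm (h : CpsEq R Γ Δ x y A) : CpsEq R Γ Δ y x A :=
  ⟨fun hΔ => (h.1 hΔ).symm, fun B hB => (h.2 B hB).symm⟩

theorem CpsEq.trans (h : CpsEq R Γ Δ x y A) (h' : CpsEq R Γ Δ y z A) : CpsEq R Γ Δ x z A :=
  ⟨fun hΔ => (h.1 hΔ).trans (h'.1 hΔ), fun B hB => (h.2 B hB).trans (h'.2 B hB)⟩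

theorem Deriv.cps_coherent (d d' : Deriv Γ Δ t A) : CpsEq R Γ Δ (cps R d) (cps R d') A := by
  cases Δ with
  | none =>
    obtain ⟨H, s, h⟩ := (principal R t Γ).1
    obtain ⟨_, f, hf, e⟩ := h d (CtxCo.var Γ)
    obtain ⟨_, f', hf', e'⟩ := h d' (CtxCo.var Γ)
    obtain rfl := hf.unique hf'
    exact CpsEq.ofV e e'
  | some D =>
    obtain ⟨B, rfl⟩ := d.exists_comp
    obtain ⟨H, s, h⟩ := (principal R t Γ).2 (some D)
    obtain ⟨c, hc, ec⟩ := CoC.exists_refl (R := R) D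
    have key : ∀ d : Deriv Γ (some D) t (.comp B), ∃ e, CoC R H B e ∧
        CEq R (cpsCtx R Γ) Tm.var d (Tm.ssubst e s) := fun d => by
      obtain ⟨_, e, he, h2⟩ := h d (CtxCo.var Γ) (.some hc)
      rw [psubst_var] at h2
      exact ⟨e, he, cEq_var.2 ((EEq.ssubst (ec _) (cEq_var.1 (CEq.self d))).symm.trans h2)⟩
    obtain ⟨e, he, h1⟩ := key d
    obtain ⟨e', he', h1'⟩ := key d'
    obtain rfl := he.unique he'
    exact CpsEq.ofC h1 h1'

/-! ## Soundness -/

/-- The judgements `t` and `u` are derivable, with equal translations. -/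
def CpsSound (R : CType) (Γ : List VType) (Δ : Option CType) (t u : Tm) (A : VType) : Prop :=
  ∃ (d : Deriv Γ Δ t A) (d' : Deriv Γ Δ u A), CpsEq R Γ Δ (cps R d) (cps R d') A

theorem CpsSound.ofV {d : Deriv Γ none t A} {d' : Deriv Γ none u A}
    (h : VEq R (cpsCtx R Γ) Tm.var d x) (h' : VEq R (cpsCtx R Γ) Tm.var d' x) :
    CpsSound R Γ none t u A :=
  ⟨d, d', CpsEq.ofV h h'⟩

theorem CpsSound.ofC {d : Deriv Γ Δ t (.comp B)} {d' : Deriv Γ Δ u (.comp B)}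
    (h : CEq R (cpsCtx R Γ) Tm.var d x) (h' : CEq R (cpsCtx R Γ) Tm.var d' x) :
    CpsSound R Γ Δ t u (.comp B) :=
  ⟨d, d', CpsEq.ofC h h'⟩

theorem CpsSound.symm (h : CpsSound R Γ Δ t u A) : CpsSound R Γ Δ u t A := by
  obtain ⟨d, d', h⟩ := h
  exact ⟨d', d, h.symm⟩

theorem CpsSound.trans (h : CpsSound R Γ Δ t u A) (h' : CpsSound R Γ Δ u v A) :
    CpsSound R Γ Δ t v A := by
  obtain ⟨d1, d2, h⟩ := h
  obtain ⟨d3, d4, h'⟩ := h'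
  exact ⟨d1, d4, h.trans ((d2.cps_coherent d3).trans h')⟩

theorem CpsSound.toV (h : CpsSound R Γ none t u A) :
    ∃ (d : Deriv Γ none t A) (d' : Deriv Γ none u A) (x : Tm),
      VEq R (cpsCtx R Γ) Tm.var d x ∧ VEq R (cpsCtx R Γ) Tm.var d' x := by
  obtain ⟨d, d', h⟩ := h
  exact ⟨d, d', h.toV⟩

theorem CpsSound.toC (h : CpsSound R Γ Δ t u (.comp B)) :
    ∃ (d : Deriv Γ Δ t (.comp B)) (d' : Deriv Γ Δ u (.comp B)) (x : Tm),
      CEq R (cpsCtx R Γ) Tm.var d x ∧ CEq R (cpsCtx R Γ) Tm.var d' x := by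
  obtain ⟨d, d', h⟩ := h
  exact ⟨d, d', h.toC⟩

theorem VEq.lift_var {A' : VType} {d : Deriv (A :: Γ) none t A'}
    (h : VEq R (cpsCtx R (A :: Γ)) Tm.var d x) :
    VEq R (cpsV R A :: cpsCtx R Γ) (liftS Tm.var) d x := by
  rw [liftS_var]; exact h

theorem uncurry_subst0 : uncurry Δ (subst0 x y) = subst0 x (uncurry Δ y) := by
  cases Δ <;> rfl

theorem Deriv.eEq_self (d : Deriv Γ none t A) :
    EEq (cpsCtx R Γ) none (cps R d) (cps R d) (cpsV R A) :=
  vEq_var.1 (VEq.self (R := R) d)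

theorem Deriv.eEq_uncurry_self (d : Deriv Γ Δ t (.comp B)) :
    EEq (cpsCtx R Γ) (some (cpsC R B)) (uncurry Δ (cps R d)) (uncurry Δ (cps R d))
      (.comp (cpsOut R Δ)) :=
  cEq_var.1 (CEq.self d)

theorem EEq.cpsSound (R : CType) (h : EEq Γ Δ t u A) : CpsSound R Γ Δ t u A := by
  induction h with
  | refl d => exact ⟨d, d, d.cpsEq_self⟩
  | symm _ ih => exact ih.symm
  | trans _ _ ih1 ih2 => exact ih1.trans ih2
  | vpair_cong _ _ ih1 ih2 =>
    obtain ⟨_, _, _, h1, h1'⟩ := ih1.toV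
    obtain ⟨_, _, _, h2, h2'⟩ := ih2.toV
    exact .ofV (h1.vpair h2) (h1'.vpair h2')
  | vfst_cong _ ih =>
    obtain ⟨_, _, _, h, h'⟩ := ih.toV
    exact .ofV h.vfst h'.vfst
  | vsnd_cong _ ih =>
    obtain ⟨_, _, _, h, h'⟩ := ih.toV
    exact .ofV h.vsnd h'.vsnd
  | vlam_cong _ ih =>
    obtain ⟨_, _, _, h, h'⟩ := ih.toV
    exact .ofV h.lift_var.vlam h'.lift_var.vlam
  | vapp_cong _ _ ih1 ih2 =>
    obtain ⟨_, _, _, h1, h1'⟩ := ih1.toV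
    obtain ⟨_, _, _, h2, h2'⟩ := ih2.toV
    exact .ofV (h1.vapp h2) (h1'.vapp h2')
  | cpair_cong _ _ ih1 ih2 =>
    obtain ⟨_, _, _, h1, h1'⟩ := ih1.toC
    obtain ⟨_, _, _, h2, h2'⟩ := ih2.toC
    exact .ofC (h1.cpair h2) (h1'.cpair h2')
  | cfst_cong _ ih =>
    obtain ⟨_, _, _, h, h'⟩ := ih.toC
    exact .ofC (h.cfst SFree.var) (h'.cfst SFree.var)
  | csnd_cong _ ih =>
    obtain ⟨_, _, _, h, h'⟩ := ih.toC
    exact .ofC (h.csnd SFree.var) (h'.csnd SFree.var)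
  | clam_cong _ ih =>
    obtain ⟨_, _, _, h, h'⟩ := ih.toC
    exact .ofC h.lift_var.clam h'.lift_var.clam
  | capp_cong _ _ ih1 ih2 =>
    obtain ⟨_, _, _, h1, h1'⟩ := ih1.toC
    obtain ⟨_, _, _, h2, h2'⟩ := ih2.toV
    exact .ofC (h1.capp SFree.var h2) (h1'.capp SFree.var h2')
  | ilet_cong _ _ ih1 ih2 =>
    obtain ⟨_, _, _, h1, h1'⟩ := ih1.toC
    obtain ⟨_, _, _, h2, h2'⟩ := ih2.toC
    exact .ofC (h1.ilet SFree.var h2) (h1'.ilet SFree.var h2')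
  | bang_cong _ ih =>
    obtain ⟨_, _, _, h, h'⟩ := ih.toV
    exact .ofC (CEq.bang h) (CEq.bang h')
  | banglet_cong _ _ ih1 ih2 =>
    obtain ⟨_, _, _, h1, h1'⟩ := ih1.toC
    obtain ⟨_, _, _, h2, h2'⟩ := ih2.toC
    exact .ofC (h1.banglet SFree.var h2.lift_var) (h1'.banglet SFree.var h2'.lift_var)
  | copow_cong _ _ ih1 ih2 =>
    obtain ⟨_, _, _, h1, h1'⟩ := ih1.toV
    obtain ⟨_, _, _, h2, h2'⟩ := ih2.toC
    exact .ofC (CEq.copow SFree.var h1 h2) (CEq.copow SFree.var h1' h2')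
  | copowlet_cong _ _ ih1 ih2 =>
    obtain ⟨_, _, _, h1, h1'⟩ := ih1.toC
    obtain ⟨_, _, _, h2, h2'⟩ := ih2.toC
    exact .ofC (h1.copowlet SFree.var h2.lift_var) (h1'.copowlet SFree.var h2'.lift_var)
  | cimage_cong _ ih =>
    obtain ⟨_, _, _, h, h'⟩ := ih.toC
    exact .ofC (h.cimage SFree.var) (h'.cimage SFree.var)
  | cinl_cong _ ih =>
    obtain ⟨_, _, _, h, h'⟩ := ih.toC
    exact .ofC (h.cinl SFree.var) (h'.cinl SFree.var)
  | cinr_cong _ ih =>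
    obtain ⟨_, _, _, h, h'⟩ := ih.toC
    exact .ofC (h.cinr SFree.var) (h'.cinr SFree.var)
  | ccase_cong _ _ _ ih1 ih2 ih3 =>
    obtain ⟨_, _, _, h1, h1'⟩ := ih1.toC
    obtain ⟨_, _, _, h2, h2'⟩ := ih2.toC
    obtain ⟨_, _, _, h3, h3'⟩ := ih3.toC
    exact .ofC (h1.ccase SFree.var h2 h3) (h1'.ccase SFree.var h2' h3')
  | llam_cong _ ih =>
    obtain ⟨_, _, _, h, h'⟩ := ih.toC
    exact .ofV (VEq.llam h) (VEq.llam h')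
  | lapp_cong _ _ ih1 ih2 =>
    obtain ⟨_, _, _, h1, h1'⟩ := ih1.toV
    obtain ⟨_, _, _, h2, h2'⟩ := ih2.toC
    exact .ofC (CEq.lapp SFree.var h1 h2) (CEq.lapp SFree.var h1' h2')
  | unit_eta d =>
    obtain ⟨e⟩ := (d.eEq_self (R := R)).regular.1
    exact .ofV (d := d) (vEq_var.2 (EEq.unit_eta e)) VEq.unit
  | vfst_beta d e =>
    exact .ofV (((VEq.self (R := R) d).vpair (VEq.self e)).vfst.trans
      (EEq.beta_vfst d.eEq_self e.eEq_self))
      (VEq.self (R := R) d)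
  | vsnd_beta d e =>
    exact .ofV (((VEq.self (R := R) d).vpair (VEq.self e)).vsnd.trans
      (EEq.beta_vsnd d.eEq_self e.eEq_self))
      (VEq.self e)
  | vpair_eta d =>
    exact .ofV (((VEq.self (R := R) d).vfst.vpair (VEq.self d).vsnd).trans
      (EEq.eta_vpair d.eEq_self))
      (VEq.self (R := R) d)
  | vlam_beta d e =>
    obtain ⟨d', hd'⟩ := d.exists_subst0 R e
    refine .ofV (d' := d') (((VEq.self (R := R) d).lift_var.vlam.vapp (VEq.self e)).trans
      (EEq.beta_vlam d.eEq_self e.eEq_self)) ?_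
    rw [← hd']
    exact VEq.self d'
  | @vlam_eta _ _ A _ d =>
    obtain ⟨d', hd'⟩ := d.exists_shift R A
    have h := ((VEq.self (R := R) d').vapp (VEq.var (h := rfl) (.var 0 rfl))).lift_var.vlam
    rw [hd'] at h
    exact .ofV (h.trans (EEq.eta_vlam d.eEq_self)) (VEq.self (R := R) d)
  | cunit_eta d =>
    exact .ofC (d := d) (cEq_var.2 (EEq.of_czero d.eEq_uncurry_self (.cimage_cong .svar))) CEq.cunit
  | cfst_beta d e =>
    refine .ofC ((((CEq.self d).cpair (CEq.self e)).cfst SFree.var).trans ?_) (CEq.self d)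
    have h := EEq.beta_cinl EEq.svar d.eEq_uncurry_self (e.eEq_uncurry_self (R := R))
    rwa [ssubst_svar] at h
  | csnd_beta d e =>
    refine .ofC ((((CEq.self d).cpair (CEq.self e)).csnd SFree.var).trans ?_) (CEq.self e)
    have h := EEq.beta_cinr EEq.svar d.eEq_uncurry_self (e.eEq_uncurry_self (R := R))
    rwa [ssubst_svar] at h
  | cpair_eta d =>
    exact .ofC ((((CEq.self d).cfst SFree.var).cpair ((CEq.self d).csnd SFree.var)).trans
      (EEq.eta_ccase d.eEq_uncurry_self)) (CEq.self d)
  | clam_beta d e =>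
    obtain ⟨d', hd'⟩ := d.exists_subst0 R e
    have h := EEq.beta_copow (e.eEq_self (R := R)) EEq.svar (d.eEq_uncurry_self (R := R))
    rw [ssubst_svar, ← uncurry_subst0, ← hd'] at h
    exact .ofC (((CEq.self d).lift_var.clam.capp SFree.var (VEq.self e)).trans h) (CEq.self d')
  | @clam_eta _ _ _ A _ d =>
    obtain ⟨d', hd'⟩ := d.exists_shift R A
    have h := ((CEq.self (R := R) d').capp SFree.var
      (VEq.var (h := rfl) (.var 0 rfl))).lift_var.clam
    rw [hd', uncurry_shift] at h
    exact .ofC (h.trans (EEq.eta_copowlet d.eEq_uncurry_self)) (CEq.self d)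
  | ilet_beta d => exact .ofC (CEq.top.ilet SFree.var (CEq.self d)) (CEq.self d)
  | ilet_eta d e =>
    obtain ⟨e1, h1⟩ := e.exists_ssubst R (.top _)
    obtain ⟨e2, h2⟩ := e.exists_ssubst R d
    have h3 := h1.trans (EEq.ssubst (cEq_var.1 CEq.top) e.eEq_uncurry_self)
    exact .ofC ((CEq.self d).ilet SFree.var h3) h2
  | bang_beta d e =>
    obtain ⟨e', he'⟩ := e.exists_subst0 R d
    have h := (CEq.bang (VEq.self (R := R) d)).banglet SFree.var (CEq.self e).lift_var
    simp only [Tm.ssubst, (d.sfree_cps R).ssubst_eq] at h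
    refine .ofC (h.trans (EEq.beta_clam e.eEq_uncurry_self d.eEq_self)) (d' := e') ?_
    rw [← uncurry_subst0, ← he']
    exact CEq.self e'
  | @bang_eta _ _ _ _ A _ d e =>
    obtain ⟨e', he'⟩ := e.exists_shift R A
    obtain ⟨e1, h1⟩ := e'.exists_ssubst R (.bang _ _ _ (.var _ 0 A rfl))
    obtain ⟨e2, h2⟩ := e.exists_ssubst R d
    have h3 := h1.trans (EEq.ssubst (cEq_var.1 (CEq.bang (VEq.var (.var 0 rfl))))
      e'.eEq_uncurry_self)
    refine .ofC ((CEq.self d).banglet SFree.var (CEq.lift_var h3)) (h2.trans ?_)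
    refine EEq.ssubst d.eEq_uncurry_self (EEq.symm ?_)
    rw [he']
    exact EEq.eta_clam e.eEq_uncurry_self
  | copow_beta d1 d2 d3 =>
    obtain ⟨d3', hd3'⟩ := d3.exists_subst0 R d1
    obtain ⟨d', h'⟩ := d3'.exists_ssubst R d2
    have h := (CEq.copow SFree.var (VEq.self (R := R) d1) (CEq.self d2)).copowlet SFree.var
      (CEq.self d3).lift_var
    rw [ssubst_ssubst] at h
    simp only [Tm.ssubst, (d1.sfree_cps R).ssubst_eq] at h
    rw [hd3'] at h'
    exact .ofC (h.trans (EEq.ssubst d2.eEq_uncurry_self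
      (EEq.beta_clam d3.eEq_uncurry_self d1.eEq_self))) h'
  | @copow_eta _ _ _ _ A B _ d e =>
    obtain ⟨e', he'⟩ := e.exists_shift R A
    obtain ⟨e1, h1⟩ := e'.exists_ssubst R (.copow _ _ _ _ _ _ (.var _ 0 A rfl) (.svar _ B))
    obtain ⟨e2, h2⟩ := e.exists_ssubst R d
    have h3 := h1.trans (EEq.ssubst
      (cEq_var.1 (CEq.copow SFree.var (VEq.var (.var 0 rfl)) CEq.svar)) e'.eEq_uncurry_self)
    refine .ofC ((CEq.self d).copowlet SFree.var (CEq.lift_var h3)) (h2.trans ?_)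
    refine EEq.ssubst d.eEq_uncurry_self (EEq.symm ?_)
    rw [he']
    exact EEq.eta_clam e.eEq_uncurry_self
  | czero_eta d e =>
    obtain ⟨e2, h2⟩ := e.exists_ssubst R d
    exact .ofC ((CEq.self d).cimage SFree.var)
      (h2.trans (EEq.ssubst d.eEq_uncurry_self (EEq.eta_cunit e.eEq_uncurry_self)))
  | csum_beta_inl du du' dt =>
    obtain ⟨e, h'⟩ := du.exists_ssubst R dt
    have h := ((CEq.self (R := R) dt).cinl SFree.var).ccase SFree.var (CEq.self du) (CEq.self du')
    rw [ssubst_ssubst] at h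
    exact .ofC (h.trans (EEq.ssubst dt.eEq_uncurry_self
      (EEq.beta_cfst du.eEq_uncurry_self du'.eEq_uncurry_self))) h'
  | csum_beta_inr du du' dt =>
    obtain ⟨e, h'⟩ := du'.exists_ssubst R dt
    have h := ((CEq.self (R := R) dt).cinr SFree.var).ccase SFree.var (CEq.self du) (CEq.self du')
    rw [ssubst_ssubst] at h
    exact .ofC (h.trans (EEq.ssubst dt.eEq_uncurry_self
      (EEq.beta_csnd du.eEq_uncurry_self du'.eEq_uncurry_self))) h'
  | csum_eta d e =>
    obtain ⟨e1, h1⟩ := e.exists_ssubst R (.cinl _ _ _ _ _ (.svar _ _))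
    obtain ⟨e2, h2⟩ := e.exists_ssubst R (.cinr _ _ _ _ _ (.svar _ _))
    obtain ⟨e3, h3⟩ := e.exists_ssubst R d
    have h1' := h1.trans (EEq.ssubst (cEq_var.1 (CEq.svar.cinl SFree.var)) e.eEq_uncurry_self)
    have h2' := h2.trans (EEq.ssubst (cEq_var.1 (CEq.svar.cinr SFree.var)) e.eEq_uncurry_self)
    exact .ofC ((CEq.self d).ccase SFree.var h1' h2') (h3.trans
      (EEq.ssubst d.eEq_uncurry_self (EEq.eta_cpair e.eEq_uncurry_self).symm))
  | llam_beta d e =>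
    obtain ⟨d', h'⟩ := d.exists_ssubst R e
    have h := EEq.beta_llam (d.eEq_uncurry_self (R := R)) EEq.svar
    rw [ssubst_svar] at h
    exact .ofC ((CEq.lapp SFree.var (VEq.llam (CEq.self d)) (CEq.self e)).trans
      (EEq.ssubst e.eEq_uncurry_self h)) h'
  | llam_eta d =>
    exact .ofV ((VEq.llam (CEq.lapp SFree.var (VEq.self (R := R) d) CEq.svar)).trans
      (EEq.eta_llam d.eEq_self)) (VEq.self (R := R) d)

theorem EEq.cpsEq (h : EEq Γ Δ t u A) (d : Deriv Γ Δ t A) (d' : Deriv Γ Δ u A) :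
    CpsEq R Γ Δ (cps R d) (cps R d') A := by
  obtain ⟨e, e', h⟩ := h.cpsSound R
  exact (d.cps_coherent e).trans (h.trans (e'.cps_coherent d'))

end

/-- **Soundness of the generic linear-use CPS self-translation of EEC**
(Theorem 5.2): (1) if `Γ ⊢ t = u : A` in the equational theory of EEC then
`Γᶜ ⊢ tᶜ = uᶜ : Aᶜ`; (2) if `Γ | z:A̲ ⊢ t = u : B̲` then
`Γᶜ | k_z:B̲ᶜ ⊢ tᶜ = uᶜ : A̲ᶜ`. -/
theorem cps_sound (R : CType) :
    (∀ (Γ : List VType) (t u : Tm) (A : VType),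
      EEq Γ none t u A →
      ∀ (dt : Deriv Γ none t A) (du : Deriv Γ none u A),
        EEq (cpsCtx R Γ) none (cps R dt) (cps R du) (cpsV R A)) ∧
    (∀ (Γ : List VType) (t u : Tm) (A B : CType),
      EEq Γ (some A) t u (.comp B) →
      ∀ (dt : Deriv Γ (some A) t (.comp B)) (du : Deriv Γ (some A) u (.comp B)),
        EEq (cpsCtx R Γ) (some (cpsC R B)) (cps R dt) (cps R du) (.comp (cpsC R A))) :=
  ⟨fun _ _ _ _ h dt du => (h.cpsEq dt du).1 rfl,
    fun _ _ _ _ _ h dt du => (h.cpsEq dt du).2 _ rfl⟩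

end EEC
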